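/- For every integer n ≥ 0, ζ⋆(1, 2, {1,3}^n) = −ζ(4n+3)/(−4)^n + (1/(3ζ(2))) · ∑_{a+b+c = 2n+1, a,b,c ≥ 0} (−1)^a(1 − 2^{2a})·16^{−n}·ζ(2a)ζ(2b)ζ(2c+3)·( 2·δ_{c even} + (2i)^{c+1}·δ_{c odd} − 8·4^c ), where the right-hand side is computed in ℂ (with i the imaginary unit) and equals the real left-hand side. -/

import Mathlib

/-- The monotone index sequence `n_0 ≤ n_1 ≤ ⋯` of positive integers parametrized by the
gap function `g`: `n i = 1 + g 0 + g 1 + ⋯ + g i`.  Every weakly increasing tuple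
`1 ≤ n_0 ≤ ⋯ ≤ n_{d−1}` arises from exactly one `g : Fin d → ℕ`. -/
def idxSeq {d : ℕ} (g : Fin d → ℕ) (i : Fin d) : ℕ :=
  1 + ∑ j ∈ Finset.univ.filter (· ≤ i), g j

/-- The multiple zeta star value
`ζ⋆(s₁,…,s_d) = ∑_{1 ≤ n₁ ≤ n₂ ≤ ⋯ ≤ n_d} 1/(n₁^{s₁} ⋯ n_d^{s_d})`. -/
noncomputable def zetaStar {d : ℕ} (s : Fin d → ℕ) : ℝ :=
  ∑' g : Fin d → ℕ, ∏ i, 1 / (idxSeq g i : ℝ) ^ s i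

/-- The repeating string `{1,3}^n`: entries alternate `1, 3, 1, 3, …` (length `2n`). -/
def pat13 (n : ℕ) : Fin (2 * n) → ℕ := fun i => if (i : ℕ) % 2 = 0 then 1 else 3

/-- connector -/
noncomputable def zsC (N : ℕ) : ℕ → ℝ
  | 0 => 1
  | k + 1 => zsC N k * ((N : ℝ) - k) / (N + k + 1)

/-- the sequence u -/
noncomputable def zsU : ℕ → ℕ → ℝ
  | 0, j => 2 / (j : ℝ) ^ 3
  | r + 1, j => (-1) ^ j / (j : ℝ) ^ 2 *
      (∑ i ∈ Finset.range (j + 1), zsU r i + ∑ i ∈ Finset.range j, zsU r i)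

/-- partial sums X -/
noncomputable def zsf : ℕ → ℕ → ℝ
  | 0, m => 1 / ((m : ℝ) + 1) ^ 2 * ∑ i ∈ Finset.range (m + 1), 1 / ((i : ℝ) + 1)
  | n + 1, j => 1 / ((j : ℝ) + 1) ^ 3 * ∑ i ∈ Finset.range (j + 1), 1 / ((i : ℝ) + 1) *
      ∑ m ∈ Finset.range (i + 1), zsf n m

lemma zsC_succ_mul (N k : ℕ) : ((N : ℝ) + k + 1) * zsC N (k + 1) = ((N : ℝ) - k) * zsC N k := by
  rw [zsC]
  have : (N : ℝ) + k + 1 ≠ 0 := by positivity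
  field_simp

lemma zsC_zero_of_lt (N k : ℕ) (h : N < k) : zsC N k = 0 := by
  induction k with
  | zero => omega
  | succ k ih =>
    rw [zsC]
    rcases Nat.lt_succ_iff_lt_or_eq.1 h with h | h
    · rw [ih h]; simp
    · subst h; simp

lemma zsC_bounds (N k : ℕ) : 0 ≤ zsC N k ∧ zsC N k ≤ 1 := by
  induction k with
  | zero => simp [zsC]
  | succ k ih =>
    by_cases h : N < k + 1
    · rw [zsC_zero_of_lt _ _ h]; simp
    · have h1 : (k : ℝ) + 1 ≤ N := by exact_mod_cast not_lt.1 h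
      have hk : (0 : ℝ) ≤ k := by positivity
      rw [zsC, mul_div_assoc]
      have h2 : 0 ≤ ((N : ℝ) - k) / (N + k + 1) := div_nonneg (by linarith) (by positivity)
      have h3 : ((N : ℝ) - k) / (N + k + 1) ≤ 1 := by
        rw [div_le_one (by positivity)]; linarith
      exact ⟨mul_nonneg ih.1 h2, mul_le_one₀ ih.2 h2 h3⟩

lemma zsC_tendsto (k : ℕ) : Filter.Tendsto (fun N => zsC N k) Filter.atTop (nhds 1) := by
  induction k with
  | zero => simp [zsC]
  | succ k ih =>
    have h : Filter.Tendsto (fun N : ℕ => ((N : ℝ) - k) / (N + k + 1)) Filter.atTop (nhds 1) := by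
      have h1 : Filter.Tendsto (fun N : ℕ => 1 - (2 * k + 1 : ℝ) / ((N : ℝ) + (k + 1))) Filter.atTop (nhds (1 - 0)) := by
        apply Filter.Tendsto.sub tendsto_const_nhds
        apply Filter.Tendsto.div_atTop tendsto_const_nhds
        exact Filter.tendsto_atTop_add_const_right _ _ tendsto_natCast_atTop_atTop
      rw [sub_zero] at h1
      refine h1.congr fun N => ?_
      have : (N : ℝ) + (k + 1) ≠ 0 := by positivity
      have : (N : ℝ) + k + 1 ≠ 0 := by positivity
      field_simp
      ring
    have := ih.mul h
    rw [mul_one] at this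
    refine this.congr fun N => ?_
    rw [zsC, mul_div_assoc]

/-- the two-row relation -/
lemma zsC_row (N k : ℕ) : ((N : ℝ) + 1) ^ 2 * zsC N k = (((N : ℝ) + 1) ^ 2 - (k : ℝ) ^ 2) * zsC (N + 1) k := by
  induction k with
  | zero => simp [zsC]
  | succ k ih =>
    have e1 := zsC_succ_mul N k
    have e2 := zsC_succ_mul (N + 1) k
    push_cast at e2 ⊢
    have h1 : (N : ℝ) + k + 1 ≠ 0 := by positivity
    have h2 : (N : ℝ) + 1 + k + 1 ≠ 0 := by positivity
    have f1 : zsC N (k+1) = ((N : ℝ) - k) * zsC N k / ((N : ℝ) + k + 1) := by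
      rw [← e1]; field_simp
    have f2 : zsC (N + 1) (k+1) = ((N : ℝ) + 1 - k) * zsC (N + 1) k / ((N : ℝ) + 1 + k + 1) := by
      rw [← e2]; field_simp
    rw [f1, f2]
    have h3 : ((N : ℝ) + 1) ^ 2 * (((N : ℝ) - k) * zsC N k / ((N : ℝ) + k + 1)) =
      (((N : ℝ) - k)  / ((N : ℝ) + k + 1)) * (((N : ℝ) + 1) ^ 2 * zsC N k) := by ring
    rw [h3, ih]
    field_simp
    ring

lemma zsC_diff (N k : ℕ) : zsC (N + 1) k - zsC N k = (k : ℝ) ^ 2 / ((N : ℝ) + 1) ^ 2 * zsC (N + 1) k := by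
  have := zsC_row N k
  have h1 : (N : ℝ) + 1 ≠ 0 := by positivity
  field_simp
  linarith

/-- summing over rows -/
lemma zsC_sum (J k : ℕ) (hk : 1 ≤ k) : ∑ i ∈ Finset.range J, 1 / ((i : ℝ) + 1) ^ 2 * zsC (i + 1) k = zsC J k / (k : ℝ) ^ 2 := by
  have hk0 : (k : ℝ) ≠ 0 := by positivity
  induction J with
  | zero => rw [zsC_zero_of_lt _ _ (by omega)]; simp
  | succ J ih =>
    rw [Finset.sum_range_succ, ih]
    have := zsC_diff J k
    have h1 : (J : ℝ) + 1 ≠ 0 := by positivity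
    field_simp
    field_simp at this
    linarith

/-- telescoping (i) -/
lemma zs_tel1 (m : ℕ) (s : ℕ → ℝ) (K : ℕ) :
    ∑ k ∈ Finset.range K, (((k : ℝ) + 1) * (s (k + 1) + s k) - m * (s (k + 1) - s k)) * zsC m (k + 1)
      = m * s 0 - ((m : ℝ) - K) * zsC m K * s K := by
  induction K with
  | zero => simp [zsC]
  | succ K ih =>
    rw [Finset.sum_range_succ, ih]
    have := zsC_succ_mul m K
    push_cast
    linear_combination s K * this

lemma zs_tel2 (m : ℕ) (s : ℕ → ℝ) (K : ℕ) :
    ∑ k ∈ Finset.range K, (-1 : ℝ) ^ (k + 1) * (((k : ℝ) + 1) * (s (k + 1) - s k) - m * (s (k + 1) + s k)) * zsC m (k + 1)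
      = m * s 0 - (-1) ^ K * ((m : ℝ) - K) * zsC m K * s K := by
  induction K with
  | zero => simp [zsC]
  | succ K ih =>
    rw [Finset.sum_range_succ, ih]
    have := zsC_succ_mul m K
    push_cast
    rw [pow_succ]
    linear_combination (-1) ^ K * s K * this

lemma zsU_zero (r : ℕ) : zsU r 0 = 0 := by
  cases r <;> simp [zsU]

/-- Step: X = sum a_k C, then sums -/
lemma zs_step (a b c : ℕ → ℝ) (X : ℕ → ℝ) (ha0 : a 0 = 0)
    (hb : ∀ j, b j = (-1) ^ j / (j : ℝ) ^ 2 *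
      (∑ i ∈ Finset.range (j + 1), a i + ∑ i ∈ Finset.range j, a i))
    (hc : ∀ j, c j = (-1) ^ j / (j : ℝ) ^ 2 *
      (∑ i ∈ Finset.range (j + 1), b i + ∑ i ∈ Finset.range j, b i))
    (hX : ∀ N K, N ≤ K → X N = ∑ k ∈ Finset.range K, a (k + 1) * zsC N (k + 1)) (N K : ℕ) (hNK : N ≤ K) :
    ∑ j ∈ Finset.range N, 1 / ((j : ℝ) + 1) ^ 3 * ∑ i ∈ Finset.range (j + 1), 1 / ((i : ℝ) + 1) * X (i + 1) =
      ∑ k ∈ Finset.range K, c (k + 1) * zsC N (k + 1) := by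
  have hb0 : b 0 = 0 := by rw [hb]; simp
  set S : ℕ → ℝ := fun j => ∑ i ∈ Finset.range (j + 1), a i with hS
  set B : ℕ → ℝ := fun j => ∑ i ∈ Finset.range (j + 1), b i with hB
  have hS0 : S 0 = 0 := by simp [hS, ha0]
  have hB0 : B 0 = 0 := by simp [hB, hb0]
  have hSs : ∀ k, a (k + 1) = S (k + 1) - S k := fun k => by
    simp only [hS]; rw [Finset.sum_range_succ _ (k + 1)]; ring
  have hBs : ∀ k, b (k + 1) = B (k + 1) - B k := fun k => by
    simp only [hB]; rw [Finset.sum_range_succ _ (k + 1)]; ring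
  have hb' : ∀ k, b (k + 1) = (-1) ^ (k + 1) / ((k : ℝ) + 1) ^ 2 * (S (k + 1) + S k) := fun k => by
    rw [hb]; push_cast; rfl
  have hc' : ∀ k, c (k + 1) = (-1) ^ (k + 1) / ((k : ℝ) + 1) ^ 2 * (B (k + 1) + B k) := fun k => by
    rw [hc]; push_cast; rfl
  -- first
  have e1 : ∀ i, i + 1 ≤ K → 1 / ((i : ℝ) + 1) * X (i + 1) = ∑ k ∈ Finset.range K,
      (((k : ℝ) + 1) * (S (k + 1) + S k)) * (1 / ((i : ℝ) + 1) ^ 2 * zsC (i + 1) (k + 1)) := by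
    intro i hi
    have h := zs_tel1 (i + 1) S K
    have hz : (((i + 1 : ℕ) : ℝ) - K) * zsC (i + 1) K = 0 := by
      rcases Nat.lt_or_eq_of_le hi with h | h
      · rw [zsC_zero_of_lt _ _ h]; simp
      · rw [← h]; simp
    rw [hS0, hz] at h
    have h2 : ((i : ℝ) + 1) * X (i + 1) = ∑ k ∈ Finset.range K,
      (((k : ℝ) + 1) * (S (k + 1) + S k)) * zsC (i + 1) (k + 1) := by
      rw [hX _ _ hi, Finset.mul_sum, ← sub_eq_zero, ← Finset.sum_sub_distrib, ← neg_eq_zero, ← Finset.sum_neg_distrib]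
      rw [mul_zero, zero_mul, sub_zero] at h
      rw [← h]
      refine Finset.sum_congr rfl fun k _ => ?_
      rw [hSs]; push_cast; ring
    have h1 : (i : ℝ) + 1 ≠ 0 := by positivity
    have h3 : 1 / ((i : ℝ) + 1) * X (i + 1) = 1 / ((i : ℝ) + 1) ^ 2 * (((i : ℝ) + 1) * X (i + 1)) := by
      field_simp
    rw [h3, h2, Finset.mul_sum]
    refine Finset.sum_congr rfl fun k _ => ?_
    ring
  have e2 : ∀ j, j + 1 ≤ K → ∑ i ∈ Finset.range (j + 1), 1 / ((i : ℝ) + 1) * X (i + 1) =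
      ∑ k ∈ Finset.range K, (-1 : ℝ) ^ (k + 1) * (((k : ℝ) + 1) * b (k + 1)) * zsC (j + 1) (k + 1) := by
    intro j hj
    rw [Finset.sum_congr rfl (fun i hi => e1 i (by have := Finset.mem_range.1 hi; omega)), Finset.sum_comm]
    refine Finset.sum_congr rfl fun k _ => ?_
    rw [← Finset.mul_sum, zsC_sum _ _ (by omega), hb']
    have h1 : (k : ℝ) + 1 ≠ 0 := by positivity
    push_cast
    have h4 : (-1 : ℝ) ^ (k + 1) * (-1) ^ (k + 1) = 1 := by rw [← mul_pow]; simp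
    field_simp
    rw [pow_two, h4, mul_one]
  have e3 : ∀ j, j + 1 ≤ K → 1 / ((j : ℝ) + 1) ^ 3 * ∑ i ∈ Finset.range (j + 1), 1 / ((i : ℝ) + 1) * X (i + 1) =
      ∑ k ∈ Finset.range K, ((-1 : ℝ) ^ (k + 1) * (B (k + 1) + B k)) * (1 / ((j : ℝ) + 1) ^ 2 * zsC (j + 1) (k + 1)) := by
    intro j hj
    rw [e2 j hj]
    have h := zs_tel2 (j + 1) B K
    have hz : (((j + 1 : ℕ) : ℝ) - K) * zsC (j + 1) K = 0 := by
      rcases Nat.lt_or_eq_of_le hj with h | h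
      · rw [zsC_zero_of_lt _ _ h]; simp
      · rw [← h]; simp
    rw [hB0, mul_assoc ((-1 : ℝ) ^ K), hz] at h
    have h2 : ∑ k ∈ Finset.range K, (-1 : ℝ) ^ (k + 1) * (((k : ℝ) + 1) * b (k + 1)) * zsC (j + 1) (k + 1) =
       ((j : ℝ) + 1) * ∑ k ∈ Finset.range K, ((-1 : ℝ) ^ (k + 1) * (B (k + 1) + B k)) * zsC (j + 1) (k + 1) := by
      rw [Finset.mul_sum, ← sub_eq_zero, ← Finset.sum_sub_distrib]
      rw [mul_zero, mul_zero, zero_mul, sub_zero] at h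
      rw [← h]
      refine Finset.sum_congr rfl fun k _ => ?_
      rw [hBs]; push_cast; ring
    rw [h2, Finset.mul_sum, Finset.mul_sum]
    refine Finset.sum_congr rfl fun k _ => ?_
    have h1 : (j : ℝ) + 1 ≠ 0 := by positivity
    field_simp
  rw [Finset.sum_congr rfl (fun j hj => e3 j (by have := Finset.mem_range.1 hj; omega)), Finset.sum_comm]
  refine Finset.sum_congr rfl fun k _ => ?_
  rw [← Finset.mul_sum, zsC_sum _ _ (by omega), hc']
  push_cast
  ring

lemma zs_harm (m K : ℕ) (h : m ≤ K) : ∑ i ∈ Finset.range m, 1 / ((i : ℝ) + 1) = ∑ k ∈ Finset.range K, 2 / ((k : ℝ) + 1) * zsC m (k + 1) := by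
  have e : ∀ i, i + 1 ≤ K → 1 / ((i : ℝ) + 1) = ∑ k ∈ Finset.range K, (2 * ((k : ℝ) + 1)) * (1 / ((i : ℝ) + 1) ^ 2 * zsC (i + 1) (k + 1)) := by
    intro i hi
    have h := zs_tel1 (i + 1) (fun _ => 1) K
    have hz : (((i + 1 : ℕ) : ℝ) - K) * zsC (i + 1) K = 0 := by
      rcases Nat.lt_or_eq_of_le hi with h | h
      · rw [zsC_zero_of_lt _ _ h]; simp
      · rw [← h]; simp
    rw [hz] at h
    have h1 : (i : ℝ) + 1 ≠ 0 := by positivity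
    have h3 : 1 / ((i : ℝ) + 1) = 1 / ((i : ℝ) + 1) ^ 2 * (((i + 1 : ℕ) : ℝ) * 1 - 0 * 1) := by
      push_cast; field_simp; ring
    rw [h3, ← h, Finset.mul_sum]
    refine Finset.sum_congr rfl fun k _ => ?_
    ring
  rw [Finset.sum_congr rfl (fun j hj => e j (by have := Finset.mem_range.1 hj; omega)), Finset.sum_comm]
  refine Finset.sum_congr rfl fun k _ => ?_
  rw [← Finset.mul_sum, zsC_sum _ _ (by omega)]
  have h1 : (k : ℝ) + 1 ≠ 0 := by positivity
  push_cast
  field_simp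

lemma zs_X (n : ℕ) : ∀ N K, N ≤ K → ∑ m ∈ Finset.range N, zsf n m = ∑ k ∈ Finset.range K, zsU (2 * n) (k + 1) * zsC N (k + 1) := by
  induction n with
  | zero =>
    intro N K h
    have e : ∀ m, m + 1 ≤ K → zsf 0 m = ∑ k ∈ Finset.range K, 2 / ((k : ℝ) + 1) * (1 / ((m : ℝ) + 1) ^ 2 * zsC (m + 1) (k + 1)) := by
      intro m hm
      rw [zsf, zs_harm _ _ hm, Finset.mul_sum]
      refine Finset.sum_congr rfl fun k _ => ?_
      ring
    rw [Finset.sum_congr rfl (fun j hj => e j (by have := Finset.mem_range.1 hj; omega)), Finset.sum_comm]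
    refine Finset.sum_congr rfl fun k _ => ?_
    rw [← Finset.mul_sum, zsC_sum _ _ (by omega), mul_zero, zsU]
    have h1 : (k : ℝ) + 1 ≠ 0 := by positivity
    push_cast
    field_simp
  | succ n ih =>
    intro N K h
    exact zs_step (zsU (2 * n)) (zsU (2 * n + 1)) (zsU (2 * n + 2)) (fun N => ∑ m ∈ Finset.range N, zsf n m)
      (zsU_zero _) (fun j => by rw [zsU]) (fun j => by rw [zsU]) ih N K h

lemma zsf_nonneg (n m : ℕ) : 0 ≤ zsf n m := by
  induction n generalizing m with
  | zero => rw [zsf]; positivity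
  | succ n ih =>
    rw [zsf]
    have : ∀ i, 0 ≤ ∑ m ∈ Finset.range (i + 1), zsf n m := fun i => Finset.sum_nonneg fun m _ => ih m
    refine mul_nonneg (by positivity) (Finset.sum_nonneg fun i _ => mul_nonneg (by positivity) (this i))

/-- absolute bounds for u -/
lemma zsU_bound (r : ℕ) : Summable (fun j => |zsU r j|) ∧ ∑' j, |zsU r j| ≤ 4 * 4 ^ r := by
  have hz2 : HasSum (fun n : ℕ => 1 / (n : ℝ) ^ 2) (Real.pi ^ 2 / 6) := hasSum_zeta_two
  have hpi : Real.pi ^ 2 / 6 ≤ 2 := by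
    have := Real.pi_lt_d2
    have := Real.pi_pos
    nlinarith
  induction r with
  | zero =>
    have h : ∀ j, |zsU 0 j| ≤ 2 * (1 / (j : ℝ) ^ 2) := by
      intro j
      rw [zsU, abs_of_nonneg (by positivity)]
      rcases Nat.eq_zero_or_pos j with h | h
      · subst h; simp
      · have h1 : (1 : ℝ) ≤ j := by exact_mod_cast h
        rw [← mul_div_assoc, mul_one]
        apply div_le_div_of_nonneg_left (by norm_num) (by positivity)
        exact pow_le_pow_right₀ h1 (by norm_num)
    have hs := Summable.of_nonneg_of_le (fun j => abs_nonneg _) h (hz2.summable.mul_left 2)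
    refine ⟨hs, ?_⟩
    calc _ ≤ ∑' j : ℕ, 2 * (1 / (j : ℝ) ^ 2) := hs.tsum_le_tsum h (hz2.summable.mul_left 2)
      _ = 2 * (Real.pi ^ 2 / 6) := by rw [tsum_mul_left, hz2.tsum_eq]
      _ ≤ _ := by norm_num; linarith
  | succ r ih =>
    set A := ∑' j, |zsU r j|
    have hp : ∀ j, |∑ i ∈ Finset.range j, zsU r i| ≤ A := fun j =>
      (Finset.abs_sum_le_sum_abs _ _).trans (ih.1.sum_le_tsum _ (fun i _ => abs_nonneg _))
    have h : ∀ j, |zsU (r + 1) j| ≤ (2 * A) * (1 / (j : ℝ) ^ 2) := by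
      intro j
      rw [zsU, abs_mul, abs_div, abs_pow, abs_neg, abs_one, one_pow, abs_of_nonneg (by positivity : (0 : ℝ) ≤ (j : ℝ) ^ 2), mul_comm]
      refine mul_le_mul_of_nonneg_right ((abs_add_le _ _).trans ?_) (by positivity)
      linarith [hp j, hp (j + 1)]
    have hs := Summable.of_nonneg_of_le (fun j => abs_nonneg _) h (hz2.summable.mul_left _)
    refine ⟨hs, ?_⟩
    have hA : 0 ≤ A := tsum_nonneg fun _ => abs_nonneg _
    calc _ ≤ ∑' j : ℕ, (2 * A) * (1 / (j : ℝ) ^ 2) := hs.tsum_le_tsum h (hz2.summable.mul_left _)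
      _ = (2 * A) * (Real.pi ^ 2 / 6) := by rw [tsum_mul_left, hz2.tsum_eq]
      _ ≤ (2 * A) * 2 := mul_le_mul_of_nonneg_left hpi (by positivity)
      _ ≤ _ := by rw [pow_succ]; linarith [ih.2]

lemma zsf_hasSum (n : ℕ) : HasSum (zsf n) (∑' j, zsU (2 * n) j) := by
  rw [hasSum_iff_tendsto_nat_of_nonneg (zsf_nonneg n)]
  have hs : Summable (zsU (2 * n)) := (zsU_bound (2 * n)).1.of_abs
  have e : ∀ N, ∑ m ∈ Finset.range N, zsf n m = ∑' k, zsU (2 * n) k * zsC N k := by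
    intro N
    have e1 : ∀ N K, N ≤ K → ∑ m ∈ Finset.range N, zsf n m = ∑ k ∈ Finset.range (K + 1), zsU (2 * n) k * zsC N k := by
      intro N K h
      rw [zs_X n N K h, Finset.sum_range_succ' _ K, zsU_zero]; simp
    rw [e1 N N le_rfl, tsum_eq_sum]
    intro b hb
    rw [zsC_zero_of_lt _ _ (by have := Finset.mem_range.not.1 hb; omega), mul_zero]
  simp_rw [e]
  refine tendsto_tsum_of_dominated_convergence (bound := fun k => |zsU (2 * n) k|) (zsU_bound (2 * n)).1 ?_ ?_
  · intro k
    simpa using (zsC_tendsto k).const_mul (zsU (2 * n) k)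
  · refine Filter.Eventually.of_forall fun N k => ?_
    rw [Real.norm_eq_abs, abs_mul, abs_of_nonneg (zsC_bounds N k).1]
    exact mul_le_of_le_one_right (abs_nonneg _) (zsC_bounds N k).2

open scoped ENNReal in
/-- ENNReal version with starting point m+1 -/
noncomputable def zsE {d : ℕ} (m : ℕ) (s : Fin d → ℕ) : ℝ≥0∞ :=
  ∑' g : Fin d → ℕ, ∏ i, ENNReal.ofReal (1 / ((m + idxSeq g i : ℕ) : ℝ) ^ s i)

lemma idxSeq_cons_zero {d : ℕ} (a : ℕ) (g : Fin d → ℕ) :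
    idxSeq (Fin.cons a g : Fin (d + 1) → ℕ) 0 = 1 + a := by
  unfold idxSeq
  have : (Finset.univ.filter (fun j : Fin (d + 1) => j ≤ 0)) = {0} := by
    ext j; simp
  rw [this]; simp

lemma idxSeq_cons_succ {d : ℕ} (a : ℕ) (g : Fin d → ℕ) (i : Fin d) :
    idxSeq (Fin.cons a g : Fin (d + 1) → ℕ) i.succ = a + idxSeq g i := by
  unfold idxSeq
  rw [Finset.sum_filter, Finset.sum_filter, Fin.sum_univ_succ]
  simp
  ring

open scoped ENNReal in
lemma zsE_cons {d : ℕ} (m a : ℕ) (s : Fin d → ℕ) :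
    zsE m (Fin.cons a s : Fin (d + 1) → ℕ) =
      ∑' g : ℕ, ENNReal.ofReal (1 / (((m + g : ℕ) : ℝ) + 1) ^ a) * zsE (m + g) s := by
  unfold zsE
  rw [← (Fin.consEquiv (fun _ : Fin (d + 1) => ℕ)).tsum_eq, ENNReal.tsum_prod']
  refine tsum_congr fun g => ?_
  rw [← ENNReal.tsum_mul_left]
  refine tsum_congr fun h => ?_
  rw [Fin.prod_univ_succ]
  have hc : (Fin.consEquiv (fun _ : Fin (d + 1) => ℕ)) (g, h) = Fin.cons g h := rfl
  rw [hc]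
  simp only [Fin.cons_zero, Fin.cons_succ, idxSeq_cons_zero, idxSeq_cons_succ]
  congr 1
  · push_cast; ring_nf
  · refine Finset.prod_congr rfl fun i _ => ?_
    rw [add_assoc]

open scoped ENNReal in
lemma zs_swap (a b : ℕ → ℝ≥0∞) : ∑' m : ℕ, a m * ∑' g : ℕ, b (m + g) =
    ∑' j : ℕ, (∑ i ∈ Finset.range (j + 1), a i) * b j := by
  simp_rw [← ENNReal.tsum_mul_left]
  rw [← ENNReal.tsum_prod (f := fun m g => a m * b (m + g)),
    ← (Finset.HasAntidiagonal.sigmaAntidiagonalEquivProd (A := ℕ)).tsum_eq, ENNReal.tsum_sigma']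
  refine tsum_congr fun j => ?_
  rw [tsum_fintype, Finset.sum_mul]
  rw [← Finset.Nat.sum_antidiagonal_eq_sum_range_succ_mk (fun p => a p.1 * b j)]
  rw [← Finset.sum_coe_sort (Finset.HasAntidiagonal.antidiagonal j) (fun p => a p.1 * b j)]
  refine Finset.sum_congr rfl fun p _ => ?_
  have := Finset.HasAntidiagonal.mem_antidiagonal.1 p.2
  simp [this]

lemma pat13_succ (n : ℕ) : pat13 (n + 1) = (Fin.cons 1 (Fin.cons 3 (pat13 n) : Fin (2 * n + 1) → ℕ) : Fin (2 * n + 2) → ℕ) := by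
  funext i
  refine Fin.cases ?_ (fun i => ?_) i
  · simp [pat13]
  · refine Fin.cases ?_ (fun i => ?_) i
    · simp [pat13]
    · simp only [Fin.cons_succ, pat13, Fin.val_succ]
      have : ((i : ℕ) + 1 + 1) % 2 = (i : ℕ) % 2 := by omega
      simp only [this]

open scoped ENNReal in
lemma zsE_pat (n : ℕ) : ∀ k, ∑' m, ENNReal.ofReal (zsf k m) * zsE m (pat13 n) = ∑' m, ENNReal.ofReal (zsf (k + n) m) := by
  induction n with
  | zero =>
    intro k
    refine tsum_congr fun m => ?_
    have : zsE m (pat13 0) = 1 := by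
      unfold zsE
      simp
    rw [this, mul_one, add_zero]
  | succ n ih =>
    intro k
    rw [← add_assoc, add_right_comm, ← ih (k + 1)]
    have e : ∀ m, zsE m (pat13 (n + 1)) = ∑' g : ℕ, (fun j => ENNReal.ofReal (1 / ((j : ℕ) + 1 : ℝ) ^ 1) *
      ∑' h : ℕ, (fun j => ENNReal.ofReal (1 / ((j : ℕ) + 1 : ℝ) ^ 3) * zsE j (pat13 n)) (j + h)) (m + g) := by
      intro m
      rw [pat13_succ, zsE_cons]
      refine tsum_congr fun g => ?_
      rw [zsE_cons]
    simp_rw [e]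
    refine (zs_swap (fun m => ENNReal.ofReal (zsf k m)) (fun j => ENNReal.ofReal (1 / ((j : ℕ) + 1 : ℝ) ^ 1) *
      ∑' h : ℕ, (fun j => ENNReal.ofReal (1 / ((j : ℕ) + 1 : ℝ) ^ 3) * zsE j (pat13 n)) (j + h))).trans ?_
    simp_rw [← mul_assoc]
    refine (zs_swap (fun j => (∑ m ∈ Finset.range (j + 1), ENNReal.ofReal (zsf k m)) * ENNReal.ofReal (1 / ((j : ℕ) + 1 : ℝ) ^ 1))
      (fun j => ENNReal.ofReal (1 / ((j : ℕ) + 1 : ℝ) ^ 3) * zsE j (pat13 n))).trans ?_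
    refine tsum_congr fun j => ?_
    rw [← mul_assoc]
    congr 1
    rw [zsf, mul_comm, ENNReal.ofReal_mul (by positivity), ENNReal.ofReal_sum_of_nonneg]
    · congr 1
      refine Finset.sum_congr rfl fun i _ => ?_
      rw [ENNReal.ofReal_mul (by positivity), pow_one, mul_comm, ENNReal.ofReal_sum_of_nonneg]
      exact fun i _ => zsf_nonneg _ _
    · exact fun i _ => mul_nonneg (by positivity) (Finset.sum_nonneg fun m _ => zsf_nonneg _ _)

lemma zetaStar_eq_toReal {d : ℕ} (s : Fin d → ℕ) : zetaStar s = (zsE 0 s).toReal := by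
  unfold zetaStar zsE
  have e : ∀ g : Fin d → ℕ, ∏ i, 1 / (idxSeq g i : ℝ) ^ s i =
      (∏ i, ENNReal.ofReal (1 / ((0 + idxSeq g i : ℕ) : ℝ) ^ s i)).toReal := by
    intro g
    rw [ENNReal.toReal_prod]
    refine Finset.prod_congr rfl fun i _ => ?_
    rw [ENNReal.toReal_ofReal (by positivity), zero_add]
  simp_rw [e]
  rw [ENNReal.tsum_toReal_eq]
  intro g
  exact ENNReal.prod_ne_top fun i _ => ENNReal.ofReal_ne_top

/-- Part A -/
theorem zs_partA (n : ℕ) :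
    zetaStar (Fin.cons 1 (Fin.cons 2 (pat13 n))) = ∑' j, zsU (2 * n) j := by
  rw [zetaStar_eq_toReal]
  have e : zsE 0 (Fin.cons 1 (Fin.cons 2 (pat13 n))) = ∑' m, ENNReal.ofReal (zsf n m) := by
    have h0 := zsE_pat n 0
    rw [zero_add] at h0
    rw [← h0, zsE_cons]
    have : ∀ g, ENNReal.ofReal (1 / (((0 + g : ℕ) : ℝ) + 1) ^ 1) * zsE (0 + g) (Fin.cons 2 (pat13 n)) =
      (fun j : ℕ => ENNReal.ofReal (1 / ((j : ℝ) + 1) ^ 1)) g * 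
        ∑' h, (fun j : ℕ => ENNReal.ofReal (1 / ((j : ℝ) + 1) ^ 2) * zsE j (pat13 n)) (g + h) := by
      intro g
      rw [zsE_cons, zero_add]
    rw [tsum_congr this]
    refine (zs_swap (fun j : ℕ => ENNReal.ofReal (1 / ((j : ℝ) + 1) ^ 1)) (fun j : ℕ => ENNReal.ofReal (1 / ((j : ℝ) + 1) ^ 2) * zsE j (pat13 n))).trans ?_
    refine tsum_congr fun j => ?_
    rw [← mul_assoc]
    congr 1
    rw [zsf, mul_comm, ENNReal.ofReal_mul (by positivity), ENNReal.ofReal_sum_of_nonneg]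
    · simp
    · intro i _; positivity
  rw [e, ← (zsf_hasSum n).tsum_eq, ← ENNReal.ofReal_tsum_of_nonneg (zsf_nonneg n) (zsf_hasSum n).summable,
    ENNReal.toReal_ofReal (tsum_nonneg (zsf_nonneg n))]

lemma zsU_psum_bound (r j : ℕ) : |∑ i ∈ Finset.range j, zsU r i| ≤ 4 * 4 ^ r :=
  ((Finset.abs_sum_le_sum_abs _ _).trans ((zsU_bound r).1.sum_le_tsum _ (fun i _ => abs_nonneg _))).trans
    (zsU_bound r).2

lemma zs_geom (x : ℝ) (hx : |x| < 1 / 8) : Summable (fun r : ℕ => |x| ^ r * (4 * 4 ^ r)) := by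
  have : (fun r : ℕ => |x| ^ r * (4 * 4 ^ r)) = fun r : ℕ => 4 * (|x| * 4) ^ r := by
    funext r; rw [mul_pow]; ring
  rw [this]
  apply Summable.mul_left
  apply summable_geometric_of_lt_one (by positivity)
  linarith

lemma zsU_tsum_bound (r : ℕ) : |∑' j, zsU r j| ≤ 4 * 4 ^ r := by
  have h := norm_tsum_le_tsum_norm (f := zsU r) (by simpa using (zsU_bound r).1)
  simp only [Real.norm_eq_abs] at h
  exact h.trans (zsU_bound r).2

lemma zs_V_summable (x : ℝ) (hx : |x| < 1 / 8) : Summable (fun r : ℕ => x ^ r * ∑' j, zsU r j) := by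
  refine Summable.of_norm_bounded (zs_geom x hx) fun r => ?_
  rw [Real.norm_eq_abs, abs_mul, abs_pow]
  exact mul_le_mul_of_nonneg_left (zsU_tsum_bound r) (by positivity)

lemma zs_s (x : ℝ) (hx : |x| < 1 / 8) : ∃ s : ℕ → ℝ, s 0 = 0 ∧
    (∀ j : ℕ, s (j + 1) - s j = 2 / ((j : ℝ) + 1) ^ 3 + x * (-1) ^ (j + 1) / ((j : ℝ) + 1) ^ 2 * (s (j + 1) + s j)) ∧
    Filter.Tendsto s Filter.atTop (nhds (∑' r : ℕ, x ^ r * ∑' j, zsU r j)) := by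
  have hS : ∀ j, Summable (fun r : ℕ => x ^ r * ∑ i ∈ Finset.range (j + 1), zsU r i) := fun j => by
    refine Summable.of_norm_bounded (zs_geom x hx) fun r => ?_
    rw [Real.norm_eq_abs, abs_mul, abs_pow]
    exact mul_le_mul_of_nonneg_left (zsU_psum_bound r _) (by positivity)
  refine ⟨fun j => ∑' r : ℕ, x ^ r * ∑ i ∈ Finset.range (j + 1), zsU r i, ?_, ?_, ?_⟩
  · simp [zsU_zero]
  · intro j
    simp only
    rw [← (hS _).tsum_sub (hS _), ← (hS _).tsum_add (hS _), ← tsum_mul_left]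
    have hsub : Summable (fun r : ℕ => x ^ r * zsU r (j + 1)) := by
      refine ((hS (j + 1)).sub (hS j)).congr fun r => ?_
      rw [Finset.sum_range_succ _ (j + 1)]; ring
    have e1 : ∀ r : ℕ, x ^ r * ∑ i ∈ Finset.range (j + 1 + 1), zsU r i - x ^ r * ∑ i ∈ Finset.range (j + 1), zsU r i = x ^ r * zsU r (j + 1) := by
      intro r
      rw [Finset.sum_range_succ _ (j + 1)]; ring
    simp_rw [e1]
    rw [hsub.tsum_eq_zero_add]
    congr 1
    · simp [zsU]
    · refine tsum_congr fun r => ?_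
      rw [zsU, pow_succ x]
      push_cast
      ring
  · refine tendsto_tsum_of_dominated_convergence (zs_geom x hx) ?_ ?_
    · intro r
      apply Filter.Tendsto.const_mul
      exact ((zsU_bound r).1.of_abs.hasSum.tendsto_sum_nat).comp (Filter.tendsto_add_atTop_nat 1)
    · refine Filter.Eventually.of_forall fun N r => ?_
      rw [Real.norm_eq_abs, abs_mul, abs_pow]
      exact mul_le_mul_of_nonneg_left (zsU_psum_bound r _) (by positivity)

lemma zs_tel (x : ℝ) (hx : |x| < 1) (s P : ℕ → ℝ) (hs0 : s 0 = 0)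
    (hs : ∀ j : ℕ, s (j + 1) - s j = 2 / ((j : ℝ) + 1) ^ 3 + x * (-1) ^ (j + 1) / ((j : ℝ) + 1) ^ 2 * (s (j + 1) + s j))
    (hP : ∀ j : ℕ, P (j + 1) * (((j : ℝ) + 1) ^ 2 + x * (-1) ^ (j + 1)) = P j * (((j : ℝ) + 1) ^ 2 - x * (-1) ^ (j + 1)))
    (N : ℕ) : x * (P (N + 1) * s (N + 1)) = -(P 0 + ∑ k ∈ Finset.range N, (-1) ^ (k + 1) * P (k + 1) * (1 / ((k : ℝ) + 1) + 1 / ((k : ℝ) + 2))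
      + (-1) ^ (N + 1) * P (N + 1) / ((N : ℝ) + 1)) := by
  have key : ∀ j : ℕ, x * (P (j + 1) * s (j + 1)) = x * (P j * s j) + (-1) ^ (j + 1) * (P j - P (j + 1)) / ((j : ℝ) + 1) := by
    intro j
    have h1 : (j : ℝ) + 1 ≠ 0 := by positivity
    have hj : (1 : ℝ) ≤ (j : ℝ) + 1 := by have : (0 : ℝ) ≤ j := by positivity
                                          linarith
    have hj2 : (1 : ℝ) ≤ ((j : ℝ) + 1) ^ 2 := one_le_pow₀ hj
    have he : (-1 : ℝ) ^ (j + 1) = 1 ∨ (-1 : ℝ) ^ (j + 1) = -1 := neg_one_pow_eq_or ℝ (j + 1)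
    have h2 : ((j : ℝ) + 1) ^ 2 + x * (-1) ^ (j + 1) ≠ 0 := by
      have := abs_lt.1 hx
      rcases he with h | h <;> rw [h] <;> nlinarith
    have e2 : ((-1 : ℝ) ^ (j + 1)) ^ 2 = 1 := by rcases he with h | h <;> rw [h] <;> norm_num
    have a1 := hs j
    have a2 := hP j
    generalize (-1 : ℝ) ^ (j + 1) = e at *
    generalize (j : ℝ) + 1 = t at *
    have a1' : t * (t ^ 2 - x * e) * s (j + 1) = t * (t ^ 2 + x * e) * s j + 2 := by
      field_simp at a1
      linear_combination a1
    have goal' : (t ^ 2 + x * e) * (t * (x * (P (j + 1) * s (j + 1)))) = (t ^ 2 + x * e) * (t * (x * (P j * s j)) + e * (P j - P (j + 1))) := by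
      linear_combination (x * P j) * a1' + (x * t * s (j + 1) + e) * a2 - (2 * P j * x) * e2
    have := mul_left_cancel₀ h2 goal'
    field_simp
    linear_combination this
  induction N with
  | zero =>
    rw [key 0, hs0]; simp; ring
  | succ N ih =>
    rw [key (N + 1), ih, Finset.sum_range_succ]
    have h1 : (N : ℝ) + 1 ≠ 0 := by positivity
    have h2 : (N : ℝ) + 2 ≠ 0 := by positivity
    have h3 : (N : ℝ) + 1 + 1 ≠ 0 := by positivity
    push_cast
    rw [show (N : ℝ) + 1 + 1 = N + 2 by ring, pow_succ _ (N + 1)]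
    field_simp
    ring

lemma zs_even_part (f : ℕ → ℝ) (x : ℝ) (h1 : Summable fun r : ℕ => x ^ r * f r) (h2 : Summable fun r : ℕ => (-x) ^ r * f r) :
    (∑' r : ℕ, x ^ r * f r) + (∑' r : ℕ, (-x) ^ r * f r) = 2 * ∑' n : ℕ, x ^ (2 * n) * f (2 * n) := by
  rw [← h1.tsum_add h2]
  have s3 := h1.add h2
  have inj : Function.Injective (fun n : ℕ => 2 * n) := fun a b h => by simpa using h
  have inj' : Function.Injective (fun n : ℕ => 2 * n + 1) := fun a b h => by simpa using h
  have e := tsum_even_add_odd (f := fun r => x ^ r * f r + (-x) ^ r * f r) (s3.comp_injective inj) (s3.comp_injective inj')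
  rw [← e]
  have : ∀ k : ℕ, x ^ (2 * k + 1) * f (2 * k + 1) + (-x) ^ (2 * k + 1) * f (2 * k + 1) = 0 := by
    intro k
    rw [Odd.neg_pow ⟨k, rfl⟩]; ring
  simp_rw [this]
  rw [tsum_zero, add_zero, ← tsum_mul_left]
  refine tsum_congr fun k => ?_
  rw [Even.neg_pow ⟨k, by ring⟩]; ring

theorem zs_partB (x : ℝ) (hx0 : 0 < x) (hx : x < 1 / 8) (p : ℕ → ℝ) (hp : ∀ k, 0 < p k)
    (hrec : ∀ k : ℕ, p (k + 1) * p k = (((k : ℝ) + 1) ^ 2 - x) / (((k : ℝ) + 1) ^ 2 + x))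
    (hlim : Filter.Tendsto p Filter.atTop (nhds 1)) :
    Filter.Tendsto (fun N => ∑ k ∈ Finset.range N, (p (k + 1) - 1 / p (k + 1)) * (1 / ((k : ℝ) + 1) + 1 / ((k : ℝ) + 2)))
      Filter.atTop (nhds (-(2 * x * ∑' n : ℕ, x ^ (2 * n) * ∑' j, zsU (2 * n) j) - (p 0 - 1 / p 0))) := by
  have hxa : |x| < 1 / 8 := by rwa [abs_of_pos hx0]
  have hxa' : |(-x)| < 1 / 8 := by rwa [abs_neg]
  obtain ⟨s, hs0, hs, hsl⟩ := zs_s x hxa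
  obtain ⟨t, ht0, ht, htl⟩ := zs_s (-x) hxa'
  set P : ℕ → ℝ := fun k => if Even k then p k else 1 / p k with hPdef
  have hP0 : ∀ k, P k ≠ 0 := by
    intro k; simp only [hPdef]; split_ifs
    · exact (hp k).ne'
    · exact one_div_ne_zero (hp k).ne'
  have hPl : Filter.Tendsto P Filter.atTop (nhds 1) := by
    have h1 : Filter.Tendsto (fun k => 1 / p k) Filter.atTop (nhds 1) := by
      simpa using (hlim.inv₀ one_ne_zero)
    rw [Metric.tendsto_atTop] at *
    intro ε he
    obtain ⟨N1, h1⟩ := h1 ε he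
    obtain ⟨N2, h2⟩ := hlim ε he
    refine ⟨max N1 N2, fun n hn => ?_⟩
    simp only [hPdef]; split_ifs
    · exact h2 n (le_trans (le_max_right _ _) hn)
    · exact h1 n (le_trans (le_max_left _ _) hn)
  have hPil : Filter.Tendsto (fun k => (P k)⁻¹) Filter.atTop (nhds 1) := by
    simpa using (hPl.inv₀ one_ne_zero)
  have hP : ∀ j : ℕ, P (j + 1) * (((j : ℝ) + 1) ^ 2 + x * (-1) ^ (j + 1)) = P j * (((j : ℝ) + 1) ^ 2 - x * (-1) ^ (j + 1)) := by
    intro j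
    have a := hrec j
    have hj : (1 : ℝ) ≤ ((j : ℝ) + 1) ^ 2 := one_le_pow₀ (by have : (0 : ℝ) ≤ j := by positivity
                                                             linarith)
    have h1 : ((j : ℝ) + 1) ^ 2 + x ≠ 0 := by positivity
    have p1 := (hp j).ne'
    have p2 := (hp (j + 1)).ne'
    rw [eq_div_iff h1] at a
    simp only [hPdef]
    rcases Nat.even_or_odd j with h | h
    · have h' : ¬ Even (j + 1) := by rw [Nat.even_add_one]; simpa using h
      rw [if_pos h, if_neg h', (Nat.not_even_iff_odd.1 h').neg_one_pow]
      field_simp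
      linear_combination -a
    · have h' : Even (j + 1) := by rw [Nat.even_add_one]; simpa using h
      rw [if_pos h', if_neg (by simpa using h), h'.neg_one_pow]
      field_simp
      linear_combination a
  have hPi : ∀ j : ℕ, (P (j + 1))⁻¹ * (((j : ℝ) + 1) ^ 2 + (-x) * (-1) ^ (j + 1)) = (P j)⁻¹ * (((j : ℝ) + 1) ^ 2 - (-x) * (-1) ^ (j + 1)) := by
    intro j
    have := hP j
    have h1 := hP0 j
    have h2 := hP0 (j + 1)
    field_simp
    linear_combination -this
  have T1 := zs_tel x (hxa.trans (by norm_num)) s P hs0 hs hP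
  have T2 := zs_tel (-x) (hxa'.trans (by norm_num)) t (fun k => (P k)⁻¹) ht0 ht hPi
  have hV := zs_even_part (fun r => ∑' j, zsU r j) x (zs_V_summable x hxa) (zs_V_summable (-x) hxa')
  have e : ∀ N : ℕ, ∑ k ∈ Finset.range N, (p (k + 1) - 1 / p (k + 1)) * (1 / ((k : ℝ) + 1) + 1 / ((k : ℝ) + 2)) =
      -(x * (P (N + 1) * s (N + 1) + (P (N + 1))⁻¹ * t (N + 1))) - (p 0 - 1 / p 0)
        - ((-1) ^ (N + 1) * (1 / ((N : ℝ) + 1))) * (P (N + 1) - (P (N + 1))⁻¹) := by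
    intro N
    have a := T1 N
    have b := T2 N
    have c : ∑ k ∈ Finset.range N, (p (k + 1) - 1 / p (k + 1)) * (1 / ((k : ℝ) + 1) + 1 / ((k : ℝ) + 2)) =
      ∑ k ∈ Finset.range N, (-1) ^ (k + 1) * P (k + 1) * (1 / ((k : ℝ) + 1) + 1 / ((k : ℝ) + 2)) -
      ∑ k ∈ Finset.range N, (-1) ^ (k + 1) * (P (k + 1))⁻¹ * (1 / ((k : ℝ) + 1) + 1 / ((k : ℝ) + 2)) := by
      rw [← Finset.sum_sub_distrib]
      refine Finset.sum_congr rfl fun k _ => ?_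
      simp only [hPdef]
      rcases Nat.even_or_odd (k + 1) with h | h
      · rw [if_pos h, h.neg_one_pow]; ring
      · rw [if_neg (by simpa using h), h.neg_one_pow, one_div, inv_inv]; ring
    have d : P 0 = p 0 := by simp [hPdef]
    rw [c]
    simp only [d] at a b
    rw [one_div (p 0)]
    linear_combination a - b
  simp_rw [e]
  have l1 : Filter.Tendsto (fun N : ℕ => ((-1 : ℝ) ^ (N + 1) * (1 / ((N : ℝ) + 1))) * (P (N + 1) - (P (N + 1))⁻¹)) Filter.atTop (nhds 0) := by
    have l2 : Filter.Tendsto (fun N : ℕ => P (N + 1) - (P (N + 1))⁻¹) Filter.atTop (nhds (1 - 1)) :=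
      (hPl.comp (Filter.tendsto_add_atTop_nat 1)).sub (hPil.comp (Filter.tendsto_add_atTop_nat 1))
    have l3 : Filter.Tendsto (fun N : ℕ => (-1 : ℝ) ^ (N + 1) * (1 / ((N : ℝ) + 1))) Filter.atTop (nhds 0) := by
      apply squeeze_zero_norm (a := fun N : ℕ => 1 / ((N : ℝ) + 1)) _ tendsto_one_div_add_atTop_nhds_zero_nat
      intro N
      rw [norm_mul, norm_pow, norm_neg, norm_one, one_pow, one_mul, Real.norm_of_nonneg (by positivity)]
    simpa using l3.mul l2
  have l4 := ((((hPl.comp (Filter.tendsto_add_atTop_nat 1)).mul (hsl.comp (Filter.tendsto_add_atTop_nat 1))).add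
     ((hPil.comp (Filter.tendsto_add_atTop_nat 1)).mul (htl.comp (Filter.tendsto_add_atTop_nat 1)))).const_mul x).neg
  have l5 := (l4.sub_const (p 0 - 1 / p 0)).sub l1
  rw [one_mul, one_mul, hV, sub_zero] at l5
  rw [show 2 * x * ∑' n : ℕ, x ^ (2 * n) * ∑' j, zsU (2 * n) j = x * (2 * ∑' n : ℕ, x ^ (2 * n) * ∑' j, zsU (2 * n) j) by ring]
  exact l5

/-- the sequence p(γ,k) -/
noncomputable def zsP (x ρ γ : ℝ) : ℕ → ℝ
  | 0 => γ * ρ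
  | k + 1 => (((k : ℝ) + 1) ^ 2 - γ ^ 2) / (((k : ℝ) + 1) ^ 2 + x) / zsP x ρ γ k

/-- weights -/
noncomputable def zsw (k : ℕ) : ℝ := 1 / ((k : ℝ) + 1) + 1 / ((k : ℝ) + 2)

/-- partial sums -/
noncomputable def zsS (x ρ γ : ℝ) (N : ℕ) : ℝ :=
  ∑ k ∈ Finset.range N, (zsP x ρ γ (k + 1) - 1 / zsP x ρ γ (k + 1)) * zsw k

lemma zs_ni_sub {γ : ℝ} (h : ∀ m : ℤ, (m : ℝ) ≠ γ) (k : ℤ) : (k : ℝ) - γ ≠ 0 := sub_ne_zero.2 (h k)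

lemma zs_ni_add {γ : ℝ} (h : ∀ m : ℤ, (m : ℝ) ≠ γ) (k : ℤ) : (k : ℝ) + γ ≠ 0 := by
  intro e; apply h (-k); push_cast; linarith

lemma zs_ni_shift {γ : ℝ} (h : ∀ m : ℤ, (m : ℝ) ≠ γ) (m : ℤ) : (m : ℝ) ≠ γ + 2 := by
  intro e; apply h (m - 2); push_cast; linarith

lemma zs_ni_neg {γ : ℝ} (h : ∀ m : ℤ, (m : ℝ) ≠ γ) (m : ℤ) : (m : ℝ) ≠ -γ := by
  intro e; apply h (-m); push_cast; linarith

lemma zs_ni_sq {γ : ℝ} (h : ∀ m : ℤ, (m : ℝ) ≠ γ) (k : ℕ) : ((k : ℝ) + 1) ^ 2 - γ ^ 2 ≠ 0 := by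
  have h1 := zs_ni_sub h (k + 1)
  have h2 := zs_ni_add h (k + 1)
  push_cast at h1 h2
  rw [sq_sub_sq]
  exact mul_ne_zero h2 h1

lemma zsP_ne {x ρ γ : ℝ} (hx : 0 < x) (hρ : ρ ≠ 0) (h : ∀ m : ℤ, (m : ℝ) ≠ γ) (k : ℕ) : zsP x ρ γ k ≠ 0 := by
  induction k with
  | zero =>
    have := h 0
    rw [zsP]
    refine mul_ne_zero ?_ hρ
    intro e; apply this; simp [e]
  | succ k ih =>
    rw [zsP]
    exact div_ne_zero (div_ne_zero (zs_ni_sq h k) (by positivity)) ih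

lemma zsP_rec {x ρ γ : ℝ} (hx : 0 < x) (hρ : ρ ≠ 0) (h : ∀ m : ℤ, (m : ℝ) ≠ γ) (k : ℕ) :
    zsP x ρ γ (k + 1) * zsP x ρ γ k = (((k : ℝ) + 1) ^ 2 - γ ^ 2) / (((k : ℝ) + 1) ^ 2 + x) := by
  have := zsP_ne hx hρ h k
  rw [zsP]
  field_simp

lemma zsP_neg (x ρ γ : ℝ) (k : ℕ) : zsP x (-ρ) (-γ) k = zsP x ρ γ k := by
  induction k with
  | zero => simp [zsP]
  | succ k ih => rw [zsP, zsP, ih]; ring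

lemma zsP_shift {x ρ γ : ℝ} (hx : 0 < x) (hρ : ρ ≠ 0) (h : ∀ m : ℤ, (m : ℝ) ≠ γ) (k : ℕ) :
    zsP x ρ (γ + 2) k = zsP x ρ γ k * (((k : ℝ) - 1 - γ) * (k + 2 + γ) / ((k + 1 + γ) * (k - γ))) := by
  induction k with
  | zero =>
    have h0 := zs_ni_sub h 0
    have h1 := zs_ni_add h 1
    push_cast at h0 h1 ⊢
    rw [zsP, zsP]
    have h0' : γ ≠ 0 := by intro e; apply h0; simp [e]
    have h1' : 0 + 1 + γ ≠ 0 := by rwa [zero_add]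
    field_simp
    ring
  | succ k ih =>
    have n0 := zsP_ne hx hρ h k
    have a1 := zs_ni_sub h k
    have a2 := zs_ni_sub h (k + 1)
    have a0 := zs_ni_sub h (k - 1)
    have b1 := zs_ni_add h (k + 1)
    have b2 := zs_ni_add h (k + 2)
    have b3 := zs_ni_add h (k + 3)
    rw [zsP, zsP, ih]
    have hk : (0 : ℝ) < ((k : ℝ) + 1) ^ 2 + x := by positivity
    push_cast at *
    have b2' : (k : ℝ) + 1 + 1 + γ ≠ 0 := by intro e; apply b2; linarith
    have a0' : (k : ℝ) - 1 - γ ≠ 0 := by intro e; apply a0; linarith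
    have e1 : ((k : ℝ) + 1) ^ 2 - (γ + 2) ^ 2 = (k - 1 - γ) * (k + 3 + γ) := by ring
    have e2 : ((k : ℝ) + 1) ^ 2 - γ ^ 2 = (k + 1 - γ) * (k + 1 + γ) := by ring
    rw [e1, e2]
    field_simp
    ring

lemma zs_theta_tendsto (γ : ℝ) : Filter.Tendsto (fun k : ℕ => (((k : ℝ) - 1 - γ) * (k + 2 + γ) / ((k + 1 + γ) * (k - γ))))
    Filter.atTop (nhds 1) := by
  have l : ∀ a b : ℝ, Filter.Tendsto (fun k : ℕ => ((k : ℝ) + a) / (k + b)) Filter.atTop (nhds 1) := by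
    intro a b
    have h1 : Filter.Tendsto (fun k : ℕ => 1 + (a - b) / ((k : ℝ) + b)) Filter.atTop (nhds (1 + 0)) := by
      apply Filter.Tendsto.add tendsto_const_nhds
      apply Filter.Tendsto.div_atTop tendsto_const_nhds
      exact Filter.tendsto_atTop_add_const_right _ _ tendsto_natCast_atTop_atTop
    rw [add_zero] at h1
    refine h1.congr' ?_
    have : Filter.Tendsto (fun k : ℕ => (k : ℝ) + b) Filter.atTop Filter.atTop :=
      Filter.tendsto_atTop_add_const_right _ _ tendsto_natCast_atTop_atTop
    filter_upwards [this.eventually_gt_atTop 0] with k hk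
    field_simp
    ring
  have := (l (-1 - γ) (1 + γ)).mul (l (2 + γ) (-γ))
  rw [mul_one] at this
  refine this.congr fun k => ?_
  rw [div_mul_div_comm]
  congr 1 <;> ring

lemma zsP_shift_tendsto {x ρ γ : ℝ} (hx : 0 < x) (hρ : ρ ≠ 0) (h : ∀ m : ℤ, (m : ℝ) ≠ γ)
    (ht : Filter.Tendsto (zsP x ρ γ) Filter.atTop (nhds 1)) :
    Filter.Tendsto (zsP x ρ (γ + 2)) Filter.atTop (nhds 1) := by
  have := ht.mul (zs_theta_tendsto γ)
  rw [mul_one] at this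
  exact this.congr fun k => (zsP_shift hx hρ h k).symm

/-- certificate numerators -/
noncomputable def zsA3 (a b : ℝ) : ℝ := 2 * (a ^ 2 + 2 * a + 2 - b)
noncomputable def zsh (a b : ℝ) (k : ℝ) : ℝ :=
  (zsA3 a b * k ^ 3 + (zsA3 a b + 4 - 4 * b) * k ^ 2 +
    (2 * b ^ 2 - (2 * a ^ 2 + 4 * a + 10) * b + 4 - 4 * a - 2 * a ^ 2) * k + 2 * (b - 1) * (b + a ^ 2 + 2 * a)) /
    ((k + 1) * (k - a) * (k + 1 + a))
noncomputable def zsg (a b : ℝ) (k : ℝ) : ℝ :=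
  (k + a + 1) / (k + 2 + a) * (zsA3 a b + 4 * (a + 1) ^ 2 / (k + 1))

/-- the certificate, algebraic form, with s = k+1 -/
lemma zs_cert (a x s q p : ℝ) (hq : q ≠ 0) (hp : p ≠ 0) (hs : s ≠ 0) (hs1 : s + 1 ≠ 0) (hx : s ^ 2 + x ≠ 0)
    (h1 : s - a ≠ 0) (h2 : s + 1 + a ≠ 0) (h3 : s + 2 + a ≠ 0) (h4 : s - 1 - a ≠ 0) (h5 : s + a ≠ 0)
    (hr : p * q = (s ^ 2 - a ^ 2) / (s ^ 2 + x)) :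
    (a + 2) * (a ^ 2 + x) * (p * ((s - 1 - a) * (s + 2 + a) / ((s + 1 + a) * (s - a))) -
        1 / (p * ((s - 1 - a) * (s + 2 + a) / ((s + 1 + a) * (s - a))))) * (1 / s + 1 / (s + 1))
      - a * ((a + 2) ^ 2 + x) * (p - 1 / p) * (1 / s + 1 / (s + 1)) =
    (zsh a (-x) s * p + zsg a (-x) s / p) - (zsh a (-x) (s - 1) * q + zsg a (-x) (s - 1) / q) := by
  have e1 : q = (s ^ 2 - a ^ 2) / (s ^ 2 + x) / p := by
    rw [← hr]; field_simp
  have e2 : 1 / q = p * (s ^ 2 + x) / ((s - a) * (s + a)) := by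
    rw [e1]
    have : s ^ 2 - a ^ 2 = (s - a) * (s + a) := by ring
    rw [this]
    field_simp
  have c1 : (a + 2) * (a ^ 2 + x) * ((s - 1 - a) * (s + 2 + a) / ((s + 1 + a) * (s - a))) * (1 / s + 1 / (s + 1)) -
      a * ((a + 2) ^ 2 + x) * (1 / s + 1 / (s + 1)) = zsh a (-x) s - zsg a (-x) (s - 1) * ((s ^ 2 + x) / ((s - a) * (s + a))) := by
    unfold zsh zsg zsA3
    have g1 : s - 1 + 1 ≠ 0 := by simpa using hs
    have g2 : s - 1 + 2 + a ≠ 0 := by intro e; apply h2; linarith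
    rw [show s - 1 + a + 1 = s + a by ring, show s - 1 + 2 + a = s + 1 + a by ring, show s - 1 + 1 = s by ring]
    field_simp
    ring
  have c2 : -((a + 2) * (a ^ 2 + x) * (((s + 1 + a) * (s - a)) / ((s - 1 - a) * (s + 2 + a))) * (1 / s + 1 / (s + 1))) +
      a * ((a + 2) ^ 2 + x) * (1 / s + 1 / (s + 1)) = zsg a (-x) s - zsh a (-x) (s - 1) * ((s ^ 2 - a ^ 2) / (s ^ 2 + x)) := by
    unfold zsh zsg zsA3
    have g1 : s - 1 + 1 ≠ 0 := by simpa using hs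
    rw [show s - 1 + 1 + a = s + a by ring, show s - 1 + 1 = s by ring, show s ^ 2 - a ^ 2 = (s - a) * (s + a) by ring]
    field_simp
    ring
  have e3 : zsh a (-x) (s - 1) * q = zsh a (-x) (s - 1) * ((s ^ 2 - a ^ 2) / (s ^ 2 + x)) * (1 / p) := by
    rw [e1]; ring
  have e4 : zsg a (-x) (s - 1) / q = zsg a (-x) (s - 1) * ((s ^ 2 + x) / ((s - a) * (s + a))) * p := by
    rw [div_eq_mul_one_div, e2]; ring
  have e5 : 1 / (p * ((s - 1 - a) * (s + 2 + a) / ((s + 1 + a) * (s - a)))) = (1 / p) * (((s + 1 + a) * (s - a)) / ((s - 1 - a) * (s + 2 + a))) := by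
    field_simp
  rw [e3, e4, e5]
  linear_combination p * c1 + (1 / p) * c2

lemma zs_h_tendsto (a b : ℝ) : Filter.Tendsto (fun k : ℕ => zsh a b k) Filter.atTop (nhds (zsA3 a b)) := by
  have i : ∀ c : ℝ, Filter.Tendsto (fun k : ℕ => c / (k : ℝ)) Filter.atTop (nhds 0) := fun c =>
    tendsto_const_div_atTop_nhds_zero_nat c
  unfold zsh
  generalize zsA3 a b = A
  generalize (A + 4 - 4 * b) = B
  generalize (2 * b ^ 2 - (2 * a ^ 2 + 4 * a + 10) * b + 4 - 4 * a - 2 * a ^ 2) = C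
  generalize 2 * (b - 1) * (b + a ^ 2 + 2 * a) = D
  have h1 : Filter.Tendsto (fun k : ℕ => (A + B / (k : ℝ) + (C / (k : ℝ)) * (1 / k) + (D / (k : ℝ)) * (1 / k) * (1 / k)) /
      ((1 + 1 / (k : ℝ)) * (1 - a / k) * (1 + (1 + a) / k))) Filter.atTop (nhds ((A + 0 + 0 * 0 + 0 * 0 * 0) / ((1 + 0) * (1 - 0) * (1 + 0)))) := by
    refine Filter.Tendsto.div ?_ ?_ (by norm_num)
    · exact ((tendsto_const_nhds.add (i B)).add ((i C).mul (i 1))).add (((i D).mul (i 1)).mul (i 1))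
    · exact ((tendsto_const_nhds.add (i 1)).mul (tendsto_const_nhds.sub (i a))).mul (tendsto_const_nhds.add (i (1 + a)))
  simp only [add_zero, mul_zero, sub_zero, mul_one, div_one] at h1
  refine h1.congr' ?_
  filter_upwards [Filter.eventually_gt_atTop 0] with k hk
  have hk' : (k : ℝ) ≠ 0 := by positivity
  rw [show ((1 + 1 / (k : ℝ)) * (1 - a / k) * (1 + (1 + a) / k)) = ((k + 1) * (k - a) * (k + 1 + a)) / (k : ℝ) ^ 3 by field_simp; ring,
    show A + B / (k : ℝ) + C / ↑k * (1 / ↑k) + D / ↑k * (1 / ↑k) * (1 / ↑k) = (A * k ^ 3 + B * k ^ 2 + C * k + D) / (k : ℝ) ^ 3 by field_simp]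
  rw [div_div_div_cancel_right₀ (by positivity)]

lemma zs_g_tendsto (a b : ℝ) : Filter.Tendsto (fun k : ℕ => zsg a b k) Filter.atTop (nhds (zsA3 a b)) := by
  unfold zsg
  have i : ∀ c d : ℝ, Filter.Tendsto (fun k : ℕ => c / ((k : ℝ) + d)) Filter.atTop (nhds 0) := fun c d => by
    apply Filter.Tendsto.div_atTop tendsto_const_nhds
    exact Filter.tendsto_atTop_add_const_right _ _ tendsto_natCast_atTop_atTop
  have h1 : Filter.Tendsto (fun k : ℕ => ((k : ℝ) + a + 1) / (k + 2 + a)) Filter.atTop (nhds (1 - 0)) := by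
    refine (tendsto_const_nhds.sub (i 1 (2 + a))).congr' ?_
    have : Filter.Tendsto (fun k : ℕ => (k : ℝ) + (2 + a)) Filter.atTop Filter.atTop :=
      Filter.tendsto_atTop_add_const_right _ _ tendsto_natCast_atTop_atTop
    filter_upwards [this.eventually_gt_atTop 0] with k hk
    rw [show (k : ℝ) + 2 + a = k + (2 + a) by ring]
    field_simp
    ring
  have h2 := h1.mul (tendsto_const_nhds (x := zsA3 a b) |>.add (i (4 * (a + 1) ^ 2) 1))
  simpa using h2

/-- the step -/
lemma zs_S_step {x ρ γ : ℝ} (hx : 0 < x) (hρ : ρ ≠ 0) (h : ∀ m : ℤ, (m : ℝ) ≠ γ)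
    (ht : Filter.Tendsto (zsP x ρ γ) Filter.atTop (nhds 1)) (S : ℝ)
    (hS : Filter.Tendsto (zsS x ρ γ) Filter.atTop (nhds S)) :
    ∃ S', Filter.Tendsto (zsS x ρ (γ + 2)) Filter.atTop (nhds S') ∧
      (γ + 2) * (γ ^ 2 + x) * S' - γ * ((γ + 2) ^ 2 + x) * S = 2 * zsA3 γ (-x) - (zsh γ (-x) 0 * (γ * ρ) + zsg γ (-x) 0 / (γ * ρ)) := by
  have n := zsP_ne hx hρ h
  have e : ∀ N : ℕ, (γ + 2) * (γ ^ 2 + x) * zsS x ρ (γ + 2) N - γ * ((γ + 2) ^ 2 + x) * zsS x ρ γ N =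
    (zsh γ (-x) N * zsP x ρ γ N + zsg γ (-x) N / zsP x ρ γ N) - (zsh γ (-x) 0 * (γ * ρ) + zsg γ (-x) 0 / (γ * ρ)) := by
    intro N
    induction N with
    | zero => simp [zsS, zsP]
    | succ N ih =>
      unfold zsS at *
      rw [Finset.sum_range_succ, Finset.sum_range_succ]
      have a1 := zs_ni_sub h (N + 1)
      have a0 := zs_ni_sub h N
      have b1 := zs_ni_add h (N + 1)
      have b2 := zs_ni_add h (N + 2)
      have b3 := zs_ni_add h (N + 3)
      push_cast at a1 a0 b1 b2 b3
      have c := zs_cert γ x ((N : ℝ) + 1) (zsP x ρ γ N) (zsP x ρ γ (N + 1)) (n _) (n _) (by positivity) (by positivity) (by positivity)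
        a1 (by intro e; apply b2; linarith) (by intro e; apply b3; linarith) (by intro e; apply a0; linarith) b1
        (zsP_rec hx hρ h N)
      have hsh := zsP_shift hx hρ h (N + 1)
      push_cast at hsh
      rw [← hsh] at c
      rw [show (N : ℝ) + 1 - 1 = N by ring] at c
      unfold zsw
      unfold zsw at ih
      push_cast
      rw [show (N : ℝ) + 2 = N + 1 + 1 by ring]
      linear_combination ih + c
  have hg2 : (γ + 2) * (γ ^ 2 + x) ≠ 0 := by
    refine mul_ne_zero ?_ (by positivity)
    have := zs_ni_add h 2
    push_cast at this
    rwa [add_comm]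
  have l1 : Filter.Tendsto (fun N : ℕ => (zsh γ (-x) N * zsP x ρ γ N + zsg γ (-x) N / zsP x ρ γ N) - (zsh γ (-x) 0 * (γ * ρ) + zsg γ (-x) 0 / (γ * ρ)))
      Filter.atTop (nhds ((zsA3 γ (-x) * 1 + zsA3 γ (-x) / 1) - (zsh γ (-x) 0 * (γ * ρ) + zsg γ (-x) 0 / (γ * ρ)))) :=
    (((zs_h_tendsto γ (-x)).mul ht).add ((zs_g_tendsto γ (-x)).div ht one_ne_zero)).sub_const _
  have l2 := (l1.add (hS.const_mul (γ * ((γ + 2) ^ 2 + x)))).div_const ((γ + 2) * (γ ^ 2 + x))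
  refine ⟨_, l2.congr fun N => ?_, ?_⟩
  · rw [← e N, div_eq_iff hg2]; ring
  · rw [mul_div_cancel₀ _ hg2]; ring

/-- G hat -/
noncomputable def zsGh (x ρ γ S : ℝ) : ℝ := γ / (γ ^ 2 + x) * (γ * ρ - 1 / (γ * ρ) + S)

noncomputable def zschi (x γ : ℝ) : ℝ := 1 / (γ ^ 2 + x)
noncomputable def zsphi (x γ : ℝ) : ℝ := γ / (γ ^ 2 + x)

noncomputable def zsT (x ρ γ : ℝ) : ℝ := 2 * (zschi x γ + zschi x (γ + 2)) +
  ρ * (2 / (γ + 1) - zsphi x γ - zsphi x (γ + 2)) - 1 / (ρ * x) * (1 / γ + 1 / (γ + 2) - zsphi x γ - zsphi x (γ + 2))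

lemma zs_G_step {x ρ γ S S' : ℝ} (hx : 0 < x) (hρ : ρ ≠ 0) (h : ∀ m : ℤ, (m : ℝ) ≠ γ)
    (hh : (γ + 2) * (γ ^ 2 + x) * S' - γ * ((γ + 2) ^ 2 + x) * S = 2 * zsA3 γ (-x) - (zsh γ (-x) 0 * (γ * ρ) + zsg γ (-x) 0 / (γ * ρ))) :
    zsGh x ρ (γ + 2) S' = zsGh x ρ γ S + zsT x ρ γ := by
  have a0 : γ ≠ 0 := by have := zs_ni_add h 0; simpa using this
  have a1 : γ + 1 ≠ 0 := by have := zs_ni_add h 1; push_cast at this; rwa [add_comm]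
  have a2 : γ + 2 ≠ 0 := by have := zs_ni_add h 2; push_cast at this; rwa [add_comm]
  have p1 : γ ^ 2 + x ≠ 0 := by positivity
  have p2 : (γ + 2) ^ 2 + x ≠ 0 := by positivity
  have hS' : S' = (γ * ((γ + 2) ^ 2 + x) * S + (2 * zsA3 γ (-x) - (zsh γ (-x) 0 * (γ * ρ) + zsg γ (-x) 0 / (γ * ρ)))) / ((γ + 2) * (γ ^ 2 + x)) := by
    rw [← hh]; field_simp; ring
  rw [hS']
  unfold zsGh zsT zschi zsphi zsh zsg zsA3
  rw [show (0 : ℝ) + 2 + γ = γ + 2 by ring, show (0 : ℝ) + γ + 1 = γ + 1 by ring,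
    show ((0 : ℝ) + 1) * (0 - γ) * (0 + 1 + γ) = -(γ * (γ + 1)) by ring]
  field_simp
  ring

noncomputable def zsr (x γ : ℝ) (k : ℕ) : ℝ := ((k : ℝ) ^ 2 - γ ^ 2) / ((k : ℝ) ^ 2 + x)

lemma zs_q_rec {x ρ γ : ℝ} (hx : 0 < x) (hρ : ρ ≠ 0) (h : ∀ m : ℤ, (m : ℝ) ≠ γ) (k : ℕ) :
    zsP x ρ γ (k + 1) ^ 2 * zsP x ρ γ k ^ 2 = zsr x γ (k + 1) ^ 2 := by
  rw [← mul_pow, zsP_rec hx hρ h, zsr]; push_cast; rfl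

lemma zsr_pos {x γ : ℝ} (hx : 0 < x) (hγ : 0 < γ) {k : ℕ} (hk : γ < k) : 0 < zsr x γ k := by
  unfold zsr
  have : γ ^ 2 < (k : ℝ) ^ 2 := by gcongr
  have : 0 < (k : ℝ) ^ 2 - γ ^ 2 := by linarith
  positivity

lemma zsr_tendsto (x γ : ℝ) : Filter.Tendsto (zsr x γ) Filter.atTop (nhds 1) := by
  have h0 : Filter.Tendsto (fun k : ℕ => (k : ℝ) ^ 2 + x) Filter.atTop Filter.atTop :=
    Filter.tendsto_atTop_add_const_right _ _
      ((Filter.tendsto_pow_atTop two_ne_zero).comp tendsto_natCast_atTop_atTop)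
  have h1 : Filter.Tendsto (fun k : ℕ => 1 - (γ ^ 2 + x) / ((k : ℝ) ^ 2 + x)) Filter.atTop (nhds (1 - 0)) := by
    apply Filter.Tendsto.sub tendsto_const_nhds
    exact Filter.Tendsto.div_atTop tendsto_const_nhds h0
  rw [sub_zero] at h1
  refine h1.congr' ?_
  filter_upwards [h0.eventually_gt_atTop 0] with k hk
  unfold zsr
  field_simp
  ring

lemma zsr_logconcave {x γ : ℝ} (hx : 0 < x) (hγ : 0 < γ) {k : ℕ} (hk : γ < k) :
    zsr x γ k * zsr x γ (k + 2) ≤ zsr x γ (k + 1) ^ 2 := by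
  unfold zsr
  rw [div_mul_div_comm, div_pow, div_le_div_iff₀ (by positivity) (by positivity)]
  push_cast
  have h1 : 0 ≤ ((k : ℝ) + 1) ^ 2 - γ ^ 2 := by nlinarith
  have h2 : (((k : ℝ) + 1) ^ 2 - γ ^ 2) ^ 2 ≤ (((k : ℝ) + 1) ^ 2 + x) ^ 2 := by
    apply pow_le_pow_left₀ h1; nlinarith
  have h4 : 0 ≤ 2 * γ ^ 2 + 2 * x := by positivity
  have h5 : 0 ≤ (2 * ((k : ℝ) + 1) ^ 2 - 1 + 2 * γ ^ 2) := by nlinarith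
  have h3 := mul_le_mul_of_nonneg_left h2 h5
  have h6 := mul_nonneg h4 (sq_nonneg (((k : ℝ) + 1) ^ 2 - γ ^ 2))
  nlinarith [h3, h6]

lemma zs_q_lower {x ρ γ : ℝ} (hx : 0 < x) (hρ : ρ ≠ 0) (hγ : 0 < γ) (h : ∀ m : ℤ, (m : ℝ) ≠ γ)
    (ht : Filter.Tendsto (zsP x ρ γ) Filter.atTop (nhds 1)) {k : ℕ} (hk : γ < k) :
    zsr x γ k ≤ zsP x ρ γ k ^ 2 := by
  have pos : ∀ j : ℕ, 0 < zsr x γ (k + j) := fun j => zsr_pos hx hγ (by push_cast; linarith [(Nat.cast_nonneg j : (0 : ℝ) ≤ j)])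
  have qpos : ∀ j : ℕ, 0 < zsP x ρ γ j ^ 2 := fun j => by have := zsP_ne hx hρ h j; positivity
  have anti : Antitone (fun j : ℕ => zsP x ρ γ (k + 2 * j) ^ 2 / zsr x γ (k + 2 * j)) := by
    apply antitone_nat_of_succ_le
    intro j
    have p0 := pos (2 * j)
    have p1 := pos (2 * j + 1)
    have p2 := pos (2 * j + 2)
    have q0 := qpos (k + 2 * j)
    have q1 := qpos (k + 2 * j + 1)
    have q2 := qpos (k + 2 * j + 2)
    have r1 := zs_q_rec hx hρ h (k + 2 * j)
    have r2 := zs_q_rec hx hρ h (k + 2 * j + 1)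
    have lc := zsr_logconcave (k := k + 2 * j) hx hγ (by push_cast; linarith [(Nat.cast_nonneg j : (0 : ℝ) ≤ j)])
    rw [show k + 2 * (j + 1) = k + 2 * j + 2 by ring]
    rw [← add_assoc] at p1 p2
    rw [show k + 2 * j + 1 + 1 = k + 2 * j + 2 by ring] at r2
    generalize zsP x ρ γ (k + 2 * j) ^ 2 = Q0 at *
    generalize zsP x ρ γ (k + 2 * j + 1) ^ 2 = Q1 at *
    generalize zsP x ρ γ (k + 2 * j + 2) ^ 2 = Q2 at *
    generalize zsr x γ (k + 2 * j) = R0 at *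
    generalize zsr x γ (k + 2 * j + 1) = R1 at *
    generalize zsr x γ (k + 2 * j + 2) = R2 at *
    rw [div_le_div_iff₀ p2 p0]
    have e : Q2 * R0 * Q1 = R0 * R2 * R2 := by rw [mul_right_comm, r2]; ring
    have e' : Q0 * R2 * Q1 = R1 ^ 2 * R2 := by rw [← r1]; ring
    have : Q2 * R0 * Q1 ≤ Q0 * R2 * Q1 := by
      rw [e, e']; gcongr
    exact le_of_mul_le_mul_right this q1
  have lim : Filter.Tendsto (fun j : ℕ => zsP x ρ γ (k + 2 * j) ^ 2 / zsr x γ (k + 2 * j)) Filter.atTop (nhds (1 ^ 2 / 1)) := by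
    have t : Filter.Tendsto (fun j : ℕ => k + 2 * j) Filter.atTop Filter.atTop :=
      Filter.tendsto_atTop_mono (fun j => by simp only [id]; omega) Filter.tendsto_id
    exact (((ht.pow 2).comp t).div ((zsr_tendsto x γ).comp t) one_ne_zero)
  have := anti.le_of_tendsto lim 0
  simp only [mul_zero, add_zero, one_pow, div_one] at this
  rwa [one_le_div (by simpa using pos 0)] at this

lemma zs_q_upper {x ρ γ : ℝ} (hx : 0 < x) (hρ : ρ ≠ 0) (hγ : 0 < γ) (h : ∀ m : ℤ, (m : ℝ) ≠ γ)
    (ht : Filter.Tendsto (zsP x ρ γ) Filter.atTop (nhds 1)) {k : ℕ} (hk : γ < k + 1) :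
    zsP x ρ γ k ^ 2 ≤ zsr x γ (k + 1) := by
  have l := zs_q_lower hx hρ hγ h ht (k := k + 1) (by push_cast; exact hk)
  have r := zs_q_rec hx hρ h k
  have p : 0 < zsr x γ (k + 1) := zsr_pos hx hγ (by push_cast; exact hk)
  have q : 0 ≤ zsP x ρ γ k ^ 2 := sq_nonneg _
  have : zsr x γ (k + 1) * zsP x ρ γ k ^ 2 ≤ zsr x γ (k + 1) * zsr x γ (k + 1) := by
    calc _ ≤ zsP x ρ γ (k + 1) ^ 2 * zsP x ρ γ k ^ 2 := by gcongr
      _ = _ := by rw [r, sq]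
  exact le_of_mul_le_mul_left this p

lemma zsr_le_one {x γ : ℝ} (hx : 0 < x) (k : ℕ) : zsr x γ k ≤ 1 := by
  unfold zsr
  rw [div_le_one (by positivity)]
  nlinarith [sq_nonneg γ]

/-- bound in the range k > γ -/
lemma zs_bound_big {x ρ γ d : ℝ} (hx : 0 < x) (hx1 : x < 1) (hρ : ρ ≠ 0) (hγ : 1 < γ) (h : ∀ m : ℤ, (m : ℝ) ≠ γ)
    (ht : Filter.Tendsto (zsP x ρ γ) Filter.atTop (nhds 1)) (hd : 0 < d) {k : ℕ} (hk : γ + d ≤ k) :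
    (zsP x ρ γ k - 1 / zsP x ρ γ k) ^ 2 ≤ 4 * γ ^ 2 / (d * k) := by
  have hk' : γ < k := by linarith
  have hk1 : (1 : ℝ) < k := by linarith
  have l := zs_q_lower hx hρ (by linarith) h ht hk'
  have u := (zs_q_upper hx hρ (by linarith) h ht (k := k) (by linarith)).trans (zsr_le_one hx _)
  have n := zsP_ne hx hρ h k
  have p := zsr_pos hx (by linarith) hk'
  have e : (zsP x ρ γ k - 1 / zsP x ρ γ k) ^ 2 = (1 - zsP x ρ γ k ^ 2) ^ 2 / zsP x ρ γ k ^ 2 := by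
    field_simp; ring
  have b1 : d / (2 * k) ≤ zsr x γ k := by
    unfold zsr
    rw [div_le_div_iff₀ (by positivity) (by positivity)]
    have : d * k ≤ (k : ℝ) ^ 2 - γ ^ 2 := by nlinarith
    nlinarith [mul_le_mul_of_nonneg_right this (by positivity : (0 : ℝ) ≤ 2 * k)]
  have b2 : 1 - zsr x γ k ≤ 2 * γ ^ 2 / (k : ℝ) ^ 2 := by
    have : 1 - zsr x γ k = (γ ^ 2 + x) / ((k : ℝ) ^ 2 + x) := by
      unfold zsr; field_simp; ring
    rw [this]
    apply div_le_div₀ (by positivity) (by nlinarith) (by positivity) (by linarith)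
  rw [e]
  generalize zsP x ρ γ k ^ 2 = q at *
  generalize zsr x γ k = r at *
  calc (1 - q) ^ 2 / q ≤ (1 - r) / r := by
        apply div_le_div₀ (by linarith) (by nlinarith) p l
    _ ≤ (2 * γ ^ 2 / (k : ℝ) ^ 2) / (d / (2 * k)) := by
        apply div_le_div₀ (by positivity) b2 (by positivity) b1
    _ = 4 * γ ^ 2 / (d * k) := by field_simp; ring

lemma zs_q_two {x ρ γ : ℝ} (hx : 0 < x) (hρ : ρ ≠ 0) (h : ∀ m : ℤ, (m : ℝ) ≠ γ) (k : ℕ) :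
    zsP x ρ γ (k + 2) ^ 2 * zsr x γ (k + 1) ^ 2 = zsP x ρ γ k ^ 2 * zsr x γ (k + 2) ^ 2 := by
  rw [← zs_q_rec hx hρ h k, ← zs_q_rec hx hρ h (k + 1)]; ring

/-- ratio bound below γ -/
lemma zsr_ratio {x γ : ℝ} (hx : 0 < x) (hx1 : x < 1) {k : ℕ} (hk : (k : ℝ) + 2 < γ) :
    0 ≤ -zsr x γ (k + 2) ∧ -zsr x γ (k + 2) ≤ (-zsr x γ (k + 1)) * (((k : ℝ) + 1) / (k + 2)) ∧ 0 < -zsr x γ (k + 1) := by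
  have k0 : (0 : ℝ) ≤ k := Nat.cast_nonneg k
  have e2 : -zsr x γ (k + 2) = (γ ^ 2 - ((k : ℝ) + 2) ^ 2) / (((k : ℝ) + 2) ^ 2 + x) := by
    unfold zsr; push_cast; rw [← neg_div]; ring
  have e1 : -zsr x γ (k + 1) = (γ ^ 2 - ((k : ℝ) + 1) ^ 2) / (((k : ℝ) + 1) ^ 2 + x) := by
    unfold zsr; push_cast; rw [← neg_div]; ring
  have a2 : 0 < γ ^ 2 - ((k : ℝ) + 2) ^ 2 := by nlinarith
  have a1 : 0 < γ ^ 2 - ((k : ℝ) + 1) ^ 2 := by nlinarith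
  rw [e2, e1]
  refine ⟨by positivity, ?_, by positivity⟩
  rw [div_mul_div_comm, div_le_div_iff₀ (by positivity) (by positivity)]
  have s1 : γ ^ 2 - ((k : ℝ) + 2) ^ 2 ≤ γ ^ 2 - ((k : ℝ) + 1) ^ 2 := by nlinarith
  have s2 : (((k : ℝ) + 1) ^ 2 + x) * (k + 2) ≤ (k + 1) * (((k : ℝ) + 2) ^ 2 + x) := by nlinarith
  calc _ ≤ (γ ^ 2 - ((k : ℝ) + 1) ^ 2) * ((k + 1) * (((k : ℝ) + 2) ^ 2 + x)) := by gcongr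
    _ = _ := by ring

lemma zs_q_step {x ρ γ : ℝ} (hx : 0 < x) (hx1 : x < 1) (hρ : ρ ≠ 0) (h : ∀ m : ℤ, (m : ℝ) ≠ γ) {k : ℕ} (hk : (k : ℝ) + 2 < γ) :
    zsP x ρ γ (k + 2) ^ 2 * (k + 3) ≤ zsP x ρ γ k ^ 2 * (k + 1) := by
  obtain ⟨a, b, c⟩ := zsr_ratio hx hx1 hk
  have e := zs_q_two hx hρ h k
  have k0 : (0 : ℝ) ≤ k := Nat.cast_nonneg k
  have q : 0 ≤ zsP x ρ γ k ^ 2 := sq_nonneg _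
  have c2 : 0 < zsr x γ (k + 1) ^ 2 := by nlinarith
  have sq := pow_le_pow_left₀ a b 2
  rw [neg_sq, mul_pow, neg_sq] at sq
  have : zsP x ρ γ (k + 2) ^ 2 * (k + 3) * zsr x γ (k + 1) ^ 2 ≤ zsP x ρ γ k ^ 2 * (k + 1) * zsr x γ (k + 1) ^ 2 := by
    calc _ = zsP x ρ γ k ^ 2 * zsr x γ (k + 2) ^ 2 * (k + 3) := by rw [← e]; ring
      _ ≤ zsP x ρ γ k ^ 2 * (zsr x γ (k + 1) ^ 2 * (((k : ℝ) + 1) / (k + 2)) ^ 2) * (k + 3) := by gcongr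
      _ = zsP x ρ γ k ^ 2 * zsr x γ (k + 1) ^ 2 * ((((k : ℝ) + 1) / (k + 2)) ^ 2 * (k + 3)) := by ring
      _ ≤ zsP x ρ γ k ^ 2 * zsr x γ (k + 1) ^ 2 * (k + 1) := by
        gcongr
        rw [div_pow, div_mul_eq_mul_div, div_le_iff₀ (by positivity)]
        nlinarith
      _ = _ := by ring
  exact le_of_mul_le_mul_right this c2

lemma zs_qinv_step {x ρ γ : ℝ} (hx : 0 < x) (hx1 : x < 1) (hρ : ρ ≠ 0) (h : ∀ m : ℤ, (m : ℝ) ≠ γ) {k : ℕ} (hk : (k : ℝ) + 2 < γ) :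
    1 / zsP x ρ γ k ^ 2 ≤ 1 / zsP x ρ γ (k + 2) ^ 2 := by
  have := zs_q_step hx hx1 hρ h hk
  have n2 := zsP_ne hx hρ h (k + 2)
  have k0 : (0 : ℝ) ≤ k := Nat.cast_nonneg k
  apply one_div_le_one_div_of_le (by positivity)
  have q : 0 ≤ zsP x ρ γ k ^ 2 := sq_nonneg _
  have q : 0 ≤ zsP x ρ γ (k + 2) ^ 2 := sq_nonneg _
  nlinarith

lemma zs_q_small {x ρ γ : ℝ} (hx : 0 < x) (hx1 : x < 1) (hρ : ρ ≠ 0) (hγ : 1 < γ) (h : ∀ m : ℤ, (m : ℝ) ≠ γ) (k : ℕ) :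
    ((k : ℝ) < γ → zsP x ρ γ k ^ 2 * (k + 1) ≤ (ρ ^ 2 + 2 / ρ ^ 2) * γ ^ 2) ∧
    ((k : ℝ) + 1 < γ → zsP x ρ γ (k + 1) ^ 2 * (k + 2) ≤ (ρ ^ 2 + 2 / ρ ^ 2) * γ ^ 2) := by
  induction k with
  | zero =>
    constructor
    · intro _
      simp only [zsP]
      have : 0 ≤ 2 / ρ ^ 2 * γ ^ 2 := by positivity
      push_cast
      nlinarith
    · intro _
      simp only [zsP]
      have hg : γ ≠ 0 := by positivity
      have : (((((0 : ℕ) : ℝ) + 1) ^ 2 - γ ^ 2) / ((((0 : ℕ) : ℝ) + 1) ^ 2 + x) / (γ * ρ)) ^ 2 * (((0 : ℕ) : ℝ) + 2) =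
        ((γ ^ 2 - 1) ^ 2 / (γ ^ 4 * (1 + x) ^ 2)) * (2 / ρ ^ 2 * γ ^ 2) := by
        push_cast; field_simp; ring
      rw [this]
      have b : ((γ ^ 2 - 1) ^ 2 / (γ ^ 4 * (1 + x) ^ 2)) ≤ 1 := by
        rw [div_le_one (by positivity), show γ ^ 4 * (1 + x) ^ 2 = (γ ^ 2 * (1 + x)) ^ 2 by ring]
        apply pow_le_pow_left₀ (by nlinarith); nlinarith
      calc _ ≤ 1 * (2 / ρ ^ 2 * γ ^ 2) := by gcongr
        _ ≤ _ := by nlinarith [mul_nonneg (sq_nonneg ρ) (sq_nonneg γ)]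
  | succ k ih =>
    obtain ⟨i1, i2⟩ := ih
    push_cast
    constructor
    · intro hk
      rw [show (k : ℝ) + 1 + 1 = k + 2 by ring]
      exact i2 hk
    · intro hk
      have := zs_q_step (k := k) hx hx1 hρ h (by linarith)
      rw [show (k : ℝ) + 1 + 2 = k + 3 by ring]
      exact this.trans (i1 (by linarith))

lemma zs_qinv_top {x ρ γ d : ℝ} (hx : 0 < x) (hx1 : x < 1) (hρ : ρ ≠ 0) (hγ : 1 < γ) (h : ∀ m : ℤ, (m : ℝ) ≠ γ)
    (ht : Filter.Tendsto (zsP x ρ γ) Filter.atTop (nhds 1)) (hd : 0 < d) {K : ℕ} (h1 : (K : ℝ) + d ≤ γ) (h2 : γ + d ≤ K + 1) :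
    1 / zsP x ρ γ K ^ 2 ≤ 16 * (K + 1) / d ^ 2 := by
  have hK0 : 0 < (K : ℝ) := by linarith
  have n0 := zsP_ne hx hρ h K
  have n1 := zsP_ne hx hρ h (K + 1)
  have u := zs_q_upper hx hρ (by linarith) h ht (k := K + 1) (by push_cast; linarith)
  have p := zsr_pos hx (by linarith : 0 < γ) (k := K + 1) (by push_cast; linarith)
  have e : 1 / zsP x ρ γ K ^ 2 = zsP x ρ γ (K + 1) ^ 2 / zsr x γ (K + 1) ^ 2 := by
    rw [← zs_q_rec hx hρ h]; field_simp
  have b1 : zsr x γ (K + 1 + 1) ≤ 4 / (K + 2) := by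
    unfold zsr
    push_cast
    rw [div_le_div_iff₀ (by positivity) (by positivity)]
    have w : ((K : ℝ) + 1 + 1) ^ 2 - γ ^ 2 ≤ 4 * (K + 2) := by nlinarith
    nlinarith [mul_le_mul_of_nonneg_right w (by positivity : (0 : ℝ) ≤ (K : ℝ) + 2)]
  have b2 : d / (2 * (K + 1)) ≤ zsr x γ (K + 1) := by
    unfold zsr
    push_cast
    rw [div_le_div_iff₀ (by positivity) (by positivity)]
    have : d * (K + 1) ≤ ((K : ℝ) + 1) ^ 2 - γ ^ 2 := by nlinarith
    nlinarith [mul_le_mul_of_nonneg_right this (by positivity : (0 : ℝ) ≤ 2 * (K + 1))]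
  rw [e]
  calc _ ≤ (4 / ((K : ℝ) + 2)) / (d / (2 * (K + 1))) ^ 2 := by
        apply div_le_div₀ (by positivity) (u.trans b1) (by positivity)
        gcongr
    _ = (16 * (K + 1) / d ^ 2) * ((K + 1) / (K + 2)) := by field_simp; ring
    _ ≤ (16 * (K + 1) / d ^ 2) * 1 := by
        gcongr
        rw [div_le_one (by positivity)]; linarith
    _ = _ := by ring

lemma zs_qinv_top2 {x ρ γ d : ℝ} (hx : 0 < x) (hx1 : x < 1) (hρ : ρ ≠ 0) (hγ : 1 < γ) (h : ∀ m : ℤ, (m : ℝ) ≠ γ)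
    (ht : Filter.Tendsto (zsP x ρ γ) Filter.atTop (nhds 1)) (hd : 0 < d) {K : ℕ} (h1 : (K : ℝ) + 1 + d ≤ γ) (h2 : γ + d ≤ K + 2) :
    1 / zsP x ρ γ K ^ 2 ≤ 16 * (K + 1) / d ^ 2 := by
  have hK0 : 0 ≤ (K : ℝ) := Nat.cast_nonneg K
  have n0 := zsP_ne hx hρ h K
  have n1 := zsP_ne hx hρ h (K + 1)
  have u := zs_q_upper hx hρ (by linarith) h ht (k := K + 1) (by push_cast; linarith)
  have e : 1 / zsP x ρ γ K ^ 2 = zsP x ρ γ (K + 1) ^ 2 / (-zsr x γ (K + 1)) ^ 2 := by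
    rw [neg_sq, ← zs_q_rec hx hρ h]; field_simp
  have b1 : zsr x γ (K + 1 + 1) ≤ 4 / (K + 2) := by
    unfold zsr
    push_cast
    rw [div_le_div_iff₀ (by positivity) (by positivity)]
    have w : ((K : ℝ) + 1 + 1) ^ 2 - γ ^ 2 ≤ 4 * (K + 2) := by nlinarith
    nlinarith [mul_le_mul_of_nonneg_right w (by positivity : (0 : ℝ) ≤ (K : ℝ) + 2)]
  have b2 : d / (2 * (K + 1)) ≤ -zsr x γ (K + 1) := by
    unfold zsr
    push_cast
    rw [← neg_div, div_le_div_iff₀ (by positivity) (by positivity)]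
    have : d * (K + 1) ≤ -(((K : ℝ) + 1) ^ 2 - γ ^ 2) := by nlinarith
    nlinarith [mul_le_mul_of_nonneg_right this (by positivity : (0 : ℝ) ≤ 2 * (K + 1))]
  rw [e]
  calc _ ≤ (4 / ((K : ℝ) + 2)) / (d / (2 * (K + 1))) ^ 2 := by
        apply div_le_div₀ (by positivity) (u.trans b1) (by positivity)
        gcongr
    _ = (16 * (K + 1) / d ^ 2) * ((K + 1) / (K + 2)) := by field_simp; ring
    _ ≤ (16 * (K + 1) / d ^ 2) * 1 := by
        gcongr
        rw [div_le_one (by positivity)]; linarith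
    _ = _ := by ring

lemma zs_qinv_small {x ρ γ d : ℝ} (hx : 0 < x) (hx1 : x < 1) (hρ : ρ ≠ 0) (hγ : 1 < γ) (h : ∀ m : ℤ, (m : ℝ) ≠ γ)
    (ht : Filter.Tendsto (zsP x ρ γ) Filter.atTop (nhds 1)) (hd : 0 < d) {K : ℕ} (h1 : (K : ℝ) + d ≤ γ) (h2 : γ + d ≤ K + 1)
    (k j : ℕ) (hkj : k + j = K) :
    1 / zsP x ρ γ k ^ 2 ≤ 16 * (K + 1) / d ^ 2 := by
  induction j using Nat.strong_induction_on generalizing k with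
  | _ j ih =>
    match j, ih, hkj with
    | 0, _, hkj =>
      have : k = K := by omega
      subst this
      exact zs_qinv_top hx hx1 hρ hγ h ht hd h1 h2
    | 1, _, hkj =>
      have : (k : ℝ) + 1 = K := by exact_mod_cast hkj
      have := zs_qinv_top2 (K := k) hx hx1 hρ hγ h ht hd (by linarith) (by linarith)
      refine this.trans ?_
      gcongr
      omega
    | j + 2, ih, hkj =>
      have c : (k : ℝ) + 2 + j = K := by have : k + 2 + j = K := by omega
                                         exact_mod_cast this
      have j0 : (0 : ℝ) ≤ j := Nat.cast_nonneg j
      refine (zs_qinv_step hx hx1 hρ h (by linarith)).trans ?_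
      exact ih j (by omega) (k + 2) (by omega)

/-- the uniform bound -/
lemma zs_bound {x ρ γ d : ℝ} (hx : 0 < x) (hx1 : x < 1) (hρ : ρ ≠ 0) (hγ : 1 < γ) (h : ∀ m : ℤ, (m : ℝ) ≠ γ)
    (ht : Filter.Tendsto (zsP x ρ γ) Filter.atTop (nhds 1)) (hd : 0 < d) {K : ℕ} (h1 : (K : ℝ) + d ≤ γ) (h2 : γ + d ≤ K + 1)
    (k : ℕ) :
    (zsP x ρ γ (k + 1) - 1 / zsP x ρ γ (k + 1)) ^ 2 ≤ (4 / d + 32 / d ^ 2 + (ρ ^ 2 + 2 / ρ ^ 2)) * γ ^ 2 / (k + 1) := by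
  have k0 : (0 : ℝ) ≤ k := Nat.cast_nonneg k
  rcases Nat.lt_or_ge K (k + 1) with hk | hk
  · have hk' : (K : ℝ) + 1 ≤ k + 1 := by
      have : K + 1 ≤ k + 1 := hk
      exact_mod_cast this
    have := zs_bound_big (k := k + 1) hx hx1 hρ hγ h ht hd (by push_cast; linarith)
    refine this.trans ?_
    push_cast
    rw [show 4 * γ ^ 2 / (d * (k + 1)) = 4 / d * γ ^ 2 / (k + 1) by field_simp]
    gcongr
    have : 0 ≤ 32 / d ^ 2 + (ρ ^ 2 + 2 / ρ ^ 2) := by positivity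
    linarith
  · have hk' : (k : ℝ) + 1 ≤ K := by exact_mod_cast hk
    have n := zsP_ne hx hρ h (k + 1)
    have e : (zsP x ρ γ (k + 1) - 1 / zsP x ρ γ (k + 1)) ^ 2 ≤ zsP x ρ γ (k + 1) ^ 2 + 1 / zsP x ρ γ (k + 1) ^ 2 := by
      have : (zsP x ρ γ (k + 1) - 1 / zsP x ρ γ (k + 1)) ^ 2 = zsP x ρ γ (k + 1) ^ 2 + 1 / zsP x ρ γ (k + 1) ^ 2 - 2 := by
        field_simp; ring
      linarith
    have s1 := (zs_q_small hx hx1 hρ hγ h (k + 1)).1 (by push_cast; linarith)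
    have s2 := zs_qinv_small hx hx1 hρ hγ h ht hd h1 h2 (k + 1) (K - (k + 1)) (by omega)
    push_cast at s1
    have q : 0 ≤ zsP x ρ γ (k + 1) ^ 2 := sq_nonneg _
    have t1 : zsP x ρ γ (k + 1) ^ 2 ≤ (ρ ^ 2 + 2 / ρ ^ 2) * γ ^ 2 / (k + 1) := by
      rw [le_div_iff₀ (by positivity)]
      nlinarith
    have t2 : 16 * ((K : ℝ) + 1) / d ^ 2 ≤ 32 / d ^ 2 * γ ^ 2 / (k + 1) := by
      rw [div_mul_eq_mul_div, div_div, div_le_div_iff₀ (by positivity) (by positivity)]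
      have a : (K : ℝ) + 1 ≤ 2 * K := by linarith
      have b : (K : ℝ) * K ≤ γ ^ 2 := by nlinarith
      have c : ((K : ℝ) + 1) * (k + 1) ≤ 2 * γ ^ 2 := by nlinarith
      have d2 : 0 < d ^ 2 := by positivity
      nlinarith [mul_le_mul_of_nonneg_right c d2.le]
    have t3 : 0 ≤ 4 / d * γ ^ 2 / (k + 1) := by positivity
    calc _ ≤ _ := e
      _ ≤ (ρ ^ 2 + 2 / ρ ^ 2) * γ ^ 2 / (k + 1) + 32 / d ^ 2 * γ ^ 2 / (k + 1) := add_le_add t1 (s2.trans t2)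
      _ ≤ (ρ ^ 2 + 2 / ρ ^ 2) * γ ^ 2 / (k + 1) + 32 / d ^ 2 * γ ^ 2 / (k + 1) + 4 / d * γ ^ 2 / (k + 1) := by linarith
      _ = _ := by ring

lemma zs_ni_of {α : ℝ} (h0 : 0 < α) (h1 : α < 1) (m : ℤ) : (m : ℝ) ≠ α := by
  intro e
  rw [← e] at h0 h1
  have a : (0 : ℤ) < m := by exact_mod_cast h0
  have b : m < (1 : ℤ) := by exact_mod_cast h1
  omega


lemma zs_base_pos {x ρ α : ℝ} (hx : 0 < x) (hρ : ρ ≠ 0) (h0 : 0 < α) (h1 : α < 1)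
    (ht : Filter.Tendsto (zsP x ρ α) Filter.atTop (nhds 1)) (k : ℕ) : 0 < zsP x ρ α k := by
  have ni := zs_ni_of h0 h1
  have ev := ht.eventually (lt_mem_nhds (zero_lt_one))
  obtain ⟨N, hN⟩ := Filter.eventually_atTop.1 ev
  have step : ∀ k, 0 < zsP x ρ α (k + 1) → 0 < zsP x ρ α k := by
    intro k hk
    have r := zsP_rec hx hρ ni k
    have : 0 < zsP x ρ α (k + 1) * zsP x ρ α k := by
      rw [r]
      have : 0 < ((k : ℝ) + 1) ^ 2 - α ^ 2 := by
        have : (0 : ℝ) ≤ k := Nat.cast_nonneg k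
        nlinarith
      positivity
    exact (pos_iff_pos_of_mul_pos this).1 hk
  have all : ∀ j k, k + j = N → 0 < zsP x ρ α k := by
    intro j
    induction j with
    | zero => intro k hk; exact hN k (by omega)
    | succ j ih => intro k hk; exact step k (ih (k + 1) (by omega))
  rcases le_total k N with h | h
  · exact all (N - k) k (by omega)
  · exact hN k h

lemma zs_base_le {x ρ α : ℝ} (hx : 0 < x) (hρ : ρ ≠ 0) (h0 : 0 < α) (h1 : α < 1)
    (ht : Filter.Tendsto (zsP x ρ α) Filter.atTop (nhds 1)) (k : ℕ) : zsP x ρ α k ≤ 1 := by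
  have ni := zs_ni_of h0 h1
  have := (zs_q_upper hx hρ h0 ni ht (k := k) (by linarith [(Nat.cast_nonneg k : (0 : ℝ) ≤ k)])).trans (zsr_le_one hx _)
  have p := zs_base_pos hx hρ h0 h1 ht k
  nlinarith

lemma zs_base_ge {x ρ α : ℝ} (hx : 0 < x) (hρ : ρ ≠ 0) (h0 : 0 < α) (h1 : α < 1)
    (ht : Filter.Tendsto (zsP x ρ α) Filter.atTop (nhds 1)) (k : ℕ) : zsr x α (k + 1) ≤ zsP x ρ α k := by
  have ni := zs_ni_of h0 h1
  have := zsP_rec hx hρ ni k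
  have l := zs_base_le hx hρ h0 h1 ht (k + 1)
  have p := zs_base_pos hx hρ h0 h1 ht k
  unfold zsr
  push_cast
  rw [← this]
  nlinarith

lemma zs_base_p0 {x ρ α : ℝ} (hx : 0 < x) (hx1 : x < 1) (hρ : ρ ≠ 0) (h0 : 0 < α) (h1 : α < 1)
    (ht : Filter.Tendsto (zsP x ρ α) Filter.atTop (nhds 1)) : (1 - α ^ 2) / 2 ≤ zsP x ρ α 0 ∧ zsP x ρ α 0 ≤ 5 / 3 * (1 - α ^ 2) := by
  have ni := zs_ni_of h0 h1
  have r := zsP_rec hx hρ ni 0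
  have g := zs_base_ge hx hρ h0 h1 ht 0
  have g1 := zs_base_ge hx hρ h0 h1 ht 1
  have p := zs_base_pos hx hρ h0 h1 ht 0
  have a : 0 < 1 - α ^ 2 := by nlinarith
  unfold zsr at g g1
  norm_num at g g1 r
  constructor
  · refine le_trans ?_ g
    apply div_le_div_of_nonneg_left a.le (by positivity) (by linarith)
  · have b : 3 / 5 ≤ zsP x ρ α 1 := by
      refine le_trans ?_ g1
      rw [div_le_div_iff₀ (by norm_num) (by positivity)]
      nlinarith
    have c : zsP x ρ α 1 * zsP x ρ α 0 ≤ 1 - α ^ 2 := by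
      rw [r]
      apply div_le_self a.le; linarith
    nlinarith

lemma zs_base_term {x ρ α : ℝ} (hx : 0 < x) (hx1 : x < 1) (hρ : ρ ≠ 0) (h0 : 0 < α) (h1 : α < 1)
    (ht : Filter.Tendsto (zsP x ρ α) Filter.atTop (nhds 1)) (k : ℕ) : |(zsP x ρ α (k + 1) - 1 / zsP x ρ α (k + 1)) * zsw k| ≤ 14 / ((k : ℝ) + 1) ^ 2 := by
  have k0 : (0 : ℝ) ≤ k := Nat.cast_nonneg k
  have l := zs_base_le hx hρ h0 h1 ht (k + 1)
  have g := zs_base_ge hx hρ h0 h1 ht (k + 1)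
  have p := zs_base_pos hx hρ h0 h1 ht (k + 1)
  have b1 : 3 / 5 ≤ zsr x α (k + 1 + 1) := by
    unfold zsr
    push_cast
    rw [div_le_div_iff₀ (by norm_num) (by positivity)]
    nlinarith
  have b2 : 1 - zsr x α (k + 1 + 1) ≤ 2 / ((k : ℝ) + 1) ^ 2 := by
    have : 1 - zsr x α (k + 1 + 1) = (α ^ 2 + x) / (((k : ℝ) + 1 + 1) ^ 2 + x) := by
      unfold zsr; push_cast; field_simp; ring
    rw [this]
    apply div_le_div₀ (by positivity) (by nlinarith) (by positivity) (by nlinarith)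
  have w0 : 0 ≤ zsw k := by unfold zsw; positivity
  have w1 : zsw k ≤ 2 := by
    unfold zsw
    have a : 1 / ((k : ℝ) + 1) ≤ 1 := by rw [div_le_one (by positivity)]; linarith
    have b : 1 / ((k : ℝ) + 2) ≤ 1 := by rw [div_le_one (by positivity)]; linarith
    linarith
  generalize zsP x ρ α (k + 1) = q at *
  generalize zsr x α (k + 1 + 1) = r at *
  rw [abs_mul, abs_of_nonneg w0]
  have e : |q - 1 / q| ≤ 7 / ((k : ℝ) + 1) ^ 2 := by
    have : q - 1 / q = -((1 - q) * (1 + q) / q) := by field_simp; ring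
    rw [this, abs_neg, abs_of_nonneg (by apply div_nonneg _ p.le; nlinarith)]
    calc (1 - q) * (1 + q) / q ≤ (2 / ((k : ℝ) + 1) ^ 2 * 2) / (3 / 5) := by
          apply div_le_div₀ (by positivity) _ (by norm_num) (b1.trans g)
          apply mul_le_mul (by linarith) (by linarith) (by linarith) (by positivity)
      _ = (20 / 3) / ((k : ℝ) + 1) ^ 2 := by ring
      _ ≤ _ := by gcongr; norm_num
  calc _ ≤ 7 / ((k : ℝ) + 1) ^ 2 * 2 := by gcongr
    _ = _ := by ring


lemma zs_sum_sq (c : ℝ) : Summable (fun k : ℕ => c / ((k : ℝ) + 1) ^ 2) := by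
  have := (summable_nat_add_iff 1).2 (Real.summable_one_div_nat_pow.2 (by norm_num : 1 < 2))
  have := this.mul_left c
  refine this.congr fun k => ?_
  push_cast; ring

lemma zs_base_conv {x ρ α : ℝ} (hx : 0 < x) (hx1 : x < 1) (hρ : ρ ≠ 0) (h0 : 0 < α) (h1 : α < 1)
    (ht : Filter.Tendsto (zsP x ρ α) Filter.atTop (nhds 1)) : ∃ S, Filter.Tendsto (zsS x ρ α) Filter.atTop (nhds S) ∧ |S| ≤ ∑' k : ℕ, 14 / ((k : ℝ) + 1) ^ 2 := by
  have b := zs_base_term hx hx1 hρ h0 h1 ht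
  have s := Summable.of_norm_bounded (zs_sum_sq 14) (fun k => by rw [Real.norm_eq_abs]; exact b k)
  refine ⟨_, s.hasSum.tendsto_sum_nat, ?_⟩
  have := tsum_of_norm_bounded (zs_sum_sq 14).hasSum (fun k => by rw [Real.norm_eq_abs]; exact b k)
  rwa [Real.norm_eq_abs] at this

/-- limit of the partial sums -/
noncomputable def zsSl (x ρ γ : ℝ) : ℝ := Filter.limUnder Filter.atTop (zsS x ρ γ)

/-- limiting ratios -/
noncomputable def zsl (x ρ : ℝ) : ℕ → ℝ
  | 0 => ρ
  | k + 1 => -1 / (((k : ℝ) + 1) ^ 2 + x) / zsl x ρ k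

lemma zsl_ne {x ρ : ℝ} (hx : 0 < x) (hρ : ρ ≠ 0) (k : ℕ) : zsl x ρ k ≠ 0 := by
  induction k with
  | zero => exact hρ
  | succ k ih =>
    rw [zsl]
    exact div_ne_zero (div_ne_zero (by norm_num) (by positivity)) ih

lemma zsl_eq {x ρ : ℝ} (hρ : ρ ≠ 0) (k : ℕ) : zsl x ρ k = zsl x 1 k * (if Even k then ρ else 1 / ρ) := by
  induction k with
  | zero => simp [zsl]
  | succ k ih =>
    rw [zsl, zsl, ih]
    simp only [Nat.even_add_one]
    by_cases h : Even k
    · simp [h]; ring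
    · simp [h]; field_simp

noncomputable def zsKe (x : ℝ) : ℝ := 1 + ∑' k : ℕ, (if Even (k + 1) then zsl x 1 (k + 1) * zsw k else 0)
noncomputable def zsKo (x : ℝ) : ℝ := ∑' k : ℕ, (if Even (k + 1) then 0 else zsl x 1 (k + 1) * zsw k)

lemma zsl_tsum {x ρ : ℝ} (hρ : ρ ≠ 0) (hs : Summable (fun k => zsl x ρ (k + 1) * zsw k)) :
    ρ + ∑' k, zsl x ρ (k + 1) * zsw k = ρ * zsKe x + zsKo x / ρ := by
  have s1 := hs.indicator {k | Even (k + 1)}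
  have s2 := hs.indicator {k | ¬ Even (k + 1)}
  have e : ∀ k, zsl x ρ (k + 1) * zsw k = Set.indicator {k | Even (k + 1)} (fun k => zsl x ρ (k + 1) * zsw k) k +
      Set.indicator {k | ¬ Even (k + 1)} (fun k => zsl x ρ (k + 1) * zsw k) k := by
    intro k
    by_cases h : Even (k + 1) <;> simp [Set.indicator, h]
  have e1 : ∀ k, Set.indicator {k | Even (k + 1)} (fun k => zsl x ρ (k + 1) * zsw k) k =
      ρ * (if Even (k + 1) then zsl x 1 (k + 1) * zsw k else 0) := by
    intro k
    by_cases h : Even (k + 1)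
    · simp only [Set.indicator, Set.mem_ofPred_eq, h, if_true]
      rw [zsl_eq hρ]; simp only [h, if_true]; ring
    · simp [Set.indicator, h]
  have e2 : ∀ k, Set.indicator {k | ¬ Even (k + 1)} (fun k => zsl x ρ (k + 1) * zsw k) k =
      (1 / ρ) * (if Even (k + 1) then 0 else zsl x 1 (k + 1) * zsw k) := by
    intro k
    by_cases h : Even (k + 1)
    · simp [Set.indicator, h]
    · simp only [Set.indicator, Set.mem_ofPred_eq, h, if_false, not_false_eq_true, if_true]
      rw [zsl_eq hρ]; simp only [h, if_false]; ring
  rw [tsum_congr e, s1.tsum_add s2, tsum_congr e1, tsum_congr e2, tsum_mul_left, tsum_mul_left, zsKe, zsKo]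
  ring

lemma zs_chain {x ρ α : ℝ} (hx : 0 < x) (hρ : ρ ≠ 0) (h : ∀ m : ℤ, (m : ℝ) ≠ α)
    (ht : Filter.Tendsto (zsP x ρ α) Filter.atTop (nhds 1)) {S : ℝ} (hS : Filter.Tendsto (zsS x ρ α) Filter.atTop (nhds S)) (n : ℕ) :
    (∀ m : ℤ, (m : ℝ) ≠ α + 2 * n) ∧ Filter.Tendsto (zsP x ρ (α + 2 * n)) Filter.atTop (nhds 1) ∧
      Filter.Tendsto (zsS x ρ (α + 2 * n)) Filter.atTop (nhds (zsSl x ρ (α + 2 * n))) := by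
  induction n with
  | zero =>
    simp only [Nat.cast_zero, mul_zero, add_zero]
    exact ⟨h, ht, by rw [zsSl, hS.limUnder_eq]; exact hS⟩
  | succ n ih =>
    obtain ⟨i1, i2, i3⟩ := ih
    have e : α + 2 * ((n + 1 : ℕ) : ℝ) = α + 2 * n + 2 := by push_cast; ring
    rw [e]
    obtain ⟨S', hS', _⟩ := zs_S_step hx hρ i1 i2 _ i3
    exact ⟨zs_ni_shift i1, zsP_shift_tendsto hx hρ i1 i2, by rw [zsSl, hS'.limUnder_eq]; exact hS'⟩

lemma zs_chain_sum {x ρ α : ℝ} (hx : 0 < x) (hρ : ρ ≠ 0) (h : ∀ m : ℤ, (m : ℝ) ≠ α)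
    (ht : Filter.Tendsto (zsP x ρ α) Filter.atTop (nhds 1)) {S : ℝ} (hS : Filter.Tendsto (zsS x ρ α) Filter.atTop (nhds S)) (n : ℕ) :
    zsGh x ρ (α + 2 * n) (zsSl x ρ (α + 2 * n)) = zsGh x ρ α S + ∑ j ∈ Finset.range n, zsT x ρ (α + 2 * j) := by
  induction n with
  | zero =>
    simp only [Nat.cast_zero, mul_zero, add_zero, Finset.range_zero, Finset.sum_empty]
    rw [zsSl, hS.limUnder_eq]
  | succ n ih =>
    obtain ⟨i1, i2, i3⟩ := zs_chain hx hρ h ht hS n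
    obtain ⟨S', hS', hh⟩ := zs_S_step hx hρ i1 i2 _ i3
    have e : α + 2 * ((n + 1 : ℕ) : ℝ) = α + 2 * n + 2 := by push_cast; ring
    rw [e, zsSl, hS'.limUnder_eq, zs_G_step hx hρ i1 hh, ih, Finset.sum_range_succ]
    ring

lemma zs_ratio_tendsto {x ρ : ℝ} (hx : 0 < x) (hρ : ρ ≠ 0) (g : ℕ → ℝ) (hg : Filter.Tendsto g Filter.atTop Filter.atTop) (k : ℕ) :
    Filter.Tendsto (fun n => zsP x ρ (g n) k / g n) Filter.atTop (nhds (zsl x ρ k)) := by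
  induction k with
  | zero =>
    rw [zsl]
    refine tendsto_const_nhds.congr' ?_
    filter_upwards [hg.eventually_gt_atTop 0] with n hn
    rw [zsP]; field_simp
  | succ k ih =>
    have n := zsl_ne hx hρ k
    have l1 : Filter.Tendsto (fun n => ((k : ℝ) + 1) ^ 2 / (g n) ^ 2 - 1) Filter.atTop (nhds (0 - 1)) := by
      apply Filter.Tendsto.sub_const
      exact Filter.Tendsto.div_atTop tendsto_const_nhds ((Filter.tendsto_pow_atTop two_ne_zero).comp hg)
    have l2 := (l1.div_const (((k : ℝ) + 1) ^ 2 + x)).div ih n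
    rw [zero_sub] at l2
    rw [zsl]
    refine l2.congr' ?_
    filter_upwards [hg.eventually_gt_atTop 0] with n hn
    rw [zsP]
    simp only [Pi.div_apply]
    field_simp

lemma zs_summable_rpow (c : ℝ) : Summable (fun k : ℕ => c * ((Real.sqrt (1 / ((k : ℝ) + 1))) * (2 / (k + 1)))) := by
  apply Summable.mul_left
  have := (summable_nat_add_iff 1).2 (Real.summable_one_div_nat_rpow.2 (by norm_num : (1 : ℝ) < 3 / 2))
  have := this.mul_left 2
  refine this.congr fun k => ?_
  have k0 : (0 : ℝ) < k + 1 := by positivity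
  push_cast
  rw [show (3 / 2 : ℝ) = 1 + 1 / 2 by norm_num, Real.rpow_add k0, Real.rpow_one, ← Real.sqrt_eq_rpow, Real.sqrt_div (by norm_num),
    Real.sqrt_one]
  field_simp

lemma zs_limit {x ρ α : ℝ} (hx : 0 < x) (hx1 : x < 1) (hρ : ρ ≠ 0) (ha : α ≠ 0) (ha1 : |α| < 1) (h : ∀ m : ℤ, (m : ℝ) ≠ α)
    (ht : Filter.Tendsto (zsP x ρ α) Filter.atTop (nhds 1)) {S : ℝ} (hS : Filter.Tendsto (zsS x ρ α) Filter.atTop (nhds S)) :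
    Filter.Tendsto (fun n : ℕ => zsGh x ρ (α + 2 * n) (zsSl x ρ (α + 2 * n))) Filter.atTop (nhds (ρ * zsKe x + zsKo x / ρ)) := by
  obtain ⟨am, ap⟩ := abs_lt.1 ha1
  set d := min |α| (1 - |α|) with hd
  have d0 : 0 < d := lt_min (abs_pos.2 ha) (by linarith)
  have d1 : d ≤ |α| := min_le_left _ _
  have d2 : d ≤ 1 - |α| := min_le_right _ _
  have hg : Filter.Tendsto (fun n : ℕ => α + 2 * (n : ℝ)) Filter.atTop Filter.atTop :=
    Filter.tendsto_atTop_add_const_left _ _ (Filter.Tendsto.const_mul_atTop (by norm_num) tendsto_natCast_atTop_atTop)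
  set C := (4 / d + 32 / d ^ 2 + (ρ ^ 2 + 2 / ρ ^ 2)) with hC
  have C0 : 0 ≤ C := by positivity
  have gam : ∀ n : ℕ, 1 ≤ n → 1 < α + 2 * n := by
    intro n hn
    have : (1 : ℝ) ≤ n := by exact_mod_cast hn
    linarith
  -- the uniform bound
  have bound : ∀ n : ℕ, 1 ≤ n → ∀ k : ℕ, |(α + 2 * n) / ((α + 2 * n) ^ 2 + x) *
      ((zsP x ρ (α + 2 * n) (k + 1) - 1 / zsP x ρ (α + 2 * n) (k + 1)) * zsw k)| ≤ Real.sqrt C * ((Real.sqrt (1 / ((k : ℝ) + 1))) * (2 / (k + 1))) := by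
    intro n hn k
    obtain ⟨c1, c2, c3⟩ := zs_chain hx hρ h ht hS n
    have g1 := gam n hn
    have hK : ∃ K : ℕ, (K : ℝ) + d ≤ α + 2 * n ∧ α + 2 * n + d ≤ K + 1 := by
      rcases lt_or_gt_of_ne ha with a0 | a0
      · rw [abs_of_neg a0] at d1 d2
        refine ⟨2 * n - 1, ?_⟩
        rw [Nat.cast_sub (by omega)]
        push_cast
        constructor <;> linarith
      · rw [abs_of_pos a0] at d1 d2
        refine ⟨2 * n, ?_⟩
        push_cast
        constructor <;> linarith
    obtain ⟨K, K1, K2⟩ := hK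
    have b := zs_bound hx hx1 hρ g1 c1 c2 d0 K1 K2 k
    rw [← hC] at b
    generalize α + 2 * (n : ℝ) = γ at *
    generalize zsP x ρ γ (k + 1) - 1 / zsP x ρ γ (k + 1) = y at *
    have b' := Real.abs_le_sqrt b
    rw [show C * γ ^ 2 / ((k : ℝ) + 1) = C * (1 / (k + 1)) * γ ^ 2 by ring, Real.sqrt_mul (by positivity), Real.sqrt_sq (by linarith),
      Real.sqrt_mul C0] at b'
    have w0 : 0 ≤ zsw k := by unfold zsw; positivity
    have w1 : zsw k ≤ 2 / (k + 1) := by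
      unfold zsw
      have : 1 / ((k : ℝ) + 2) ≤ 1 / (k + 1) := by gcongr; norm_num
      calc _ ≤ 1 / ((k : ℝ) + 1) + 1 / (k + 1) := by linarith
        _ = _ := by ring
    rw [abs_mul, abs_mul, abs_of_nonneg w0, abs_of_nonneg (by positivity)]
    calc _ ≤ γ / (γ ^ 2 + x) * (Real.sqrt C * Real.sqrt (1 / (k + 1)) * γ * (2 / (k + 1))) := by gcongr
      _ = (γ ^ 2 / (γ ^ 2 + x)) * (Real.sqrt C * (Real.sqrt (1 / (k + 1)) * (2 / (k + 1)))) := by ring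
      _ ≤ 1 * (Real.sqrt C * (Real.sqrt (1 / (k + 1)) * (2 / (k + 1)))) := by
        gcongr
        rw [div_le_one (by positivity)]; linarith
      _ = _ := one_mul _
  have hphi : Filter.Tendsto (fun n : ℕ => (α + 2 * (n : ℝ)) ^ 2 / ((α + 2 * n) ^ 2 + x)) Filter.atTop (nhds 1) := by
    have h0 : Filter.Tendsto (fun n : ℕ => (α + 2 * (n : ℝ)) ^ 2 + x) Filter.atTop Filter.atTop :=
      Filter.tendsto_atTop_add_const_right _ _ ((Filter.tendsto_pow_atTop two_ne_zero).comp hg)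
    have := (tendsto_const_nhds (x := (1 : ℝ))).sub (Filter.Tendsto.div_atTop (tendsto_const_nhds (x := x)) h0)
    rw [sub_zero] at this
    refine this.congr fun n => ?_
    have : (α + 2 * (n : ℝ)) ^ 2 + x ≠ 0 := by positivity
    field_simp; ring
  have hchi : Filter.Tendsto (fun n : ℕ => 1 / ((α + 2 * (n : ℝ)) ^ 2 + x)) Filter.atTop (nhds 0) := by
    have h0 : Filter.Tendsto (fun n : ℕ => (α + 2 * (n : ℝ)) ^ 2 + x) Filter.atTop Filter.atTop :=
      Filter.tendsto_atTop_add_const_right _ _ ((Filter.tendsto_pow_atTop two_ne_zero).comp hg)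
    exact Filter.Tendsto.div_atTop tendsto_const_nhds h0
  -- pointwise limits
  have pt' : ∀ k : ℕ, Filter.Tendsto (fun n : ℕ => (α + 2 * n) / ((α + 2 * n) ^ 2 + x) *
      (zsP x ρ (α + 2 * n) k - 1 / zsP x ρ (α + 2 * n) k)) Filter.atTop (nhds (zsl x ρ k)) := by
    intro k
    have r := zs_ratio_tendsto hx hρ _ hg k
    have l := (hphi.mul r).sub (hchi.mul ((tendsto_const_nhds (x := (1 : ℝ))).div r (zsl_ne hx hρ k)))
    rw [one_mul, zero_mul, sub_zero] at l
    refine l.congr' ?_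
    filter_upwards [hg.eventually_gt_atTop 0] with n hn
    obtain ⟨c1, c2, c3⟩ := zs_chain hx hρ h ht hS n
    have := zsP_ne hx hρ c1 k
    simp only [Pi.div_apply]
    have : (α + 2 * (n : ℝ)) ^ 2 + x ≠ 0 := by positivity
    field_simp
  have pt : ∀ k : ℕ, Filter.Tendsto (fun n : ℕ => (α + 2 * n) / ((α + 2 * n) ^ 2 + x) *
      ((zsP x ρ (α + 2 * n) (k + 1) - 1 / zsP x ρ (α + 2 * n) (k + 1)) * zsw k)) Filter.atTop (nhds (zsl x ρ (k + 1) * zsw k)) := by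
    intro k
    refine ((pt' (k + 1)).mul_const (zsw k)).congr fun n => ?_
    ring
  have sb := zs_summable_rpow (Real.sqrt C)
  have dom := tendsto_tsum_of_dominated_convergence sb pt (by
    filter_upwards [Filter.eventually_ge_atTop 1] with n hn k
    rw [Real.norm_eq_abs]; exact bound n hn k)
  have sl : Summable (fun k => zsl x ρ (k + 1) * zsw k) := by
    refine Summable.of_norm_bounded sb fun k => ?_
    refine le_of_tendsto (pt k).norm ?_
    filter_upwards [Filter.eventually_ge_atTop 1] with n hn
    rw [Real.norm_eq_abs]; exact bound n hn k
  have fin := (pt' 0).add dom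
  rw [zsl, zsl_tsum hρ sl] at fin
  refine fin.congr' ?_
  filter_upwards [Filter.eventually_ge_atTop 1] with n hn
  obtain ⟨c1, c2, c3⟩ := zs_chain hx hρ h ht hS n
  have s : Summable (fun k => (α + 2 * n) / ((α + 2 * n) ^ 2 + x) *
      ((zsP x ρ (α + 2 * n) (k + 1) - 1 / zsP x ρ (α + 2 * n) (k + 1)) * zsw k)) :=
    Summable.of_norm_bounded sb fun k => by rw [Real.norm_eq_abs]; exact bound n hn k
  have t1 := s.hasSum.tendsto_sum_nat
  have t2 := c3.const_mul ((α + 2 * n) / ((α + 2 * n) ^ 2 + x))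
  have : ∑' k, (α + 2 * n) / ((α + 2 * n) ^ 2 + x) *
      ((zsP x ρ (α + 2 * n) (k + 1) - 1 / zsP x ρ (α + 2 * n) (k + 1)) * zsw k) = (α + 2 * n) / ((α + 2 * n) ^ 2 + x) * zsSl x ρ (α + 2 * n) := by
    refine tendsto_nhds_unique t1 (t2.congr fun N => ?_)
    rw [zsS, Finset.mul_sum]
  rw [this, zsGh, zsP]
  ring

/-- B_m with m real (m = 2n) -/
noncomputable def zsB (x α m : ℝ) : ℝ := zsphi x (m + α) + zsphi x (m - α)
noncomputable def zsX (x α m : ℝ) : ℝ := zschi x (m + α) - zschi x (m - α)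
noncomputable def zsZ (x α m : ℝ) : ℝ := 1 / (m + α) + 1 / (m - α) - zsB x α m
noncomputable def zsY (x α m : ℝ) : ℝ := 1 / (m - 1 + α) + 1 / (m - 1 - α) - zsB x α m

lemma zs_chi_bound {x t : ℝ} {n : ℕ} (hx : 0 < x) (ht : (n : ℝ) + 1 ≤ t) : |zschi x t| ≤ 1 / ((n : ℝ) + 1) ^ 2 := by
  have n0 : (0 : ℝ) ≤ n := Nat.cast_nonneg n
  unfold zschi
  rw [abs_of_nonneg (by positivity)]
  apply one_div_le_one_div_of_le (by positivity)
  nlinarith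

lemma zs_inv_phi_bound {x t : ℝ} {n : ℕ} (hx : 0 < x) (hx1 : x < 1) (ht : (n : ℝ) + 1 ≤ t) : |1 / t - zsphi x t| ≤ 1 / ((n : ℝ) + 1) ^ 2 := by
  have n0 : (0 : ℝ) ≤ n := Nat.cast_nonneg n
  have t0 : 0 < t := by linarith
  have e : 1 / t - zsphi x t = x / (t * (t ^ 2 + x)) := by
    unfold zsphi; field_simp; ring
  rw [e, abs_of_nonneg (by positivity)]
  apply div_le_div₀ (by norm_num) hx1.le (by positivity)
  have : ((n : ℝ) + 1) ^ 2 ≤ t ^ 2 := by gcongr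
  nlinarith [sq_nonneg t]

section
variable {x α : ℝ} {n : ℕ}

lemma zsX_bound (hx : 0 < x) (h0 : 0 ≤ α) (h1 : α ≤ 1) : |zsX x α (2 * n + 2)| ≤ 4 / ((n : ℝ) + 1) ^ 2 := by
  have n0 : (0 : ℝ) ≤ n := Nat.cast_nonneg n
  have a := zs_chi_bound (x := x) (n := n) (t := 2 * n + 2 + α) hx (by linarith)
  have b := zs_chi_bound (x := x) (n := n) (t := 2 * n + 2 - α) hx (by linarith)
  unfold zsX
  calc _ ≤ _ := abs_sub _ _
    _ ≤ 1 / ((n : ℝ) + 1) ^ 2 + 1 / ((n : ℝ) + 1) ^ 2 := add_le_add a b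
    _ = 2 / ((n : ℝ) + 1) ^ 2 := by ring
    _ ≤ _ := by gcongr; norm_num

lemma zsZ_bound (hx : 0 < x) (hx1 : x < 1) (h0 : 0 ≤ α) (h1 : α ≤ 1) : |zsZ x α (2 * n + 2)| ≤ 2 / ((n : ℝ) + 1) ^ 2 := by
  have n0 : (0 : ℝ) ≤ n := Nat.cast_nonneg n
  have a := zs_inv_phi_bound (x := x) (n := n) (t := 2 * n + 2 + α) hx hx1 (by linarith)
  have b := zs_inv_phi_bound (x := x) (n := n) (t := 2 * n + 2 - α) hx hx1 (by linarith)
  unfold zsZ zsB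
  rw [add_sub_add_comm]
  calc _ ≤ _ := abs_add_le _ _
    _ ≤ 1 / ((n : ℝ) + 1) ^ 2 + 1 / ((n : ℝ) + 1) ^ 2 := add_le_add a b
    _ = _ := by ring

lemma zsY_bound (hx : 0 < x) (hx1 : x < 1) (h0 : 0 ≤ α) (h1 : α ≤ 1) : |zsY x α (2 * (n + 1) + 2)| ≤ 4 / ((n : ℝ) + 1) ^ 2 := by
  have n0 : (0 : ℝ) ≤ n := Nat.cast_nonneg n
  have a := zs_inv_phi_bound (x := x) (n := n) (t := 2 * (n + 1) + 2 + α) hx hx1 (by linarith)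
  have b := zs_inv_phi_bound (x := x) (n := n) (t := 2 * (n + 1) + 2 - α) hx hx1 (by linarith)
  have d : ∀ t : ℝ, (n : ℝ) + 2 ≤ t → |1 / (t - 1) - 1 / t| ≤ 1 / ((n : ℝ) + 1) ^ 2 := by
    intro t ht
    have e : 1 / (t - 1) - 1 / t = 1 / ((t - 1) * t) := by
      have : t - 1 ≠ 0 := by linarith
      have : t ≠ 0 := by linarith
      field_simp; ring
    rw [e, abs_of_nonneg (by apply div_nonneg zero_le_one; nlinarith)]
    apply one_div_le_one_div_of_le (by positivity)
    nlinarith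
  have c := d (2 * (n + 1) + 2 + α) (by linarith)
  have d := d (2 * (n + 1) + 2 - α) (by linarith)
  have e : zsY x α (2 * (n + 1) + 2) = ((1 / (2 * ((n : ℝ) + 1) + 2 + α - 1) - 1 / (2 * (n + 1) + 2 + α)) + (1 / (2 * ((n : ℝ) + 1) + 2 - α - 1) - 1 / (2 * (n + 1) + 2 - α)))
      + ((1 / (2 * (n + 1) + 2 + α) - zsphi x (2 * (n + 1) + 2 + α)) + (1 / (2 * (n + 1) + 2 - α) - zsphi x (2 * (n + 1) + 2 - α))) := by
    unfold zsY zsB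
    rw [show 2 * ((n : ℝ) + 1) + 2 - 1 + α = 2 * (n + 1) + 2 + α - 1 by ring, show 2 * ((n : ℝ) + 1) + 2 - 1 - α = 2 * (n + 1) + 2 - α - 1 by ring]
    ring
  rw [e]
  calc _ ≤ _ := abs_add_le _ _
    _ ≤ (1 / ((n : ℝ) + 1) ^ 2 + 1 / ((n : ℝ) + 1) ^ 2) + (1 / ((n : ℝ) + 1) ^ 2 + 1 / ((n : ℝ) + 1) ^ 2) := by
      apply add_le_add
      · exact (abs_add_le _ _).trans (add_le_add c d)
      · exact (abs_add_le _ _).trans (add_le_add a b)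
    _ = _ := by ring
end

noncomputable def zsXs (x α : ℝ) : ℝ := ∑' n : ℕ, zsX x α (2 * n + 2)
noncomputable def zsZs (x α : ℝ) : ℝ := ∑' n : ℕ, zsZ x α (2 * n + 2)
noncomputable def zsYt (x α : ℝ) : ℝ := ∑' n : ℕ, zsY x α (2 * (n + 1) + 2)

lemma zsX_summable {x α : ℝ} (hx : 0 < x) (h0 : 0 ≤ α) (h1 : α ≤ 1) : Summable (fun n : ℕ => zsX x α (2 * n + 2)) :=
  Summable.of_norm_bounded (zs_sum_sq 4) fun n => by rw [Real.norm_eq_abs]; exact zsX_bound hx h0 h1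
lemma zsZ_summable {x α : ℝ} (hx : 0 < x) (hx1 : x < 1) (h0 : 0 ≤ α) (h1 : α ≤ 1) : Summable (fun n : ℕ => zsZ x α (2 * n + 2)) :=
  Summable.of_norm_bounded (zs_sum_sq 2) fun n => by rw [Real.norm_eq_abs]; exact zsZ_bound hx hx1 h0 h1
lemma zsYt_summable {x α : ℝ} (hx : 0 < x) (hx1 : x < 1) (h0 : 0 ≤ α) (h1 : α ≤ 1) : Summable (fun n : ℕ => zsY x α (2 * (n + 1) + 2)) :=
  Summable.of_norm_bounded (zs_sum_sq 4) fun n => by rw [Real.norm_eq_abs]; exact zsY_bound hx hx1 h0 h1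
lemma zsY_summable {x α : ℝ} (hx : 0 < x) (hx1 : x < 1) (h0 : 0 ≤ α) (h1 : α ≤ 1) : Summable (fun n : ℕ => zsY x α (2 * n + 2)) := by
  rw [← summable_nat_add_iff 1]
  have := zsYt_summable hx hx1 h0 h1
  refine this.congr fun n => ?_
  push_cast; rfl
lemma zsY_tsum {x α : ℝ} (hx : 0 < x) (hx1 : x < 1) (h0 : 0 ≤ α) (h1 : α ≤ 1) :
    ∑' n : ℕ, zsY x α (2 * n + 2) = zsY x α 2 + zsYt x α := by
  rw [(zsY_summable hx hx1 h0 h1).tsum_eq_zero_add, zsYt]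
  push_cast
  simp

lemma zs_seq_cont (a : ℕ → ℝ) (a0 : ℝ) (ha : Filter.Tendsto a Filter.atTop (nhds a0)) (x m : ℝ) (hx : 0 < x) :
    Filter.Tendsto (fun i => zsX x (a i) m) Filter.atTop (nhds (zsX x a0 m)) ∧
    Filter.Tendsto (fun i => zsB x (a i) m) Filter.atTop (nhds (zsB x a0 m)) := by
  have p := tendsto_const_nhds (x := m) |>.add ha
  have q := tendsto_const_nhds (x := m) |>.sub ha
  have c : ∀ (t : ℕ → ℝ) (t0 : ℝ), Filter.Tendsto t Filter.atTop (nhds t0) → Filter.Tendsto (fun i => zschi x (t i)) Filter.atTop (nhds (zschi x t0)) := by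
    intro t t0 h
    exact tendsto_const_nhds.div ((h.pow 2).add_const x) (by positivity)
  have f : ∀ (t : ℕ → ℝ) (t0 : ℝ), Filter.Tendsto t Filter.atTop (nhds t0) → Filter.Tendsto (fun i => zsphi x (t i)) Filter.atTop (nhds (zsphi x t0)) := by
    intro t t0 h
    exact h.div ((h.pow 2).add_const x) (by positivity)
  exact ⟨(c _ _ p).sub (c _ _ q), (f _ _ p).add (f _ _ q)⟩

lemma zs_seq_Z (a : ℕ → ℝ) (a0 : ℝ) (ha : Filter.Tendsto a Filter.atTop (nhds a0)) (x m : ℝ) (hx : 0 < x) (h1 : m + a0 ≠ 0) (h2 : m - a0 ≠ 0) :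
    Filter.Tendsto (fun i => zsZ x (a i) m) Filter.atTop (nhds (zsZ x a0 m)) := by
  have p := tendsto_const_nhds (x := m) |>.add ha
  have q := tendsto_const_nhds (x := m) |>.sub ha
  exact ((tendsto_const_nhds.div p h1).add (tendsto_const_nhds.div q h2)).sub (zs_seq_cont a a0 ha x m hx).2

lemma zs_seq_Y (a : ℕ → ℝ) (a0 : ℝ) (ha : Filter.Tendsto a Filter.atTop (nhds a0)) (x m : ℝ) (hx : 0 < x) (h1 : m - 1 + a0 ≠ 0) (h2 : m - 1 - a0 ≠ 0) :
    Filter.Tendsto (fun i => zsY x (a i) m) Filter.atTop (nhds (zsY x a0 m)) := by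
  have p := tendsto_const_nhds (x := m - 1) |>.add ha
  have q := tendsto_const_nhds (x := m - 1) |>.sub ha
  exact ((tendsto_const_nhds.div p h1).add (tendsto_const_nhds.div q h2)).sub (zs_seq_cont a a0 ha x m hx).2

lemma zs_sums_tendsto (a : ℕ → ℝ) (a0 : ℝ) (ha : Filter.Tendsto a Filter.atTop (nhds a0)) (h0 : ∀ i, 0 ≤ a i) (h1 : ∀ i, a i ≤ 1)
    (x : ℝ) (hx : 0 < x) (hx1 : x < 1) :
    Filter.Tendsto (fun i => zsXs x (a i)) Filter.atTop (nhds (zsXs x a0)) ∧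
    Filter.Tendsto (fun i => zsZs x (a i)) Filter.atTop (nhds (zsZs x a0)) ∧
    Filter.Tendsto (fun i => zsYt x (a i)) Filter.atTop (nhds (zsYt x a0)) := by
  have b0 : 0 ≤ a0 := ge_of_tendsto' ha h0
  have b1 : a0 ≤ 1 := le_of_tendsto' ha h1
  have nn : ∀ n : ℕ, (0 : ℝ) ≤ n := fun n => Nat.cast_nonneg n
  refine ⟨?_, ?_, ?_⟩
  · refine tendsto_tsum_of_dominated_convergence (zs_sum_sq 4) (fun n => (zs_seq_cont a a0 ha x _ hx).1) ?_
    exact Filter.Eventually.of_forall fun i n => by rw [Real.norm_eq_abs]; exact zsX_bound hx (h0 i) (h1 i)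
  · refine tendsto_tsum_of_dominated_convergence (zs_sum_sq 2) (fun n => zs_seq_Z a a0 ha x _ hx ?_ ?_) ?_
    · have := nn n; positivity
    · have := nn n; intro e; linarith
    exact Filter.Eventually.of_forall fun i n => by rw [Real.norm_eq_abs]; exact zsZ_bound hx hx1 (h0 i) (h1 i)
  · refine tendsto_tsum_of_dominated_convergence (zs_sum_sq 4) (fun n => zs_seq_Y a a0 ha x _ hx ?_ ?_) ?_
    · have := nn n; intro e; linarith
    · have := nn n; intro e; linarith
    exact Filter.Eventually.of_forall fun i n => by rw [Real.norm_eq_abs]; exact zsY_bound hx hx1 (h0 i) (h1 i)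

lemma zs_T_diff {x ρ α : ℝ} (m : ℝ) :
    zsT x ρ (α + m) - zsT x (-ρ) (-α + m) = 2 * (zsX x α m + zsX x α (m + 2)) +
      ρ * (2 * zsY x α (m + 2) + zsB x α (m + 2) - zsB x α m) - 1 / (ρ * x) * (zsZ x α m + zsZ x α (m + 2)) := by
  unfold zsT zsX zsY zsZ zsB
  rw [show α + m + 1 = m + 2 - 1 + α by ring, show -α + m + 1 = m + 2 - 1 - α by ring, show α + m + 2 = m + 2 + α by ring,
    show -α + m + 2 = m + 2 - α by ring, show α + m = m + α by ring, show -α + m = m - α by ring,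
    show 1 / (-ρ * x) = -(1 / (ρ * x)) by rw [neg_mul, div_neg]]
  ring

lemma zs_zero_vals (x α : ℝ) : zsX x α 0 = 0 ∧ zsB x α 0 = 0 ∧ zsZ x α 0 = 0 := by
  have hX : zsX x α 0 = 0 := by unfold zsX zschi; ring
  have hB : zsB x α 0 = 0 := by
    unfold zsB zsphi
    rw [zero_add, zero_sub, neg_sq]; ring
  refine ⟨hX, hB, ?_⟩
  unfold zsZ; rw [hB, zero_add, zero_sub, div_neg]; ring

lemma zs_T_sum {x ρ α : ℝ} (N : ℕ) :
    ∑ j ∈ Finset.range N, (zsT x ρ (α + 2 * j) - zsT x (-ρ) (-α + 2 * j)) =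
      4 * ∑ j ∈ Finset.range N, zsX x α (2 * j + 2) - 2 * zsX x α (2 * N) +
      ρ * (2 * ∑ j ∈ Finset.range N, zsY x α (2 * j + 2) + zsB x α (2 * N)) -
      1 / (ρ * x) * (2 * ∑ j ∈ Finset.range N, zsZ x α (2 * j + 2) - zsZ x α (2 * N)) := by
  obtain ⟨a, b, c⟩ := zs_zero_vals x α
  induction N with
  | zero => simp [a, b, c]
  | succ N ih =>
    rw [Finset.sum_range_succ, ih, zs_T_diff, Finset.sum_range_succ, Finset.sum_range_succ, Finset.sum_range_succ]
    push_cast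
    rw [show 2 * ((N : ℝ) + 1) = 2 * N + 2 by ring]
    ring

lemma zs_B_tendsto (x α : ℝ) (hx : 0 < x) : Filter.Tendsto (fun N : ℕ => zsB x α (2 * N)) Filter.atTop (nhds 0) := by
  have t2 : Filter.Tendsto (fun N : ℕ => 2 * (N : ℝ)) Filter.atTop Filter.atTop :=
    Filter.Tendsto.const_mul_atTop (by norm_num) tendsto_natCast_atTop_atTop
  have f : ∀ (t : ℕ → ℝ), Filter.Tendsto t Filter.atTop Filter.atTop → Filter.Tendsto (fun i => zsphi x (t i)) Filter.atTop (nhds 0) := by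
    intro t h
    refine squeeze_zero' ?_ ?_ (Filter.Tendsto.div_atTop (tendsto_const_nhds (x := (1 : ℝ))) h)
    · filter_upwards [h.eventually_gt_atTop 0] with i hi
      unfold zsphi; positivity
    · filter_upwards [h.eventually_gt_atTop 0] with i hi
      unfold zsphi
      rw [div_le_div_iff₀ (by positivity) hi]; nlinarith
  have := (f _ (Filter.tendsto_atTop_add_const_right _ α t2)).add (f _ (Filter.tendsto_atTop_add_const_right _ (-α) t2))
  rw [add_zero] at this
  exact this

lemma zs_even_tendsto (f : ℝ → ℝ) (h : Summable (fun n : ℕ => f (2 * n + 2))) : Filter.Tendsto (fun N : ℕ => f (2 * N)) Filter.atTop (nhds 0) := by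
  rw [← Filter.tendsto_add_atTop_iff_nat 1]
  refine h.tendsto_atTop_zero.congr fun n => ?_
  push_cast; congr 1; ring

/-- master formula -/
lemma zs_master {x ρ α S : ℝ} (hx : 0 < x) (hx1 : x < 1) (hρ : ρ ≠ 0) (h0 : 0 < α) (h1 : α < 1)
    (ht : Filter.Tendsto (zsP x ρ α) Filter.atTop (nhds 1)) (hS : Filter.Tendsto (zsS x ρ α) Filter.atTop (nhds S)) :
    zsGh x ρ α S = ρ * zsKe x + zsKo x / ρ - 2 * zsXs x α - ρ * (zsY x α 2 + zsYt x α) + 1 / (ρ * x) * zsZs x α := by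
  have ni := zs_ni_of h0 h1
  have hn : zsP x (-ρ) (-α) = zsP x ρ α := funext fun k => zsP_neg x ρ α k
  have hSn : zsS x (-ρ) (-α) = zsS x ρ α := by
    funext N; unfold zsS; rw [hn]
  have ht' : Filter.Tendsto (zsP x (-ρ) (-α)) Filter.atTop (nhds 1) := by rw [hn]; exact ht
  have hS' : Filter.Tendsto (zsS x (-ρ) (-α)) Filter.atTop (nhds S) := by rw [hSn]; exact hS
  have l1 := zs_limit hx hx1 hρ h0.ne' (by rw [abs_of_pos h0]; exact h1) ni ht hS
  have l2 := zs_limit hx hx1 (neg_ne_zero.2 hρ) (neg_ne_zero.2 h0.ne') (by rw [abs_neg, abs_of_pos h0]; exact h1) (zs_ni_neg ni) ht' hS'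
  have c1 := zs_chain_sum hx hρ ni ht hS
  have c2 := zs_chain_sum hx (neg_ne_zero.2 hρ) (zs_ni_neg ni) ht' hS'
  have hG : zsGh x (-ρ) (-α) S = - zsGh x ρ α S := by
    unfold zsGh; rw [neg_sq, neg_mul_neg]; ring
  have l3 := l1.sub l2
  simp only [c1, c2, hG] at l3
  have X := (zsX_summable hx h0.le h1.le)
  have Z := (zsZ_summable hx hx1 h0.le h1.le)
  have Y := (zsY_summable hx hx1 h0.le h1.le)
  have l4 := (((X.hasSum.tendsto_sum_nat.const_mul 4).sub ((zs_even_tendsto _ X).const_mul 2)).add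
    (((Y.hasSum.tendsto_sum_nat.const_mul 2).add (zs_B_tendsto x α hx)).const_mul ρ)).sub
    (((Z.hasSum.tendsto_sum_nat.const_mul 2).sub (zs_even_tendsto _ Z)).const_mul (1 / (ρ * x)))
  have l5 := l4.const_add (2 * zsGh x ρ α S)
  have u := tendsto_nhds_unique l3 (l5.congr fun N => by
    rw [← zs_T_sum, Finset.sum_sub_distrib]; ring)
  rw [zsY_tsum hx hx1 h0.le h1.le] at u
  change _ = 2 * zsGh x ρ α S + (4 * zsXs x α - 2 * 0 + ρ * (2 * (zsY x α 2 + zsYt x α) + 0) - 1 / (ρ * x) * (2 * zsZs x α - 0)) at u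
  have e : zsKo x / -ρ = -(zsKo x / ρ) := by rw [div_neg]
  rw [e] at u
  linarith

lemma zs_Ke {x : ℝ} (hx : 0 < x) (hx1 : x < 1)
    (H : ∀ α : ℝ, 0 < α → α < 1 → ∃ ρ : ℝ, ρ ≠ 0 ∧ Filter.Tendsto (zsP x ρ α) Filter.atTop (nhds 1)) :
    zsKe x = zsY x 0 2 + zsYt x 0 := by
  have a0 : ∀ i : ℕ, (0 : ℝ) < 1 / ((i : ℝ) + 2) := fun i => by positivity
  have a1 : ∀ i : ℕ, 1 / ((i : ℝ) + 2) < 1 := fun i => by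
    rw [div_lt_one (by positivity)]; linarith [(Nat.cast_nonneg i : (0 : ℝ) ≤ i)]
  have a2 : ∀ i : ℕ, 1 / ((i : ℝ) + 2) ≤ 1 / 2 := fun i => by
    apply one_div_le_one_div_of_le (by norm_num); linarith [(Nat.cast_nonneg i : (0 : ℝ) ≤ i)]
  have ha : Filter.Tendsto (fun i : ℕ => 1 / ((i : ℝ) + 2)) Filter.atTop (nhds 0) :=
    Filter.Tendsto.div_atTop tendsto_const_nhds (Filter.tendsto_atTop_add_const_right _ _ tendsto_natCast_atTop_atTop)
  generalize hdef : (fun i : ℕ => 1 / ((i : ℝ) + 2)) = a at *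
  have a0 : ∀ i, 0 < a i := fun i => by rw [← hdef]; exact a0 i
  have a1 : ∀ i, a i < 1 := fun i => by rw [← hdef]; exact a1 i
  have a2 : ∀ i, a i ≤ 1 / 2 := fun i => by rw [← hdef]; exact a2 i
  choose ρ hρ ht using fun i => H (a i) (a0 i) (a1 i)
  choose S hS hSb using fun i => zs_base_conv hx hx1 (hρ i) (a0 i) (a1 i) (ht i)
  have p0 := fun i => zs_base_p0 hx hx1 (hρ i) (a0 i) (a1 i) (ht i)
  have p0' : ∀ i, 3 / 8 ≤ a i * ρ i := fun i => by
    have := (p0 i).1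
    rw [zsP] at this
    nlinarith [a2 i, a0 i]
  have hr : ∀ i, 1 / ρ i = a i * (1 / (a i * ρ i)) := fun i => by
    have := (a0 i).ne'
    have := hρ i
    field_simp
  have rpos : ∀ i, 0 < ρ i := fun i => by
    have := p0' i; have := a0 i
    by_contra hc
    push Not at hc
    nlinarith
  have rl : Filter.Tendsto (fun i => 1 / ρ i) Filter.atTop (nhds 0) := by
    refine squeeze_zero (fun i => (one_div_pos.2 (rpos i)).le) (fun i => ?_) (by simpa using ha.mul_const (8 / 3))
    rw [hr i]
    have : 1 / (a i * ρ i) ≤ 8 / 3 := by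
      rw [div_le_div_iff₀ (by linarith [p0' i]) (by norm_num)]; linarith [p0' i]
    exact mul_le_mul_of_nonneg_left this (a0 i).le
  -- G / ρ → 0
  have Gl : Filter.Tendsto (fun i => zsGh x (ρ i) (a i) (S i) * (1 / ρ i)) Filter.atTop (nhds 0) := by
    have fl : Filter.Tendsto (fun i => a i / (a i ^ 2 + x)) Filter.atTop (nhds 0) := by
      have := ha.div ((ha.pow 2).add_const x) (by positivity)
      rw [zero_div] at this
      exact this
    have b : ∀ i, |zsGh x (ρ i) (a i) (S i) * (1 / ρ i)| ≤ (a i / (a i ^ 2 + x)) * (1 + (8 / 3) * (8 / 3) + (∑' k : ℕ, 14 / ((k : ℝ) + 1) ^ 2) * (8 / 3)) := by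
      intro i
      have q : 1 / (a i * ρ i) ≤ 8 / 3 := by
        rw [div_le_div_iff₀ (by linarith [p0' i]) (by norm_num)]; linarith [p0' i]
      have q0 : 0 ≤ 1 / (a i * ρ i) := by apply div_nonneg zero_le_one; linarith [p0' i]
      have r3 : 1 / ρ i ≤ 8 / 3 := by
        rw [hr i]; nlinarith [a1 i, a0 i]
      have r0 : 0 ≤ 1 / ρ i := (one_div_pos.2 (rpos i)).le
      have e : zsGh x (ρ i) (a i) (S i) * (1 / ρ i) = (a i / (a i ^ 2 + x)) * (a i - (1 / (a i * ρ i)) * (1 / ρ i) + S i * (1 / ρ i)) := by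
        unfold zsGh
        have := hρ i
        field_simp
      have f0 : 0 ≤ a i / (a i ^ 2 + x) := by have := a0 i; positivity
      rw [e, abs_mul, abs_of_nonneg f0]
      gcongr
      calc _ ≤ |a i - (1 / (a i * ρ i)) * (1 / ρ i)| + |S i * (1 / ρ i)| := abs_add_le _ _
        _ ≤ (|a i| + |(1 / (a i * ρ i)) * (1 / ρ i)|) + |S i * (1 / ρ i)| := by gcongr; exact abs_sub _ _
        _ ≤ _ := by
          rw [abs_mul, abs_mul, abs_of_nonneg q0, abs_of_nonneg r0, abs_of_pos (a0 i)]
          gcongr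
          · exact (a1 i).le
          · exact hSb i
    rw [tendsto_zero_iff_abs_tendsto_zero]
    refine squeeze_zero (fun i => abs_nonneg _) b ?_
    simpa using fl.mul_const (1 + (8 / 3) * (8 / 3) + (∑' k : ℕ, 14 / ((k : ℝ) + 1) ^ 2) * (8 / 3))
  obtain ⟨lX, lZ, lY⟩ := zs_sums_tendsto a 0 ha (fun i => (a0 i).le) (fun i => (a1 i).le) x hx hx1
  have lY0 := zs_seq_Y a 0 ha x 2 hx (by norm_num) (by norm_num)
  have l := ((((tendsto_const_nhds (x := zsKe x)).add ((rl.mul rl).const_mul (zsKo x))).sub ((lX.mul rl).const_mul 2)).sub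
    (lY0.add lY)).add (((rl.mul rl).mul lZ).const_mul (1 / x))
  have u := tendsto_nhds_unique Gl (l.congr fun i => by
    rw [zs_master hx hx1 (hρ i) (a0 i) (a1 i) (ht i) (hS i)]
    have := hρ i
    field_simp)
  simp only [mul_zero, zero_mul, add_zero, sub_zero] at u
  linarith

lemma zs_Ko {x : ℝ} (hx : 0 < x) (hx1 : x < 1)
    (H : ∀ α : ℝ, 0 < α → α < 1 → ∃ ρ : ℝ, ρ ≠ 0 ∧ Filter.Tendsto (zsP x ρ α) Filter.atTop (nhds 1)) :
    zsKo x = -1 / (1 + x) - zsZs x 1 / x := by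
  have a0 : ∀ i : ℕ, (0 : ℝ) < 1 / ((i : ℝ) + 2) := fun i => by positivity
  have a2 : ∀ i : ℕ, 1 / ((i : ℝ) + 2) ≤ 1 / 2 := fun i => by
    apply one_div_le_one_div_of_le (by norm_num); linarith [(Nat.cast_nonneg i : (0 : ℝ) ≤ i)]
  have ha' : Filter.Tendsto (fun i : ℕ => 1 - 1 / ((i : ℝ) + 2)) Filter.atTop (nhds (1 - 0)) :=
    tendsto_const_nhds.sub (Filter.Tendsto.div_atTop tendsto_const_nhds (Filter.tendsto_atTop_add_const_right _ _ tendsto_natCast_atTop_atTop))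
  rw [sub_zero] at ha'
  obtain ⟨a, a1, a2, ha⟩ : ∃ a : ℕ → ℝ, (∀ i, a i < 1) ∧ (∀ i, 1 / 2 ≤ a i) ∧ Filter.Tendsto a Filter.atTop (nhds 1) :=
    ⟨_, fun i => by linarith [a0 i], fun i => by linarith [a2 i], ha'⟩
  have a0 : ∀ i, 0 < a i := fun i => by linarith [a2 i]
  choose ρ hρ ht using fun i => H (a i) (a0 i) (a1 i)
  choose S hS hSb using fun i => zs_base_conv hx hx1 (hρ i) (a0 i) (a1 i) (ht i)
  have p0 := fun i => zs_base_p0 hx hx1 (hρ i) (a0 i) (a1 i) (ht i)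
  have rpos : ∀ i, 0 < ρ i := fun i => by
    have := (p0 i).1
    rw [zsP] at this
    have := a0 i
    have := a1 i
    by_contra hc
    push Not at hc
    nlinarith
  have rle : ∀ i, ρ i ≤ 20 / 3 * (1 - a i) := fun i => by
    have := (p0 i).2
    rw [zsP] at this
    have h1 : ρ i * (1 / 2) ≤ a i * ρ i := by nlinarith [a2 i, rpos i]
    nlinarith [a1 i, a0 i]
  have dl : Filter.Tendsto (fun i => 20 / 3 * (1 - a i)) Filter.atTop (nhds 0) := by
    have := (tendsto_const_nhds (x := (1 : ℝ)).sub ha).const_mul (20 / 3)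
    simpa using this
  have rl : Filter.Tendsto ρ Filter.atTop (nhds 0) := squeeze_zero (fun i => (rpos i).le) rle dl
  have sing : Filter.Tendsto (fun i => ρ i * (ρ i * (1 / (1 - a i)))) Filter.atTop (nhds 0) := by
    refine squeeze_zero (fun i => ?_) (fun i => ?_) (by simpa using rl.mul_const (20 / 3))
    · have := rpos i
      have : 0 < 1 - a i := by linarith [a1 i]
      positivity
    · have h : 0 < 1 - a i := by linarith [a1 i]
      apply mul_le_mul_of_nonneg_left _ (rpos i).le
      rw [mul_one_div, div_le_iff₀ h]
      exact rle i
  have Sl : Filter.Tendsto (fun i => ρ i * S i) Filter.atTop (nhds 0) := by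
    rw [tendsto_zero_iff_abs_tendsto_zero]
    refine squeeze_zero (fun i => abs_nonneg _) (fun i => ?_) (by simpa using rl.mul_const (∑' k : ℕ, 14 / ((k : ℝ) + 1) ^ 2))
    simp only [Function.comp]
    rw [abs_mul, abs_of_pos (rpos i)]
    exact mul_le_mul_of_nonneg_left (hSb i) (rpos i).le
  have Gl : Filter.Tendsto (fun i => ρ i * zsGh x (ρ i) (a i) (S i)) Filter.atTop (nhds (1 / (1 ^ 2 + x) * (1 * (0 * 0) - 1 / 1 + 0))) := by
    have := (ha.div ((ha.pow 2).add_const x) (by positivity)).mul (((ha.mul (rl.mul rl)).sub ((tendsto_const_nhds (x := (1 : ℝ))).div ha one_ne_zero)).add Sl)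
    refine this.congr fun i => ?_
    unfold zsGh
    have := hρ i
    have := (a0 i).ne'
    simp only [Pi.div_apply]
    field_simp
  obtain ⟨lX, lZ, lY⟩ := zs_sums_tendsto a 1 ha (fun i => (a0 i).le) (fun i => (a1 i).le) x hx hx1
  have lB := (zs_seq_cont a 1 ha x 2 hx).2
  have lY0 : Filter.Tendsto (fun i => ρ i * ρ i * zsY x (a i) 2) Filter.atTop (nhds (0 * 0 * (1 / (2 - 1 + 1)) + 0 - 0 * 0 * zsB x 1 2)) := by
    have := (((rl.mul rl).mul ((tendsto_const_nhds (x := (1 : ℝ))).div (ha.const_add (2 - 1)) (by norm_num))).add sing).sub ((rl.mul rl).mul lB)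
    refine this.congr fun i => ?_
    unfold zsY
    rw [show (2 : ℝ) - 1 - a i = 1 - a i by ring]
    simp only [Pi.div_apply]
    ring
  have l := (((((rl.mul rl).mul_const (zsKe x)).add_const (zsKo x)).sub ((rl.mul lX).const_mul 2)).sub
    (lY0.add ((rl.mul rl).mul lY))).add (lZ.const_mul (1 / x))
  have u := tendsto_nhds_unique Gl (l.congr fun i => by
    rw [zs_master hx hx1 (hρ i) (a0 i) (a1 i) (ht i) (hS i)]
    have := hρ i
    field_simp)
  simp only [mul_zero, zero_mul, add_zero, zero_add, sub_zero, zero_sub, one_pow, div_one] at u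
  have e1 : zsZs x 1 / x = 1 / x * zsZs x 1 := by ring
  have e2 : -1 / (1 + x) = 1 / (1 + x) * -1 := by ring
  rw [e1, e2]
  linarith

lemma zs_euler_sinh (z : ℝ) : Filter.Tendsto (fun n : ℕ => Real.pi * z * ∏ j ∈ Finset.range n, (1 + z ^ 2 / ((j : ℝ) + 1) ^ 2))
    Filter.atTop (nhds (Real.sinh (Real.pi * z))) := by
  have h := Complex.tendsto_euler_sin_prod ((z : ℂ) * Complex.I)
  have h2 := (h.mul_const (-Complex.I))
  have h3 := (Complex.continuous_re.tendsto _).comp h2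
  have e : (Complex.sin (Real.pi * (z * Complex.I)) * -Complex.I).re = Real.sinh (Real.pi * z) := by
    rw [← mul_assoc, Complex.sin_mul_I, mul_assoc, mul_neg, Complex.I_mul_I, neg_neg, mul_one]
    rw [← Complex.ofReal_mul, ← Complex.ofReal_sinh, Complex.ofReal_re]
  rw [e] at h3
  refine h3.congr fun n => ?_
  simp only [Function.comp]
  have : (Real.pi : ℂ) * (z * Complex.I) * (∏ j ∈ Finset.range n, (1 - ((z : ℂ) * Complex.I) ^ 2 / ((j : ℂ) + 1) ^ 2)) * -Complex.I =
      ((Real.pi * z * ∏ j ∈ Finset.range n, (1 + z ^ 2 / ((j : ℝ) + 1) ^ 2) : ℝ) : ℂ) := by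
    push_cast
    have : ∀ j : ℕ, (1 - ((z : ℂ) * Complex.I) ^ 2 / ((j : ℂ) + 1) ^ 2) = 1 + (z : ℂ) ^ 2 / ((j : ℂ) + 1) ^ 2 := by
      intro j; rw [mul_pow, Complex.I_sq]; ring
    simp only [this]
    linear_combination (-(Real.pi * (z : ℂ) * ∏ j ∈ Finset.range n, (1 + (z : ℂ) ^ 2 / ((j : ℂ) + 1) ^ 2))) * Complex.I_mul_I
  rw [this, Complex.ofReal_re]

lemma zs_prod_r {z α : ℝ} (hz : 0 < z) (h0 : 0 < α) (h1 : α < 1) :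
    Filter.Tendsto (fun n : ℕ => ∏ j ∈ Finset.range n, (((j : ℝ) + 1) ^ 2 - α ^ 2) / (((j : ℝ) + 1) ^ 2 + z ^ 2)) Filter.atTop
      (nhds ((Real.sin (Real.pi * α) / (Real.pi * α)) / (Real.sinh (Real.pi * z) / (Real.pi * z)))) := by
  have p := Real.pi_pos
  have s1 := (Real.tendsto_euler_sin_prod α).div_const (Real.pi * α)
  have s2 := (zs_euler_sinh z).div_const (Real.pi * z)
  have n2 : Real.sinh (Real.pi * z) / (Real.pi * z) ≠ 0 := by
    have : 0 < Real.sinh (Real.pi * z) := Real.sinh_pos_iff.2 (by positivity)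
    positivity
  refine (s1.div s2 n2).congr fun n => ?_
  simp only [Pi.div_apply]
  rw [mul_div_cancel_left₀ _ (by positivity), mul_div_cancel_left₀ _ (by positivity), ← Finset.prod_div_distrib]
  refine Finset.prod_congr rfl fun j _ => ?_
  have : (j : ℝ) + 1 ≠ 0 := by positivity
  field_simp

lemma zs_P_even {x ρ α : ℝ} (hx : 0 < x) (hρ : ρ ≠ 0) (ni : ∀ m : ℤ, (m : ℝ) ≠ α) (m : ℕ) :
    zsP x ρ α (2 * m) * ∏ j ∈ Finset.range (2 * m), (((j : ℝ) + 1) ^ 2 - α ^ 2) / (((j : ℝ) + 1) ^ 2 + x) =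
      α * ρ * (∏ j ∈ Finset.range m, (((j : ℝ) + 1) ^ 2 - (α / 2) ^ 2) / (((j : ℝ) + 1) ^ 2 + x / 4)) ^ 2 := by
  induction m with
  | zero => simp [zsP]
  | succ m ih =>
    rw [Finset.prod_range_succ, show 2 * (m + 1) = 2 * m + 1 + 1 by ring, Finset.prod_range_succ, Finset.prod_range_succ, mul_pow]
    have r1 := zsP_rec hx hρ ni (2 * m)
    have r2 := zsP_rec hx hρ ni (2 * m + 1)
    have n0 := zsP_ne hx hρ ni (2 * m)
    have n1 := zsP_ne hx hρ ni (2 * m + 1)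
    have e : (((m : ℝ) + 1) ^ 2 - (α / 2) ^ 2) / (((m : ℝ) + 1) ^ 2 + x / 4) =
        ((((2 * m + 1 : ℕ) : ℝ) + 1) ^ 2 - α ^ 2) / ((((2 * m + 1 : ℕ) : ℝ) + 1) ^ 2 + x) := by
      push_cast
      rw [div_eq_div_iff (by positivity) (by positivity)]
      ring
    rw [e, ← mul_assoc (α * ρ), ← ih, ← r1, ← r2]
    ring

noncomputable def zsrho (z α : ℝ) : ℝ := Real.cos (Real.pi * α / 2) / Real.sin (Real.pi * α / 2) *
  (Real.sinh (Real.pi * z / 2) / Real.cosh (Real.pi * z / 2)) / z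

lemma zs_rho_pos {z α : ℝ} (hz : 0 < z) (h0 : 0 < α) (h1 : α < 1) : 0 < zsrho z α := by
  have p := Real.pi_pos
  have c : 0 < Real.cos (Real.pi * α / 2) := Real.cos_pos_of_mem_Ioo ⟨by nlinarith, by nlinarith⟩
  have s : 0 < Real.sin (Real.pi * α / 2) := Real.sin_pos_of_pos_of_lt_pi (by positivity) (by nlinarith)
  have s2 : 0 < Real.sinh (Real.pi * z / 2) := Real.sinh_pos_iff.2 (by positivity)
  have c2 := Real.cosh_pos (Real.pi * z / 2)
  unfold zsrho; positivity

lemma zs_P_tendsto {z α : ℝ} (hz : 0 < z) (h0 : 0 < α) (h1 : α < 1) :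
    Filter.Tendsto (zsP (z ^ 2) (zsrho z α) α) Filter.atTop (nhds 1) := by
  have p := Real.pi_pos
  have c : 0 < Real.cos (Real.pi * α / 2) := Real.cos_pos_of_mem_Ioo ⟨by nlinarith, by nlinarith⟩
  have s : 0 < Real.sin (Real.pi * α / 2) := Real.sin_pos_of_pos_of_lt_pi (by positivity) (by nlinarith)
  have s2 : 0 < Real.sinh (Real.pi * z / 2) := Real.sinh_pos_iff.2 (by positivity)
  have c2 := Real.cosh_pos (Real.pi * z / 2)
  have ni := zs_ni_of h0 h1
  have hρ := (zs_rho_pos hz h0 h1).ne'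
  have hx : 0 < z ^ 2 := by positivity
  have A := zs_prod_r hz h0 h1
  have E := zs_prod_r (z := z / 2) (α := α / 2) (by positivity) (by positivity) (by linarith)
  have t2 : Filter.Tendsto (fun m : ℕ => 2 * m) Filter.atTop Filter.atTop :=
    Filter.tendsto_atTop_mono (fun m => by simp only [id]; omega) Filter.tendsto_id
  have A2 := A.comp t2
  have d1 : Real.sin (Real.pi * α) = 2 * Real.sin (Real.pi * α / 2) * Real.cos (Real.pi * α / 2) := by
    rw [← Real.sin_two_mul]; congr 1; ring
  have d2 : Real.sinh (Real.pi * z) = 2 * Real.sinh (Real.pi * z / 2) * Real.cosh (Real.pi * z / 2) := by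
    rw [← Real.sinh_two_mul]; congr 1; ring
  rw [d1, d2] at A2
  rw [← mul_div_assoc, ← mul_div_assoc] at E
  have even : Filter.Tendsto (fun m : ℕ => zsP (z ^ 2) (zsrho z α) α (2 * m)) Filter.atTop (nhds 1) := by
    have l := ((E.pow 2).const_mul (α * zsrho z α)).div A2 (by positivity)
    have v : (α * zsrho z α * (Real.sin (Real.pi * α / 2) / (Real.pi * α / 2) / (Real.sinh (Real.pi * z / 2) / (Real.pi * z / 2))) ^ 2) /
        (2 * Real.sin (Real.pi * α / 2) * Real.cos (Real.pi * α / 2) / (Real.pi * α) / (2 * Real.sinh (Real.pi * z / 2) * Real.cosh (Real.pi * z / 2) / (Real.pi * z))) = 1 := by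
      unfold zsrho
      generalize Real.sin (Real.pi * α / 2) = s' at *
      generalize Real.cos (Real.pi * α / 2) = c' at *
      generalize Real.sinh (Real.pi * z / 2) = s2' at *
      generalize Real.cosh (Real.pi * z / 2) = c2' at *
      clear l A2 E A d1 d2
      field_simp
    rw [v] at l
    refine l.congr fun m => ?_
    simp only [Pi.div_apply, Function.comp]
    have e := zs_P_even hx hρ ni m
    rw [show z ^ 2 / 4 = (z / 2) ^ 2 by ring] at e
    rw [← e, mul_div_cancel_right₀]
    refine Finset.prod_ne_zero_iff.2 fun j _ => ?_
    exact div_ne_zero (zs_ni_sq ni j) (by positivity)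
  have odd : Filter.Tendsto (fun m : ℕ => zsP (z ^ 2) (zsrho z α) α (2 * m + 1)) Filter.atTop (nhds 1) := by
    have t3 : Filter.Tendsto (fun m : ℕ => 2 * m + 1) Filter.atTop Filter.atTop :=
      Filter.tendsto_atTop_mono (fun m => by simp only [id]; omega) Filter.tendsto_id
    have l := ((zsr_tendsto (z ^ 2) α).comp t3).div even one_ne_zero
    rw [div_one] at l
    refine l.congr fun m => ?_
    simp only [Pi.div_apply, Function.comp]
    rw [zsP, zsr]; push_cast; rfl
  rw [Metric.tendsto_atTop] at even odd ⊢
  intro ε hε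
  obtain ⟨N1, h1⟩ := even ε hε
  obtain ⟨N2, h2⟩ := odd ε hε
  refine ⟨2 * (N1 + N2), fun n hn => ?_⟩
  rcases Nat.even_or_odd' n with ⟨m, rfl | rfl⟩
  · exact h1 m (by omega)
  · exact h2 m (by omega)

noncomputable def zsEta (s : ℝ) : ℝ := ∑' n : ℕ, 1 / (((n : ℝ) + 1) * (((n : ℝ) + 1) ^ 2 - s))
noncomputable def zsTh (s : ℝ) : ℝ := ∑' n : ℕ, 1 / (((n : ℝ) + 1) * (((n : ℝ) + 1) ^ 4 - s))
noncomputable def zsQ (s : ℝ) : ℝ := ∑' n : ℕ, ((n : ℝ) + 1) / (((n : ℝ) + 1) ^ 4 - s)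
noncomputable def zsm (x : ℝ) : ℝ := 2 * zsEta x - zsEta (x / 4) / 4 - zsEta (-x / 4) / 4 + x / 4 * zsTh (-(x ^ 2 / 4))

lemma zsEta_den {s : ℝ} (hs : s ≤ 1 / 2) (n : ℕ) : ((n : ℝ) + 1) ^ 2 / 2 ≤ ((n : ℝ) + 1) ^ 2 - s := by
  have : (0 : ℝ) ≤ n := Nat.cast_nonneg n
  nlinarith

lemma zsEta_summable {s : ℝ} (hs : s ≤ 1 / 2) : Summable fun n : ℕ => 1 / (((n : ℝ) + 1) * (((n : ℝ) + 1) ^ 2 - s)) := by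
  refine Summable.of_norm_bounded (zs_sum_sq 2) fun n => ?_
  have n0 : (0 : ℝ) ≤ n := Nat.cast_nonneg n
  have d := zsEta_den hs n
  have d0 : 0 < ((n : ℝ) + 1) ^ 2 - s := lt_of_lt_of_le (by positivity) d
  rw [Real.norm_eq_abs, abs_of_nonneg (by positivity), div_le_div_iff₀ (by positivity) (by positivity)]
  nlinarith

lemma zsTh_den {s : ℝ} (hs : s ≤ 1 / 2) (n : ℕ) : ((n : ℝ) + 1) ^ 4 / 2 ≤ ((n : ℝ) + 1) ^ 4 - s := by
  have : (0 : ℝ) ≤ n := Nat.cast_nonneg n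
  have : 1 ≤ ((n : ℝ) + 1) ^ 4 := one_le_pow₀ (by linarith)
  nlinarith

lemma zsTh_summable {s : ℝ} (hs : s ≤ 1 / 2) : Summable fun n : ℕ => 1 / (((n : ℝ) + 1) * (((n : ℝ) + 1) ^ 4 - s)) := by
  refine Summable.of_norm_bounded (zs_sum_sq 2) fun n => ?_
  have n0 : (0 : ℝ) ≤ n := Nat.cast_nonneg n
  have d := zsTh_den hs n
  have d0 : 0 < ((n : ℝ) + 1) ^ 4 - s := lt_of_lt_of_le (by positivity) d
  rw [Real.norm_eq_abs, abs_of_nonneg (by positivity), div_le_div_iff₀ (by positivity) (by positivity)]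
  have : 1 ≤ ((n : ℝ) + 1) := by linarith
  have : ((n : ℝ) + 1) ^ 2 ≤ ((n : ℝ) + 1) ^ 4 := pow_le_pow_right₀ this (by norm_num)
  nlinarith

lemma zsEta_odd_summable {s : ℝ} (hs : s ≤ 1 / 2) : Summable fun n : ℕ => 1 / ((2 * (n : ℝ) + 1) * ((2 * (n : ℝ) + 1) ^ 2 - s)) := by
  have h := (zsEta_summable hs).comp_injective (i := fun k : ℕ => 2 * k) (fun a b h => by simpa using h)
  refine h.congr fun n => ?_
  simp only [Function.comp]; push_cast; rfl

lemma zsEta_even_term (s : ℝ) (k : ℕ) : 1 / ((((2 * k + 1 : ℕ) : ℝ) + 1) * ((((2 * k + 1 : ℕ) : ℝ) + 1) ^ 2 - s)) =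
    1 / (((k : ℝ) + 1) * (((k : ℝ) + 1) ^ 2 - s / 4)) / 8 := by
  push_cast
  rw [show (2 * (k : ℝ) + 1 + 1) * ((2 * (k : ℝ) + 1 + 1) ^ 2 - s) = (((k : ℝ) + 1) * (((k : ℝ) + 1) ^ 2 - s / 4)) * 8 by ring]
  rw [div_mul_eq_div_div]

lemma zsEta_odd {s : ℝ} (hs : s ≤ 1 / 2) :
    HasSum (fun n : ℕ => 1 / ((2 * (n : ℝ) + 1) * ((2 * (n : ℝ) + 1) ^ 2 - s))) (zsEta s - zsEta (s / 4) / 8) := by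
  have hs4 : s / 4 ≤ 1 / 2 := by linarith
  have h1 := (zsEta_odd_summable hs).hasSum
  have h2 := (zsEta_summable hs4).hasSum.div_const 8
  have t : HasSum (fun n : ℕ => 1 / (((n : ℝ) + 1) * (((n : ℝ) + 1) ^ 2 - s)))
      (∑' n : ℕ, 1 / ((2 * (n : ℝ) + 1) * ((2 * (n : ℝ) + 1) ^ 2 - s)) + (∑' n : ℕ, 1 / (((n : ℝ) + 1) * (((n : ℝ) + 1) ^ 2 - s / 4))) / 8) := by
    apply HasSum.even_add_odd
    · refine h1.congr_fun ?_
      intro k; push_cast; rfl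
    · refine h2.congr_fun ?_
      intro k; exact zsEta_even_term s k
  have u := t.tsum_eq
  have v : zsEta s - zsEta (s / 4) / 8 = ∑' n : ℕ, 1 / ((2 * (n : ℝ) + 1) * ((2 * (n : ℝ) + 1) ^ 2 - s)) := by
    unfold zsEta; rw [u]; ring
  rw [v]; exact h1

lemma zsB_spec {z k : ℝ} (hz : 0 < z) (hk : 0 < k) : zsB (z ^ 2) z (2 * k) = k ^ 3 / (k ^ 4 + z ^ 4 / 4) := by
  unfold zsB zsphi
  have : (2 * k - z) ^ 2 + z ^ 2 ≠ 0 := by positivity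
  have : (2 * k + z) ^ 2 + z ^ 2 ≠ 0 := by positivity
  have : k ^ 4 + z ^ 4 / 4 ≠ 0 := by positivity
  field_simp
  ring

lemma zsX_spec {z k : ℝ} (hz : 0 < z) (hk : 0 < k) : zsX (z ^ 2) z (2 * k) = -(z / 2) * (k / (k ^ 4 - -((z ^ 2) ^ 2 / 4))) := by
  unfold zsX zschi
  have : (2 * k - z) ^ 2 + z ^ 2 ≠ 0 := by positivity
  have : (2 * k + z) ^ 2 + z ^ 2 ≠ 0 := by positivity
  have : k ^ 4 - -((z ^ 2) ^ 2 / 4) ≠ 0 := by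
    have : 0 < k ^ 4 + (z ^ 2) ^ 2 / 4 := by positivity
    linarith
  have : k ^ 4 * 4 + z ^ 4 ≠ 0 := by positivity
  rw [show k ^ 4 - -((z ^ 2) ^ 2 / 4) = (k ^ 4 * 4 + z ^ 4) / 4 by ring]
  field_simp
  ring

lemma zsXs_spec {z : ℝ} (hz : 0 < z) : zsXs (z ^ 2) z = -(z / 2) * zsQ (-((z ^ 2) ^ 2 / 4)) := by
  unfold zsXs zsQ
  rw [← tsum_mul_left]
  refine tsum_congr fun n => ?_
  rw [show 2 * (n : ℝ) + 2 = 2 * (n + 1) by ring, zsX_spec hz (by positivity)]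

lemma zs_l1 {a z : ℝ} (hz : 0 < z) (ha : z < a) : 1 / (a + z) + 1 / (a - z) - (1 / a + 1 / a) = 2 * z ^ 2 * (1 / (a * (a ^ 2 - z ^ 2))) := by
  have h1 : a - z ≠ 0 := by linarith
  have h2 : a + z ≠ 0 := by linarith
  have h3 : a ≠ 0 := by linarith
  rw [show a ^ 2 - z ^ 2 = (a - z) * (a + z) by ring]
  field_simp
  ring

lemma zs_l2 {x k : ℝ} (hx : 0 < x) (hk : 0 < k) : zsphi x (2 * k) + zsphi x (2 * k) - 1 / k = -(x / 4) * (1 / (k * (k ^ 2 - -x / 4))) := by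
  unfold zsphi
  rw [show k ^ 2 - -x / 4 = ((2 * k) ^ 2 + x) / 4 by ring]
  field_simp
  ring

lemma zs_l3 {x k : ℝ} (hx : 0 < x) (hk : 0 < k) : 1 / k - k ^ 3 / (k ^ 4 + x ^ 2 / 4) = x ^ 2 / 4 * (1 / (k * (k ^ 4 - -(x ^ 2 / 4)))) := by
  rw [show k ^ 4 - -(x ^ 2 / 4) = k ^ 4 + x ^ 2 / 4 by ring]
  have : k ^ 4 + x ^ 2 / 4 ≠ 0 := by positivity
  field_simp
  ring

lemma zs_l4 {x k : ℝ} (hx : 0 < x) (hx1 : x < 1) (hk : 1 ≤ k) : 4 * k / (4 * k ^ 2 - x) - 1 / k = x / 4 * (1 / (k * (k ^ 2 - x / 4))) := by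
  have : 0 < 4 * k ^ 2 - x := by nlinarith
  rw [show k ^ 2 - x / 4 = (4 * k ^ 2 - x) / 4 by ring]
  field_simp
  ring

lemma zsY_spec {z : ℝ} (hz : 0 < z) (hz1 : z ^ 2 < 1 / 8) (n : ℕ) :
    zsY (z ^ 2) z (2 * n + 2) - zsY (z ^ 2) 0 (2 * n + 2) =
      2 * z ^ 2 * (1 / ((2 * (n : ℝ) + 1) * ((2 * (n : ℝ) + 1) ^ 2 - z ^ 2)))
      + -(z ^ 2 / 4) * (1 / (((n : ℝ) + 1) * (((n : ℝ) + 1) ^ 2 - -z ^ 2 / 4)))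
      + (z ^ 2) ^ 2 / 4 * (1 / (((n : ℝ) + 1) * (((n : ℝ) + 1) ^ 4 - -((z ^ 2) ^ 2 / 4)))) := by
  have n0 : (0 : ℝ) ≤ n := Nat.cast_nonneg n
  have z1 : z < 1 := by nlinarith
  have hx : 0 < z ^ 2 := by positivity
  rw [← zs_l1 hz (by linarith), ← zs_l2 hx (by positivity), ← zs_l3 hx (by positivity)]
  unfold zsY
  rw [show 2 * (n : ℝ) + 2 = 2 * (n + 1) by ring, zsB_spec hz (by positivity)]
  unfold zsB
  rw [show 2 * ((n : ℝ) + 1) - 1 = 2 * n + 1 by ring]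
  simp only [add_zero, sub_zero]
  ring

lemma zsY_diff {z : ℝ} (hz : 0 < z) (hz1 : z ^ 2 < 1 / 8) :
    (zsY (z ^ 2) z 2 + zsYt (z ^ 2) z) - (zsY (z ^ 2) 0 2 + zsYt (z ^ 2) 0) = z ^ 2 * zsm (z ^ 2) := by
  have z1 : z < 1 := by nlinarith
  have hx : 0 < z ^ 2 := by positivity
  have hx1 : z ^ 2 < 1 := by linarith
  rw [← zsY_tsum hx hx1 hz.le z1.le, ← zsY_tsum hx hx1 le_rfl zero_le_one]
  have h := (zsY_summable hx hx1 hz.le z1.le).hasSum.sub (zsY_summable hx hx1 le_rfl zero_le_one).hasSum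
  have h' := (((zsEta_odd (s := z ^ 2) (by linarith)).mul_left (2 * z ^ 2)).add
    ((zsEta_summable (s := -z ^ 2 / 4) (by linarith)).hasSum.mul_left (-(z ^ 2 / 4)))).add
    ((zsTh_summable (s := -((z ^ 2) ^ 2 / 4)) (by nlinarith)).hasSum.mul_left ((z ^ 2) ^ 2 / 4))
  have u := h.unique (h'.congr_fun fun n => zsY_spec hz hz1 n)
  rw [u]
  unfold zsm
  change 2 * z ^ 2 * (zsEta (z ^ 2) - zsEta (z ^ 2 / 4) / 8) + -(z ^ 2 / 4) * zsEta (-z ^ 2 / 4) + (z ^ 2) ^ 2 / 4 * zsTh (-((z ^ 2) ^ 2 / 4)) = _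
  ring

lemma zsZ_spec {z : ℝ} (hz : 0 < z) (hz1 : z ^ 2 < 1 / 8) (n : ℕ) :
    zsZ (z ^ 2) z (2 * n + 2) =
      z ^ 2 / 4 * (1 / (((n : ℝ) + 1) * (((n : ℝ) + 1) ^ 2 - z ^ 2 / 4)))
      + (z ^ 2) ^ 2 / 4 * (1 / (((n : ℝ) + 1) * (((n : ℝ) + 1) ^ 4 - -((z ^ 2) ^ 2 / 4)))) := by
  have n0 : (0 : ℝ) ≤ n := Nat.cast_nonneg n
  have z1 : z < 1 := by nlinarith
  have hx : 0 < z ^ 2 := by positivity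
  rw [← zs_l4 hx (by linarith) (by linarith), ← zs_l3 hx (by positivity)]
  unfold zsZ
  rw [show 2 * (n : ℝ) + 2 = 2 * (n + 1) by ring, zsB_spec hz (by positivity)]
  have e : 1 / (2 * ((n : ℝ) + 1) + z) + 1 / (2 * ((n : ℝ) + 1) - z) = 4 * ((n : ℝ) + 1) / (4 * ((n : ℝ) + 1) ^ 2 - z ^ 2) := by
    have h1 : 2 * ((n : ℝ) + 1) - z ≠ 0 := by linarith
    have h2 : 2 * ((n : ℝ) + 1) + z ≠ 0 := by linarith
    rw [show 4 * ((n : ℝ) + 1) ^ 2 - z ^ 2 = (2 * ((n : ℝ) + 1) - z) * (2 * ((n : ℝ) + 1) + z) by ring]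
    field_simp
    ring
  rw [e]; ring

lemma zsZs_spec {z : ℝ} (hz : 0 < z) (hz1 : z ^ 2 < 1 / 8) :
    zsZs (z ^ 2) z = z ^ 2 / 4 * zsEta (z ^ 2 / 4) + (z ^ 2) ^ 2 / 4 * zsTh (-((z ^ 2) ^ 2 / 4)) := by
  have h' := ((zsEta_summable (s := z ^ 2 / 4) (by linarith)).hasSum.mul_left (z ^ 2 / 4)).add
    ((zsTh_summable (s := -((z ^ 2) ^ 2 / 4)) (by nlinarith)).hasSum.mul_left ((z ^ 2) ^ 2 / 4))
  exact (h'.congr_fun fun n => zsZ_spec hz hz1 n).tsum_eq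

lemma zsZ1_spec {x : ℝ} (hx : 0 < x) (n : ℕ) :
    zsZ x 1 (2 * n + 2) = x * (1 / ((2 * (n : ℝ) + 1) * ((2 * (n : ℝ) + 1) ^ 2 - -x)) +
      1 / ((2 * ((n + 1 : ℕ) : ℝ) + 1) * ((2 * ((n + 1 : ℕ) : ℝ) + 1) ^ 2 - -x))) := by
  have h : ∀ t : ℝ, 0 < t → 1 / t - zsphi x t = x * (1 / (t * (t ^ 2 - -x))) := by
    intro t ht
    unfold zsphi
    rw [show t ^ 2 - -x = t ^ 2 + x by ring]
    field_simp
    ring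
  have n0 : (0 : ℝ) ≤ n := Nat.cast_nonneg n
  rw [mul_add, ← h _ (by positivity), ← h _ (by positivity)]
  unfold zsZ zsB
  push_cast
  rw [show 2 * (n : ℝ) + 2 + 1 = 2 * (n + 1) + 1 by ring, show 2 * (n : ℝ) + 2 - 1 = 2 * n + 1 by ring]
  ring

lemma zsZ1s_spec {x : ℝ} (hx : 0 < x) :
    zsZs x 1 = 2 * x * (zsEta (-x) - zsEta (-x / 4) / 8) - x / (1 + x) := by
  have h := zsEta_odd (s := -x) (by linarith)
  have h2 := (hasSum_nat_add_iff' 1).2 h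
  have h3 := ((h.add h2).mul_left x)
  have e := (h3.congr_fun fun n => zsZ1_spec hx n).tsum_eq
  rw [zsZs, e, Finset.sum_range_one]
  push_cast
  have : 1 + x ≠ 0 := by positivity
  rw [show (2 * (0 : ℝ) + 1) * ((2 * 0 + 1) ^ 2 - -x) = 1 + x by ring]
  field_simp
  ring

theorem zs_partC {z : ℝ} (hz : 0 < z) (hz1 : z ^ 2 < 1 / 8) :
    ∑' n : ℕ, (z ^ 2) ^ (2 * n) * ∑' j, zsU (2 * n) j =
      -zsQ (-((z ^ 2) ^ 2 / 4)) + (z * zsrho z z) * zsm (z ^ 2) + zsm (-z ^ 2) / (z * zsrho z z) := by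
  have z1 : z < 1 := by nlinarith
  have hx : 0 < z ^ 2 := by positivity
  have hx1 : z ^ 2 < 1 := by linarith
  have r := zs_rho_pos hz hz z1
  have ht := zs_P_tendsto hz hz z1
  have H : ∀ α : ℝ, 0 < α → α < 1 → ∃ ρ : ℝ, ρ ≠ 0 ∧ Filter.Tendsto (zsP (z ^ 2) ρ α) Filter.atTop (nhds 1) :=
    fun α a0 a1 => ⟨_, (zs_rho_pos hz a0 a1).ne', zs_P_tendsto hz a0 a1⟩
  have B := zs_partB (z ^ 2) hx hz1 (zsP (z ^ 2) (zsrho z z) z) (zs_base_pos hx r.ne' hz z1 ht)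
    (fun k => zsP_rec hx r.ne' (zs_ni_of hz z1) k) ht
  set F := ∑' n : ℕ, (z ^ 2) ^ (2 * n) * ∑' j, zsU (2 * n) j with hF
  have Mm := zs_master hx hx1 r.ne' hz z1 ht B
  rw [zs_Ke hx hx1 H, zs_Ko hx hx1 H, zsXs_spec hz, zsZ1s_spec hx, zsZs_spec hz hz1] at Mm
  have Y := zsY_diff hz hz1
  have Y' : zsY (z ^ 2) z 2 + zsYt (z ^ 2) z = zsY (z ^ 2) 0 2 + zsYt (z ^ 2) 0 + z ^ 2 * zsm (z ^ 2) := by linarith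
  rw [Y'] at Mm
  have G : zsGh (z ^ 2) (zsrho z z) z (-(2 * z ^ 2 * F) - (zsP (z ^ 2) (zsrho z z) z 0 - 1 / zsP (z ^ 2) (zsrho z z) z 0)) = -z * F := by
    unfold zsGh
    rw [zsP]
    field_simp
    ring
  rw [G] at Mm
  have e : zsm (-z ^ 2) = 2 * zsEta (-z ^ 2) - zsEta (-z ^ 2 / 4) / 4 - zsEta (z ^ 2 / 4) / 4 - z ^ 2 / 4 * zsTh (-((z ^ 2) ^ 2 / 4)) := by
    unfold zsm
    rw [show - -z ^ 2 / 4 = z ^ 2 / 4 by ring, show -((-z ^ 2) ^ 2 / 4) = -((z ^ 2) ^ 2 / 4) by ring]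
    ring
  rw [e]
  generalize zsEta (-z ^ 2) = E1 at *
  generalize zsEta (-z ^ 2 / 4) = E2 at *
  generalize zsEta (z ^ 2 / 4) = E3 at *
  generalize zsTh (-((z ^ 2) ^ 2 / 4)) = E4 at *
  generalize zsQ (-((z ^ 2) ^ 2 / 4)) = E5 at *
  generalize zsm (z ^ 2) = E6 at *
  generalize zsrho z z = ρ at *
  generalize zsY (z ^ 2) 0 2 + zsYt (z ^ 2) 0 = E7 at *
  clear_value F
  have hF2 : F = -(1 / z) * (-z * F) := by field_simp
  rw [hF2, Mm]
  have : 1 + z ^ 2 ≠ 0 := by positivity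
  field_simp
  ring

lemma zs_zeta_hasSum {k : ℕ} (hk : 2 ≤ k) : HasSum (fun n : ℕ => 1 / ((n : ℂ) + 1) ^ k) (riemannZeta (k : ℂ)) := by
  have h : Summable (fun n : ℕ => 1 / (n : ℂ) ^ k) := by
    have := (Complex.summable_one_div_nat_cpow (p := (k : ℂ))).2 (by simp; omega)
    simpa [Complex.cpow_natCast] using this
  have e := zeta_nat_eq_tsum_of_gt_one (k := k) (by omega)
  rw [e]
  have h2 := (hasSum_nat_add_iff' 1).2 h.hasSum
  rw [Finset.sum_range_one] at h2
  simpa [show k ≠ 0 by omega] using h2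

lemma zs_swapD {f : ℕ → ℕ → ℂ} (S : Summable (fun a : ℕ × ℕ => f a.1 a.2)) {g h : ℕ → ℂ} (hg : ∀ n, HasSum (fun c => f n c) (g n))
    (hh : ∀ c, HasSum (fun n => f n c) (h c)) : HasSum h (∑' n, g n) := by
  have T := S.hasSum.prod_fiberwise hg
  have S' : Summable (fun a : ℕ × ℕ => f a.2 a.1) := S.prod_symm
  have T' := S'.hasSum.prod_fiberwise hh
  rw [T.tsum_eq, ← (Equiv.prodComm ℕ ℕ).tsum_eq (fun a : ℕ × ℕ => f a.1 a.2)]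
  exact T'

lemma zs_gen (p q : ℕ) (hp : 2 ≤ p) (s : ℂ) (hs : ‖s‖ < 1) :
    HasSum (fun c : ℕ => riemannZeta ((p + q * c : ℕ) : ℂ) * s ^ c)
      (∑' n : ℕ, 1 / (((n : ℂ) + 1) ^ p * (1 - s / ((n : ℂ) + 1) ^ q))) := by
  have nn : ∀ n : ℕ, ‖(n : ℂ) + 1‖ = (n : ℝ) + 1 := fun n => by
    rw [← Nat.cast_add_one, Complex.norm_natCast]; push_cast; rfl
  have n1 : ∀ n : ℕ, (n : ℂ) + 1 ≠ 0 := fun n => Nat.cast_add_one_ne_zero n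
  have S : Summable (fun a : ℕ × ℕ => (1 / ((a.1 : ℂ) + 1) ^ (p + q * a.2)) * s ^ a.2) := by
    have h1 : Summable (fun n : ℕ => ‖1 / ((n : ℂ) + 1) ^ p‖) := (zs_zeta_hasSum hp).summable.norm
    have h2 : Summable (fun c : ℕ => ‖s‖ ^ c) := summable_geometric_of_lt_one (norm_nonneg _) hs
    refine Summable.of_norm_bounded (h1.mul_of_nonneg h2 (fun _ => norm_nonneg _) (fun _ => by positivity)) fun a => ?_
    rw [norm_mul, norm_pow]
    gcongr
    rw [norm_div, norm_div, norm_pow, norm_pow, nn]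
    gcongr
    · have : (0 : ℝ) ≤ a.1 := Nat.cast_nonneg _
      linarith
    · omega
  have g : ∀ n : ℕ, HasSum (fun c : ℕ => (1 / ((n : ℂ) + 1) ^ (p + q * c)) * s ^ c) (1 / (((n : ℂ) + 1) ^ p * (1 - s / ((n : ℂ) + 1) ^ q))) := by
    intro n
    have b : ‖s / ((n : ℂ) + 1) ^ q‖ < 1 := by
      rw [norm_div, norm_pow, nn]
      refine lt_of_le_of_lt (div_le_self (norm_nonneg _) (one_le_pow₀ ?_)) hs
      have : (0 : ℝ) ≤ n := Nat.cast_nonneg _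
      linarith
    have := (hasSum_geometric_of_norm_lt_one b).mul_left (1 / ((n : ℂ) + 1) ^ p)
    rw [one_div_mul_eq_div, inv_eq_one_div, div_div, mul_comm] at this
    refine this.congr_fun fun c => ?_
    rw [div_pow, ← pow_mul, pow_add]
    have := n1 n
    field_simp
  exact zs_swapD (f := fun n c => (1 / ((n : ℂ) + 1) ^ (p + q * c)) * s ^ c) S g
    (fun c => (zs_zeta_hasSum (Nat.le_add_right_of_le hp)).mul_right (s ^ c))

lemma zs_cauchy {a b : ℕ → ℂ} {A B y : ℂ} (ha : HasSum (fun n => a n * y ^ n) A) (hb : HasSum (fun n => b n * y ^ n) B) :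
    HasSum (fun n => (∑ p ∈ Finset.HasAntidiagonal.antidiagonal n, a p.1 * b p.2) * y ^ n) (A * B) := by
  have h1 := ha.summable.norm
  have h2 := hb.summable.norm
  have t := tsum_mul_tsum_eq_tsum_sum_antidiagonal_of_summable_norm h1 h2
  have s := (summable_norm_sum_mul_antidiagonal_of_summable_norm h1 h2).of_norm.hasSum
  rw [← t, ha.tsum_eq, hb.tsum_eq] at s
  refine s.congr_fun fun n => ?_
  rw [Finset.sum_mul]
  refine Finset.sum_congr rfl fun p hp => ?_
  rw [← Finset.HasAntidiagonal.mem_antidiagonal.1 hp, pow_add]; ring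

lemma zs_unique {d : ℕ → ℂ} {r : ℝ} (hr : 0 < r) (h : ∀ y : ℝ, 0 < y → y < r → HasSum (fun n => d n * (y : ℂ) ^ n) 0) (N : ℕ) : d N = 0 := by
  have hs : Summable (fun n => d n * ((r / 2 : ℝ) : ℂ) ^ n) := (h (r / 2) (by linarith) (by linarith)).summable
  have hr2 : 0 < r / 2 := by linarith
  induction N using Nat.strong_induction_on with
  | _ N ih =>
  have hsN : Summable (fun n => ‖d (n + (N + 1)) * ((r / 2 : ℝ) : ℂ) ^ n‖) := by
    have := ((summable_nat_add_iff (N + 1)).2 hs).norm.mul_right (1 / ((r / 2) ^ (N + 1)))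
    refine this.congr fun n => ?_
    rw [norm_mul, norm_mul, norm_pow, norm_pow, Complex.norm_real, Real.norm_of_nonneg hr2.le, pow_add]
    field_simp
  set K := ∑' n, ‖d (n + (N + 1)) * ((r / 2 : ℝ) : ℂ) ^ n‖
  have bound : ∀ y : ℝ, 0 < y → y < r / 2 → ‖d N‖ ≤ y * K := by
    intro y y0 y1
    have hy := h y y0 (by linarith)
    have h2 := (hasSum_nat_add_iff' (N + 1)).2 hy
    rw [Finset.sum_range_succ, Finset.sum_eq_zero (fun i hi => by rw [ih i (Finset.mem_range.1 hi), zero_mul]), zero_add, zero_sub] at h2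
    have yc : (y : ℂ) ≠ 0 := by exact_mod_cast y0.ne'
    have h3 : HasSum (fun n => d (n + (N + 1)) * (y : ℂ) ^ n) (-(d N) / y) := by
      have := h2.mul_right (1 / (y : ℂ) ^ (N + 1))
      have e : -(d N * (y : ℂ) ^ N) * (1 / (y : ℂ) ^ (N + 1)) = -(d N) / y := by
        rw [pow_succ]; field_simp
      rw [e] at this
      refine this.congr_fun fun n => ?_
      rw [pow_add]; field_simp
    have b := tsum_of_norm_bounded hsN.hasSum (f := fun n => d (n + (N + 1)) * (y : ℂ) ^ n) (fun n => by
      rw [norm_mul, norm_mul, norm_pow, norm_pow, Complex.norm_real, Complex.norm_real, Real.norm_of_nonneg hr2.le, Real.norm_of_nonneg y0.le]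
      gcongr)
    rw [h3.tsum_eq, norm_div, norm_neg, Complex.norm_real, Real.norm_of_nonneg y0.le, div_le_iff₀ y0] at b
    linarith
  have t : Filter.Tendsto (fun y : ℝ => y * K) (nhdsWithin 0 (Set.Ioi 0)) (nhds 0) := by
    have : Filter.Tendsto (fun y : ℝ => y * K) (nhds 0) (nhds (0 * K)) := Filter.Tendsto.mul_const K Filter.tendsto_id
    rw [zero_mul] at this; exact this.mono_left nhdsWithin_le_nhds
  have := ge_of_tendsto t (by
    filter_upwards [Ioo_mem_nhdsGT hr2] with y hy
    exact bound y hy.1 hy.2)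
  exact norm_eq_zero.1 (le_antisymm this (norm_nonneg _))

lemma zsEta_series {s : ℝ} (hs : |s| < 1) : HasSum (fun c : ℕ => riemannZeta ((3 + 2 * c : ℕ) : ℂ) * (s : ℂ) ^ c) (zsEta s : ℂ) := by
  have h := zs_gen 3 2 (by norm_num) (s : ℂ) (by rwa [Complex.norm_real])
  convert h using 1
  unfold zsEta
  rw [Complex.ofReal_tsum]
  refine tsum_congr fun n => ?_
  have : (n : ℂ) + 1 ≠ 0 := Nat.cast_add_one_ne_zero n
  push_cast
  congr 1
  field_simp

lemma zsTh_series {s : ℝ} (hs : |s| < 1) : HasSum (fun c : ℕ => riemannZeta ((5 + 4 * c : ℕ) : ℂ) * (s : ℂ) ^ c) (zsTh s : ℂ) := by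
  have h := zs_gen 5 4 (by norm_num) (s : ℂ) (by rwa [Complex.norm_real])
  convert h using 1
  unfold zsTh
  rw [Complex.ofReal_tsum]
  refine tsum_congr fun n => ?_
  have : (n : ℂ) + 1 ≠ 0 := Nat.cast_add_one_ne_zero n
  push_cast
  congr 1
  field_simp

lemma zsQ_series {s : ℝ} (hs : |s| < 1) : HasSum (fun c : ℕ => riemannZeta ((3 + 4 * c : ℕ) : ℂ) * (s : ℂ) ^ c) (zsQ s : ℂ) := by
  have h := zs_gen 3 4 (by norm_num) (s : ℂ) (by rwa [Complex.norm_real])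
  convert h using 1
  unfold zsQ
  rw [Complex.ofReal_tsum]
  refine tsum_congr fun n => ?_
  have n1 : (n : ℂ) + 1 ≠ 0 := Nat.cast_add_one_ne_zero n
  push_cast
  rw [show ((n : ℂ) + 1) ^ 3 * (1 - (s : ℂ) / ((n : ℂ) + 1) ^ 4) = (((n : ℂ) + 1) ^ 4 - s) / ((n : ℂ) + 1) by field_simp]
  rw [one_div_div]

lemma zs_tau {w : ℂ} (hw : ‖w‖ < 1) (w0 : w ≠ 0) :
    HasSum (fun b : ℕ => riemannZeta ((2 * b : ℕ) : ℂ) * (w ^ 2) ^ b) (-(Real.pi * w / 2) * Complex.cot (Real.pi * w)) := by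
  have hc : w ∈ Complex.integerComplement := by
    rintro ⟨m, rfl⟩
    rw [Complex.norm_intCast] at hw
    have : |m| < 1 := by exact_mod_cast hw
    rw [Int.abs_lt_one_iff] at this
    apply w0; rw [this]; simp
  have c := cot_series_rep' hc
  have h := zs_gen 2 2 le_rfl (w ^ 2) (by rw [norm_pow]; exact pow_lt_one₀ (norm_nonneg _) hw (by norm_num))
  have e : ∑' n : ℕ, (1 / (w - (n + 1)) + 1 / (w + (n + 1))) = -2 * w * ∑' n : ℕ, 1 / (((n : ℂ) + 1) ^ 2 * (1 - w ^ 2 / ((n : ℂ) + 1) ^ 2)) := by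
    rw [← tsum_mul_left]
    refine tsum_congr fun n => ?_
    have n1 : (n : ℂ) + 1 ≠ 0 := Nat.cast_add_one_ne_zero n
    have m1 : w - (n + 1) ≠ 0 := fun e => hc ⟨(n : ℤ) + 1, by push_cast; linear_combination -e⟩
    have m2 : w + (n + 1) ≠ 0 := fun e => hc ⟨-((n : ℤ) + 1), by push_cast; linear_combination -e⟩
    rw [show ((n : ℂ) + 1) ^ 2 * (1 - w ^ 2 / ((n : ℂ) + 1) ^ 2) = -((w - (n + 1)) * (w + (n + 1))) by field_simp; ring]
    field_simp
    ring
  rw [e] at c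
  generalize ∑' n : ℕ, 1 / (((n : ℂ) + 1) ^ 2 * (1 - w ^ 2 / ((n : ℂ) + 1) ^ 2)) = W at *
  have h2 := h.mul_left (w ^ 2)
  have v : -(Real.pi * w / 2) * Complex.cot (Real.pi * w) = w ^ 2 * W + ∑ i ∈ Finset.range 1, riemannZeta ((2 * i : ℕ) : ℂ) * (w ^ 2) ^ i := by
    rw [Finset.sum_range_one]
    simp only [mul_zero, Nat.cast_zero, riemannZeta_zero, pow_zero, mul_one]
    have : Real.pi * Complex.cot (Real.pi * w) = 1 / w + -2 * w * W := by linear_combination c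
    rw [show -(Real.pi * w / 2) * Complex.cot (Real.pi * w) = -(w / 2) * (Real.pi * Complex.cot (Real.pi * w)) by ring, this]
    field_simp
    ring
  rw [v]
  refine (hasSum_nat_add_iff 1).1 (h2.congr_fun fun n => ?_)
  rw [show 2 * (n + 1) = 2 + 2 * n by ring]
  ring

/-- coefficients -/
noncomputable def zst1 (a : ℕ) : ℂ := (-1) ^ a * (1 - 4 ^ a) / 4 ^ a * riemannZeta ((2 * a : ℕ) : ℂ)
noncomputable def zst2 (b : ℕ) : ℂ := riemannZeta ((2 * b : ℕ) : ℂ) / 4 ^ b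
noncomputable def zskap (c : ℕ) : ℂ :=
  2 * (if Even c then 1 else 0) + (2 * Complex.I) ^ (c + 1) * (if Odd c then 1 else 0) - 8 * 4 ^ c
noncomputable def zsmc (c : ℕ) : ℂ := -zskap c / 4 ^ c / 4 * riemannZeta ((3 + 2 * c : ℕ) : ℂ)
noncomputable def zsnu (k : ℕ) : ℂ := ∑ p ∈ Finset.HasAntidiagonal.antidiagonal k,
  (∑ q ∈ Finset.HasAntidiagonal.antidiagonal p.1, zst1 q.1 * zst2 q.2) * zsmc p.2

lemma zst2_series {v : ℂ} (hv : ‖v‖ < 1) (v0 : v ≠ 0) :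
    HasSum (fun b => zst2 b * (v ^ 2) ^ b) (-(Real.pi * v / 4) * Complex.cot (Real.pi * v / 2)) := by
  have h := zs_tau (w := v / 2) (by rw [norm_div]; simp; linarith) (by simpa using v0)
  rw [show -(Real.pi * (v / 2) / 2) * Complex.cot (Real.pi * (v / 2)) = -(Real.pi * v / 4) * Complex.cot (Real.pi * v / 2) by ring_nf] at h
  refine h.congr_fun fun b => ?_
  unfold zst2
  rw [div_pow, div_pow]; norm_num; ring

lemma zs_cot_tan (a : ℂ) (h1 : Complex.sin a ≠ 0) (h2 : Complex.cos a ≠ 0) : 2 * Complex.cot (2 * a) - Complex.cot a = -Complex.tan a := by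
  unfold Complex.cot Complex.tan
  rw [Complex.sin_two_mul, Complex.cos_two_mul]
  field_simp
  linear_combination Complex.sin_sq_add_cos_sq a

lemma zst1_series {v : ℂ} (hv : ‖v‖ < 1) (v0 : v ≠ 0) (h1 : Complex.sin (Real.pi * v * Complex.I / 2) ≠ 0)
    (h2 : Complex.cos (Real.pi * v * Complex.I / 2) ≠ 0) :
    HasSum (fun b => zst1 b * (v ^ 2) ^ b) (-(Real.pi * v * Complex.I / 4) * Complex.tan (Real.pi * v * Complex.I / 2)) := by
  have h := zs_tau (w := v * Complex.I / 2) (by simp; linarith) (by simpa using v0)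
  have h' := zs_tau (w := v * Complex.I) (by simpa using hv) (by simpa using v0)
  have t := zs_cot_tan _ h1 h2
  have k := h.sub h'
  have e : -(Real.pi * (v * Complex.I / 2) / 2) * Complex.cot (Real.pi * (v * Complex.I / 2)) - -(Real.pi * (v * Complex.I) / 2) * Complex.cot (Real.pi * (v * Complex.I)) =
      -(Real.pi * v * Complex.I / 4) * Complex.tan (Real.pi * v * Complex.I / 2) := by
    rw [show Real.pi * (v * Complex.I) = 2 * (Real.pi * v * Complex.I / 2) by ring, show Real.pi * (v * Complex.I / 2) = Real.pi * v * Complex.I / 2 by ring]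
    linear_combination (Real.pi * v * Complex.I / 4) * t
  rw [e] at k
  refine k.congr_fun fun b => ?_
  unfold zst1
  have a1 : ((v * Complex.I / 2) ^ 2) ^ b = (-1) ^ b * (v ^ 2) ^ b / 4 ^ b := by
    rw [div_pow, mul_pow, Complex.I_sq, div_pow, mul_comm, mul_pow]; norm_num
  have a2 : ((v * Complex.I) ^ 2) ^ b = (-1) ^ b * (v ^ 2) ^ b := by
    rw [mul_pow, Complex.I_sq, mul_comm, mul_pow]
  rw [a1, a2]
  field_simp

lemma zsmc_series {y : ℝ} (hy : |y| < 1) : HasSum (fun c => zsmc c * (y : ℂ) ^ c) (zsm y : ℂ) := by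
  have y4 : |y / 4| < 1 := by rw [abs_div]; norm_num; linarith
  have y4' : |-y / 4| < 1 := by rw [abs_div, abs_neg]; norm_num; linarith
  have y5 : |-(y ^ 2 / 4)| < 1 := by
    rw [abs_neg, abs_of_nonneg (by positivity)]
    have := abs_lt.1 hy
    nlinarith
  have t := (zsTh_series y5).mul_left ((y : ℂ) / 4)
  have t' : HasSum (fun c : ℕ => (if Odd c then (1 / 4) * (-1 / 4) ^ ((c - 1) / 2) * riemannZeta ((3 + 2 * c : ℕ) : ℂ) else 0) * (y : ℂ) ^ c)
      (0 + (y : ℂ) / 4 * (zsTh (-(y ^ 2 / 4)) : ℂ)) := by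
    apply HasSum.even_add_odd
    · convert hasSum_zero (α := ℂ) (β := ℕ) using 2 with k
      simp
    · refine t.congr_fun fun l => ?_
      rw [if_pos (by simp), show (2 * l + 1 - 1) / 2 = l by omega, show 3 + 2 * (2 * l + 1) = 5 + 4 * l by ring]
      push_cast
      rw [show (-((y : ℂ) ^ 2 / 4)) = (-1 / 4) * y ^ 2 by ring, mul_pow, pow_succ, pow_mul]
      ring
  have k := ((((zsEta_series hy).mul_left 2).sub ((zsEta_series y4).div_const 4)).sub ((zsEta_series y4').div_const 4)).add t'
  rw [zero_add] at k
  have e : ((zsm y : ℝ) : ℂ) = 2 * (zsEta y : ℂ) - zsEta (y / 4) / 4 - zsEta (-y / 4) / 4 + (y : ℂ) / 4 * (zsTh (-(y ^ 2 / 4)) : ℂ) := by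
    unfold zsm; push_cast; rfl
  rw [e]
  refine k.congr_fun fun c => ?_
  unfold zsmc zskap
  push_cast
  rw [show -(y : ℂ) / 4 = (-1) * (y / 4) by ring, mul_pow (-1 : ℂ), div_pow]
  rcases Nat.even_or_odd' c with ⟨l, rfl | rfl⟩
  · have ne : ¬ Odd (2 * l) := by simp
    rw [if_pos (by simp), if_neg ne, if_neg ne, pow_mul (-1 : ℂ)]
    norm_num
    field_simp
    ring
  · have ne : ¬ Even (2 * l + 1) := by simp
    have o : Odd (2 * l + 1) := by simp
    rw [if_neg ne, if_pos o, if_pos o, show (2 * l + 1 - 1) / 2 = l by omega]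
    have i1 : (2 * Complex.I) ^ (2 * l + 1 + 1) = (-4) * (-4) ^ l := by
      rw [show 2 * l + 1 + 1 = 2 * (l + 1) by ring, pow_mul, mul_pow, Complex.I_sq, pow_succ]; norm_num; ring
    have i2 : (-1 / 4 : ℂ) ^ l = (-4) ^ l / 4 ^ (2 * l) := by
      rw [pow_mul, ← div_pow]; norm_num
    have i3 : (-1 : ℂ) ^ (2 * l + 1) = -1 := Odd.neg_one_pow o
    rw [i1, i2, i3, pow_succ (4 : ℂ)]
    field_simp
    ring

lemma zs_N {v : ℂ} {y : ℝ} (hv : ‖v‖ < 1) (v0 : v ≠ 0) (hy : v ^ 2 = (y : ℂ)) (hy1 : |y| < 1) (h1 : Complex.sin (Real.pi * v * Complex.I / 2) ≠ 0)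
    (h2 : Complex.cos (Real.pi * v * Complex.I / 2) ≠ 0) :
    HasSum (fun k => zsnu k * (y : ℂ) ^ k) ((Real.pi ^ 2 * Complex.I * y / 16) * (Complex.tan (Real.pi * v * Complex.I / 2) * Complex.cot (Real.pi * v / 2)) * zsm y) := by
  have a := zst1_series hv v0 h1 h2
  have b := zst2_series hv v0
  rw [hy] at a b
  have c := zs_cauchy (zs_cauchy a b) (zsmc_series hy1)
  have e : (Real.pi ^ 2 * Complex.I * y / 16) * (Complex.tan (Real.pi * v * Complex.I / 2) * Complex.cot (Real.pi * v / 2)) * zsm y =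
      -(Real.pi * v * Complex.I / 4) * Complex.tan (Real.pi * v * Complex.I / 2) * (-(Real.pi * v / 4) * Complex.cot (Real.pi * v / 2)) * zsm y := by
    rw [← hy]; ring
  rw [e]
  exact c

lemma zs_N_pos {z : ℝ} (hz : 0 < z) (hz1 : z < 1) :
    HasSum (fun k => zsnu k * ((z ^ 2 : ℝ) : ℂ) ^ k) (-(Real.pi ^ 2 * (z ^ 2 : ℝ) / 16) * (z * zsrho z z : ℝ) * zsm (z ^ 2)) := by
  have p := Real.pi_pos
  have c : 0 < Real.cos (Real.pi * z / 2) := Real.cos_pos_of_mem_Ioo ⟨by nlinarith, by nlinarith⟩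
  have s : 0 < Real.sin (Real.pi * z / 2) := Real.sin_pos_of_pos_of_lt_pi (by positivity) (by nlinarith)
  have s2 : 0 < Real.sinh (Real.pi * z / 2) := Real.sinh_pos_iff.2 (by positivity)
  have c2 := Real.cosh_pos (Real.pi * z / 2)
  have e1 : Complex.sin (Real.pi * (z : ℂ) * Complex.I / 2) = (Real.sinh (Real.pi * z / 2) : ℂ) * Complex.I := by
    push_cast; rw [← Complex.sin_mul_I]; ring_nf
  have e2 : Complex.cos (Real.pi * (z : ℂ) * Complex.I / 2) = (Real.cosh (Real.pi * z / 2) : ℂ) := by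
    push_cast; rw [← Complex.cos_mul_I]; ring_nf
  have c2' : (Real.cosh (Real.pi * z / 2) : ℂ) ≠ 0 := by exact_mod_cast c2.ne'
  have s2' : (Real.sinh (Real.pi * z / 2) : ℂ) ≠ 0 := by exact_mod_cast s2.ne'
  have h := zs_N (v := (z : ℂ)) (y := z ^ 2) (by rw [Complex.norm_real, Real.norm_of_nonneg hz.le]; exact hz1) (by exact_mod_cast hz.ne') (by push_cast; rfl)
    (by rw [abs_of_nonneg (by positivity)]; nlinarith) (by rw [e1]; exact mul_ne_zero s2' Complex.I_ne_zero) (by rw [e2]; exact c2')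
  convert h using 1
  have e3 : Complex.cot (Real.pi * (z : ℂ) / 2) = (Real.cos (Real.pi * z / 2) : ℂ) / (Real.sin (Real.pi * z / 2) : ℂ) := by
    unfold Complex.cot; push_cast; rfl
  have e4 : z * zsrho z z = Real.cos (Real.pi * z / 2) / Real.sin (Real.pi * z / 2) *
      (Real.sinh (Real.pi * z / 2) / Real.cosh (Real.pi * z / 2)) := by
    unfold zsrho; field_simp
  rw [e3, e4, Complex.tan, e1, e2]
  rw [Complex.ofReal_mul, Complex.ofReal_div, Complex.ofReal_div]
  linear_combination (Real.pi ^ 2 * (z ^ 2 : ℝ) / 16) * (((Real.cos (Real.pi * z / 2) : ℂ) / (Real.sin (Real.pi * z / 2) : ℂ)) * ((Real.sinh (Real.pi * z / 2) : ℂ) / (Real.cosh (Real.pi * z / 2) : ℂ))) * (zsm (z ^ 2) : ℂ) * (-1) * Complex.I_mul_I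

lemma zs_N_neg {z : ℝ} (hz : 0 < z) (hz1 : z < 1) :
    HasSum (fun k => zsnu k * ((-z ^ 2 : ℝ) : ℂ) ^ k) ((Real.pi ^ 2 * (z ^ 2 : ℝ) / 16) / (z * zsrho z z : ℝ) * zsm (-z ^ 2)) := by
  have p := Real.pi_pos
  have c : 0 < Real.cos (Real.pi * z / 2) := Real.cos_pos_of_mem_Ioo ⟨by nlinarith, by nlinarith⟩
  have s : 0 < Real.sin (Real.pi * z / 2) := Real.sin_pos_of_pos_of_lt_pi (by positivity) (by nlinarith)
  have s2 : 0 < Real.sinh (Real.pi * z / 2) := Real.sinh_pos_iff.2 (by positivity)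
  have c2 := Real.cosh_pos (Real.pi * z / 2)
  have ii : Real.pi * ((z : ℂ) * Complex.I) * Complex.I / 2 = -(Real.pi * z / 2) := by
    linear_combination (Real.pi * z / 2 : ℂ) * Complex.I_mul_I
  have e1 : Complex.sin (Real.pi * ((z : ℂ) * Complex.I) * Complex.I / 2) = -(Real.sin (Real.pi * z / 2) : ℂ) := by
    push_cast; rw [ii, Complex.sin_neg]
  have e2 : Complex.cos (Real.pi * ((z : ℂ) * Complex.I) * Complex.I / 2) = (Real.cos (Real.pi * z / 2) : ℂ) := by
    push_cast; rw [ii, Complex.cos_neg]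
  have c' : (Real.cos (Real.pi * z / 2) : ℂ) ≠ 0 := by exact_mod_cast c.ne'
  have s' : (Real.sin (Real.pi * z / 2) : ℂ) ≠ 0 := by exact_mod_cast s.ne'
  have c2' : (Real.cosh (Real.pi * z / 2) : ℂ) ≠ 0 := by exact_mod_cast c2.ne'
  have s2' : (Real.sinh (Real.pi * z / 2) : ℂ) ≠ 0 := by exact_mod_cast s2.ne'
  have h := zs_N (v := (z : ℂ) * Complex.I) (y := -z ^ 2) (by rw [norm_mul, Complex.norm_I, mul_one, Complex.norm_real, Real.norm_of_nonneg hz.le]; exact hz1)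
    (mul_ne_zero (by exact_mod_cast hz.ne') Complex.I_ne_zero) (by push_cast; rw [mul_pow, Complex.I_sq]; ring)
    (by rw [abs_neg, abs_of_nonneg (by positivity)]; nlinarith) (by rw [e1]; exact neg_ne_zero.2 s') (by rw [e2]; exact c')
  convert h using 1
  have e3 : Complex.cot (Real.pi * ((z : ℂ) * Complex.I) / 2) = (Real.cosh (Real.pi * z / 2) : ℂ) / ((Real.sinh (Real.pi * z / 2) : ℂ) * Complex.I) := by
    unfold Complex.cot; push_cast; rw [← Complex.sin_mul_I, ← Complex.cos_mul_I]; ring_nf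
  have e4 : z * zsrho z z = Real.cos (Real.pi * z / 2) / Real.sin (Real.pi * z / 2) *
      (Real.sinh (Real.pi * z / 2) / Real.cosh (Real.pi * z / 2)) := by
    unfold zsrho; field_simp
  rw [e3, e4, Complex.tan, e1, e2]
  rw [Complex.ofReal_mul, Complex.ofReal_div, Complex.ofReal_div, Complex.ofReal_neg]
  generalize (Real.cos (Real.pi * z / 2) : ℂ) = C at *
  generalize (Real.sin (Real.pi * z / 2) : ℂ) = S at *
  generalize (Real.sinh (Real.pi * z / 2) : ℂ) = S2 at *
  generalize (Real.cosh (Real.pi * z / 2) : ℂ) = C2 at *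
  have := Complex.I_ne_zero
  field_simp

/-- the generating function identity expressed as a power series -/
lemma zs_series {z : ℝ} (hz : 0 < z) (hz1 : z < 1) :
    HasSum (fun n : ℕ => (-(32 / (Real.pi : ℂ) ^ 2) * zsnu (2 * n + 1)) * (((z ^ 2) ^ 2 : ℝ) : ℂ) ^ n)
      (((z * zsrho z z) * zsm (z ^ 2) + zsm (-z ^ 2) / (z * zsrho z z) : ℝ) : ℂ) := by
  have h := (zs_N_pos hz hz1).sub (zs_N_neg hz hz1)
  have inj : Function.Injective (fun n : ℕ => 2 * n + 1) := fun a b h => by simpa using h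
  rw [← inj.hasSum_iff (by
    intro k hk
    have : Even k := by
      by_contra ho
      obtain ⟨l, rfl⟩ := Nat.not_even_iff_odd.1 ho
      exact hk ⟨l, rfl⟩
    rw [Complex.ofReal_neg, this.neg_pow, sub_self])] at h
  have p : (Real.pi : ℂ) ≠ 0 := by exact_mod_cast Real.pi_ne_zero
  have z0 : (z : ℂ) ≠ 0 := by exact_mod_cast hz.ne'
  have r0 : (zsrho z z : ℂ) ≠ 0 := by exact_mod_cast (zs_rho_pos hz hz hz1).ne'
  have k := h.mul_left (-(16 / ((Real.pi : ℂ) ^ 2 * z ^ 2)))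
  have e : -(16 / ((Real.pi : ℂ) ^ 2 * z ^ 2)) * (-(Real.pi ^ 2 * (z ^ 2 : ℝ) / 16) * (z * zsrho z z : ℝ) * zsm (z ^ 2) - (Real.pi ^ 2 * (z ^ 2 : ℝ) / 16) / (z * zsrho z z : ℝ) * zsm (-z ^ 2)) = (((z * zsrho z z) * zsm (z ^ 2) + zsm (-z ^ 2) / (z * zsrho z z) : ℝ) : ℂ) := by
    push_cast
    field_simp
    ring
  rw [e] at k
  refine k.congr_fun fun n => ?_
  simp only [Function.comp]
  have o : Odd (2 * n + 1) := by simp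
  rw [Complex.ofReal_neg, o.neg_pow, pow_succ _ (2 * n), pow_mul]
  push_cast
  field_simp
  ring

theorem zs_coeff (n : ℕ) : ((∑' j, zsU (2 * n) j : ℝ) : ℂ) =
    -(riemannZeta ((3 + 4 * n : ℕ) : ℂ) * (-1 / 4) ^ n) - 32 / (Real.pi : ℂ) ^ 2 * zsnu (2 * n + 1) := by
  have key := zs_unique (d := fun n => ((∑' j, zsU (2 * n) j : ℝ) : ℂ) + riemannZeta ((3 + 4 * n : ℕ) : ℂ) * (-1 / 4) ^ n
    + 32 / (Real.pi : ℂ) ^ 2 * zsnu (2 * n + 1)) (r := 1 / 64) (by norm_num) (fun y y0 y1 => by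
      set z := Real.sqrt (Real.sqrt y) with hz
      have z2 : z ^ 2 = Real.sqrt y := Real.sq_sqrt (Real.sqrt_nonneg _)
      have z4 : (z ^ 2) ^ 2 = y := by rw [z2]; exact Real.sq_sqrt y0.le
      have z0 : 0 < z := Real.sqrt_pos.2 (Real.sqrt_pos.2 y0)
      have zx : z ^ 2 < 1 / 8 := by nlinarith [sq_nonneg z]
      have z1 : z < 1 := by nlinarith
      have C := zs_partC z0 zx
      have hser := zs_series z0 z1
      have hQ := zsQ_series (s := -((z ^ 2) ^ 2 / 4)) (by rw [abs_neg, abs_of_nonneg (by positivity), z4]; linarith)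
      have hF : Summable (fun n : ℕ => (z ^ 2) ^ (2 * n) * ∑' j, zsU (2 * n) j) := by
        have g : Summable (fun n : ℕ => 4 * (16 * y) ^ n) := (summable_geometric_of_lt_one (by positivity) (by linarith)).mul_left 4
        refine Summable.of_norm_bounded g fun n => ?_
        rw [norm_mul, norm_pow, Real.norm_of_nonneg (by positivity), pow_mul, z4, Real.norm_eq_abs]
        have := zsU_tsum_bound (2 * n)
        calc y ^ n * |∑' j, zsU (2 * n) j| ≤ y ^ n * (4 * 4 ^ (2 * n)) := by gcongr
          _ = 4 * (16 * y) ^ n := by rw [mul_pow, pow_mul]; norm_num; ring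
      have hF' := Complex.hasSum_ofReal.2 hF.hasSum
      rw [C] at hF'
      have t := (hF'.add hQ).sub hser
      have v : (((-zsQ (-((z ^ 2) ^ 2 / 4)) + (z * zsrho z z) * zsm (z ^ 2) + zsm (-z ^ 2) / (z * zsrho z z) : ℝ) : ℂ)) + ((zsQ (-((z ^ 2) ^ 2 / 4)) : ℝ) : ℂ)
        - (((z * zsrho z z) * zsm (z ^ 2) + zsm (-z ^ 2) / (z * zsrho z z) : ℝ) : ℂ) = 0 := by
        push_cast; ring
      rw [v] at t
      refine t.congr_fun fun n => ?_
      rw [pow_mul, z4]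
      rw [show ((-(y / 4) : ℝ) : ℂ) = (-1 / 4) * y by push_cast; ring, mul_pow]
      push_cast
      ring) n
  linear_combination key

lemma zs_triple (k : ℕ) (g : ℕ → ℕ → ℕ → ℂ) :
    ∑ p ∈ Finset.HasAntidiagonal.antidiagonal k, ∑ q ∈ Finset.HasAntidiagonal.antidiagonal p.1, g q.1 q.2 p.2 =
      ∑ p ∈ (Finset.range (k + 1) ×ˢ Finset.range (k + 1) ×ˢ Finset.range (k + 1)).filter
        (fun p => p.1 + p.2.1 + p.2.2 = k), g p.1 p.2.1 p.2.2 := by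
  rw [Finset.sum_sigma']
  refine Finset.sum_bij' (fun s _ => (s.2.1, s.2.2, s.1.2)) (fun p _ => ⟨(p.1 + p.2.1, p.2.2), (p.1, p.2.1)⟩) ?_ ?_ ?_ ?_ ?_
  · rintro ⟨⟨i, c⟩, ⟨a, b⟩⟩ h
    simp only [Finset.mem_sigma, Finset.HasAntidiagonal.mem_antidiagonal] at h
    simp only [Finset.mem_filter, Finset.mem_product, Finset.mem_range]
    omega
  · rintro ⟨a, b, c⟩ h
    simp only [Finset.mem_filter, Finset.mem_product, Finset.mem_range] at h
    simp only [Finset.mem_sigma, Finset.HasAntidiagonal.mem_antidiagonal, and_true]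
    omega
  · rintro ⟨⟨i, c⟩, ⟨a, b⟩⟩ h
    simp only [Finset.mem_sigma, Finset.HasAntidiagonal.mem_antidiagonal] at h
    obtain ⟨h1, h2⟩ := h
    subst h2
    rfl
  · rintro ⟨a, b, c⟩ h
    rfl
  · rintro ⟨⟨i, c⟩, ⟨a, b⟩⟩ h
    rfl

lemma zsnu_eq (n : ℕ) : -(32 / (Real.pi : ℂ) ^ 2) * zsnu (2 * n + 1) = 1 / (3 * riemannZeta 2) *
          ∑ p ∈ (Finset.range (2 * n + 2) ×ˢ Finset.range (2 * n + 2) ×ˢ Finset.range (2 * n + 2)).filter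
              (fun p => p.1 + p.2.1 + p.2.2 = 2 * n + 1),
            (-1 : ℂ) ^ p.1 * (1 - 2 ^ (2 * p.1)) / 16 ^ n * riemannZeta (2 * p.1) * riemannZeta (2 * p.2.1) *
              riemannZeta (2 * p.2.2 + 3) *
              (2 * (if Even p.2.2 then 1 else 0) + (2 * Complex.I) ^ (p.2.2 + 1) * (if Odd p.2.2 then 1 else 0) - 8 * 4 ^ p.2.2) := by
  have p : (Real.pi : ℂ) ≠ 0 := by exact_mod_cast Real.pi_ne_zero
  unfold zsnu
  simp only [Finset.sum_mul]
  rw [zs_triple (2 * n + 1) (fun a b c => zst1 a * zst2 b * zsmc c), riemannZeta_two, Finset.mul_sum, Finset.mul_sum]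
  refine Finset.sum_congr rfl ?_
  rintro ⟨a, b, c⟩ h
  have h := (Finset.mem_filter.1 h).2
  simp only at h ⊢
  unfold zst1 zst2 zsmc
  rw [show 2 * (if Even c then 1 else 0) + (2 * Complex.I) ^ (c + 1) * (if Odd c then 1 else 0) - 8 * 4 ^ c = zskap c from rfl]
  have e : (4 : ℂ) ^ a * 4 ^ b * 4 ^ c = 4 * 16 ^ n := by
    rw [← pow_add, ← pow_add, h, pow_succ, pow_mul]; norm_num; ring
  have e2 : (2 : ℂ) ^ (2 * a) = 4 ^ a := by rw [pow_mul]; norm_num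
  have e3 : (((3 + 2 * c : ℕ)) : ℂ) = 2 * c + 3 := by push_cast; ring
  rw [e2, e3]
  push_cast
  generalize riemannZeta (2 * (a : ℂ)) = A
  generalize riemannZeta (2 * (b : ℂ)) = B
  generalize riemannZeta (2 * (c : ℂ) + 3) = C
  generalize zskap c = K
  calc _ = 8 / (Real.pi : ℂ) ^ 2 * ((-1) ^ a * (1 - 4 ^ a) * A * B * K * C) / ((4 : ℂ) ^ a * 4 ^ b * 4 ^ c) := by
        field_simp; ring
    _ = _ := by rw [e]; field_simp; ring

/-- The evaluation of `ζ⋆(1, 2, {1,3}^n)` in terms of Riemann zeta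
values (with the convention `ζ(0) = −1/2`, which `riemannZeta` satisfies). -/
theorem zetaStar_1_2_1313 (n : ℕ) :
    ((zetaStar (Fin.cons 1 (Fin.cons 2 (pat13 n))) : ℝ) : ℂ) =
      -riemannZeta (4 * n + 3) / (-4 : ℂ) ^ n
      + 1 / (3 * riemannZeta 2) *
          ∑ p ∈ (Finset.range (2 * n + 2) ×ˢ Finset.range (2 * n + 2) ×ˢ
              Finset.range (2 * n + 2)).filter
              (fun p => p.1 + p.2.1 + p.2.2 = 2 * n + 1),
            (-1 : ℂ) ^ p.1 * (1 - 2 ^ (2 * p.1)) / 16 ^ n *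
              riemannZeta (2 * p.1) * riemannZeta (2 * p.2.1) *
              riemannZeta (2 * p.2.2 + 3) *
              (2 * (if Even p.2.2 then 1 else 0)
                + (2 * Complex.I) ^ (p.2.2 + 1) * (if Odd p.2.2 then 1 else 0)
                - 8 * 4 ^ p.2.2) := by
  rw [zs_partA, zs_coeff, sub_eq_add_neg, ← neg_mul (32 / (Real.pi : ℂ) ^ 2), zsnu_eq]
  congr 1
  rw [show (((3 + 4 * n : ℕ)) : ℂ) = 4 * n + 3 by push_cast; ring,
    show (-1 / 4 : ℂ) = (-4)⁻¹ by norm_num, inv_pow]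
  rw [neg_div, div_eq_mul_inv]
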